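/- Let (R,m) be a Noetherian local ring and M a finitely generated R-module with r = dim_R M ≥ 2. Let U = U_{M̂}(0) be the unmixed component of (0) in the m-adic completion M̂. Then the following are equivalent: (1) Λ(M) = {e_1(Q,M) : Q a parameter ideal for M} is a finite set; (2) dim_{R̂} U ≤ r−2 and M̂/U is a generalized Cohen–Macaulay R̂-module. When this is the case, 0 ≥ e_1(Q,M) ≥ −Σ_{i=1}^{r−1} C(r−2, i−1) · h^i(M̂/U) for every parameter ideal Q for M, where h^i denotes the length of the i-th local cohomology module with support in the maximal ideal. -/

import Mathlib

open IsLocalRing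

section Defs

variable (R : Type) [CommRing R]

/-- The length of a module, as the Krull dimension of its lattice of submodules. -/
noncomputable def mLength (M : Type) [AddCommGroup M] [Module R M] : WithBot ℕ∞ :=
  Order.krullDim (Submodule R M)

/-- The (Krull) dimension of a module. -/
noncomputable def mDim (M : Type) [AddCommGroup M] [Module R M] : WithBot ℕ∞ :=
  ringKrullDim (R ⧸ Submodule.annihilator (⊤ : Submodule R M))

/-- `f` is eventually given by the Hilbert-type polynomial of degree `t` with
coefficients `s 0, …, s t` (written in the binomial basis with alternating signs). -/
def IsHilbPolyAt (f : ℕ → WithBot ℕ∞) (t : ℕ) (s : ℕ → ℤ) : Prop :=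
  ∃ N : ℕ, ∀ n ≥ N, ∃ l : ℕ, f n = (l : ℕ∞) ∧
    (l : ℤ) = ∑ i ∈ Finset.range (t + 1), (-1 : ℤ) ^ i * s i * ((n + t - i).choose (t - i) : ℤ)

/-- `s 0, …, s t` are the Hilbert coefficients `e_i(I, M)`, i.e.
`λ(M/I^{n+1}M) = ∑ (-1)^i e_i(I,M) C(n+t-i, t-i)` for `n ≫ 0`. -/
def HasHilbCoeffs (I : Ideal R) (M : Type) [AddCommGroup M] [Module R M]
    (t : ℕ) (s : ℕ → ℤ) : Prop :=
  IsHilbPolyAt (fun n => mLength R (M ⧸ (I ^ (n + 1) • (⊤ : Submodule R M)))) t s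

/-- The unmixed component `U_M(0)` of `M`: the largest submodule of dimension `< dim M`. -/
noncomputable def unmixedComp (M : Type) [AddCommGroup M] [Module R M] : Submodule R M :=
  sSup {N : Submodule R M | mDim R ↥N < mDim R M}

/-- `x` is a d-sequence on `M`. -/
def IsDSeq {r : ℕ} (x : Fin r → R) (M : Type) [AddCommGroup M] [Module R M] : Prop :=
  ∀ i j : Fin r, i ≤ j →
    Submodule.comap (LinearMap.lsmul R M (x i * x j))
        (Ideal.span (x '' {k | k < i}) • (⊤ : Submodule R M))
      = Submodule.comap (LinearMap.lsmul R M (x j))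
        (Ideal.span (x '' {k | k < i}) • (⊤ : Submodule R M))

/-- `x` is a standard (d⁺-) system: all power sequences in any order are d-sequences. -/
def IsStandardSeq {r : ℕ} (x : Fin r → R) (M : Type) [AddCommGroup M] [Module R M] : Prop :=
  ∀ n : Fin r → ℕ, (∀ k, 1 ≤ n k) → ∀ σ : Equiv.Perm (Fin r),
    IsDSeq R (fun k => x (σ k) ^ n (σ k)) M

/-- The integral closure of an ideal, as a set. -/
def intClos (Q : Ideal R) : Set R :=
  {x : R | ∃ n : ℕ, 0 < n ∧ ∃ a : ℕ → R, (∀ i, 1 ≤ i → i ≤ n → a i ∈ Q ^ i) ∧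
    x ^ n + ∑ i ∈ Finset.Icc 1 n, a i * x ^ (n - i) = 0}

variable [IsLocalRing R]

/-- `h ∈ I` is superficial for `M` with respect to `I`. -/
def IsSuperficial (I : Ideal R) (M : Type) [AddCommGroup M] [Module R M] (h : R) : Prop :=
  h ∈ I ∧ ∃ c N : ℕ, ∀ n ≥ N,
    Submodule.comap (LinearMap.lsmul R M h) (I ^ (n + 1) • (⊤ : Submodule R M))
        ⊓ (I ^ c • (⊤ : Submodule R M))
      = I ^ n • (⊤ : Submodule R M)

/-- `Q` is a parameter ideal for `M` (`r` the dimension of `M`):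
generated by `r` elements of the maximal ideal with `M/QM` of finite length. -/
def IsParamIdeal (Q : Ideal R) (M : Type) [AddCommGroup M] [Module R M] (r : ℕ) : Prop :=
  Q ≤ maximalIdeal R ∧ (∃ x : Fin r → R, Q = Ideal.span (Set.range x)) ∧
    IsFiniteLength R (M ⧸ Q • (⊤ : Submodule R M))

/-- Local cohomology `H^i_𝔪(M)` with support in the maximal ideal. -/
noncomputable def LC (i : ℕ) (M : Type) [AddCommGroup M] [Module R M] : ModuleCat R :=
  (localCohomology (maximalIdeal R) i).obj (ModuleCat.of R M)

/-- `M` is Cohen–Macaulay: there is a regular sequence on `M` in the maximal ideal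
whose length equals `dim M`. -/
def IsCM (M : Type) [AddCommGroup M] [Module R M] : Prop :=
  ∃ rs : List R, (∀ x ∈ rs, x ∈ maximalIdeal R) ∧ RingTheory.Sequence.IsRegular M rs ∧
    (rs.length : WithBot ℕ∞) = mDim R M

/-- `M` is unmixed: `dim R̂/p = dim M` for every associated prime `p` of the completion `M̂`. -/
def IsUnmixed (M : Type) [AddCommGroup M] [Module R M] : Prop :=
  ∀ p ∈ associatedPrimes (AdicCompletion (maximalIdeal R) R)
      (AdicCompletion (maximalIdeal R) M),
    ringKrullDim ((AdicCompletion (maximalIdeal R) R) ⧸ p) = mDim R M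

/-- `M` is generalized Cohen–Macaulay: `H^i_𝔪(M)` has finite length for `i < r = dim M`. -/
def IsGenCM (M : Type) [AddCommGroup M] [Module R M] (r : ℕ) : Prop :=
  ∀ i < r, IsFiniteLength R ↥(LC R i M)

/-- The set `Λ(M)` of first Hilbert coefficients of parameter ideals for `M`. -/
def Lambda (M : Type) [AddCommGroup M] [Module R M] (r : ℕ) : Set ℤ :=
  {a : ℤ | ∃ (Q : Ideal R) (e : ℕ → ℤ),
    IsParamIdeal R Q M r ∧ HasHilbCoeffs R Q M r e ∧ e 1 = a}

/-- A standard parameter ideal: one generated by a standard system of parameters. -/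
def IsStandardParamIdeal (Q : Ideal R) (M : Type) [AddCommGroup M] [Module R M]
    (r : ℕ) : Prop :=
  IsParamIdeal R Q M r ∧ ∃ x : Fin r → R, Q = Ideal.span (Set.range x) ∧
    IsStandardSeq R x M

/-- `M` is Buchsbaum: every parameter ideal for `M` is standard. -/
def IsBuchsbaum (M : Type) [AddCommGroup M] [Module R M] (r : ℕ) : Prop :=
  ∀ Q : Ideal R, IsParamIdeal R Q M r → IsStandardParamIdeal R Q M r

/-- `M` is a Vasconcelos module. -/
def IsVasconcelos (M : Type) [AddCommGroup M] [Module R M] : Prop :=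
  mDim R M ≤ 0 ∨ (0 < mDim R M ∧ ∃ (r : ℕ) (Q : Ideal R) (e : ℕ → ℤ),
    mDim R M = (r : ℕ∞) ∧ IsParamIdeal R Q M r ∧ HasHilbCoeffs R Q M r e ∧ e 1 = 0)

/-- A Gorenstein local ring: Noetherian, Cohen–Macaulay, with an irreducible parameter ideal. -/
def IsGorensteinLocalRing : Prop :=
  IsNoetherianRing R ∧ IsCM R R ∧ ∃ (r : ℕ) (Q : Ideal R),
    mDim R R = (r : ℕ∞) ∧ IsParamIdeal R Q R r ∧
    ∀ I J : Ideal R, Q = I ⊓ J → Q = I ∨ Q = J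

/-- `E` is an injective envelope of the residue field `R/𝔪`. -/
def IsInjEnvResidue (E : Type) [AddCommGroup E] [Module R E] : Prop :=
  Module.Injective R E ∧ ∃ ι : (R ⧸ maximalIdeal R) →ₗ[R] E, Function.Injective ι ∧
    ∀ N : Submodule R E, N ⊓ LinearMap.range ι = ⊥ → N = ⊥

end Defs

/-- A (not necessarily local) Cohen–Macaulay ring: Noetherian,
with all localizations at primes Cohen–Macaulay. -/
def IsCMRing (S : Type) [CommRing S] : Prop :=
  IsNoetherianRing S ∧ ∀ (p : Ideal S) [p.IsPrime],
    IsCM (Localization.AtPrime p) (Localization.AtPrime p)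

/-- A (not necessarily local) Gorenstein ring. -/
def IsGorensteinRing (S : Type) [CommRing S] : Prop :=
  IsNoetherianRing S ∧ ∀ (p : Ideal S) [p.IsPrime],
    IsGorensteinLocalRing (Localization.AtPrime p)

/-- `HDegRel R I E M v` : `v` is the homological degree `hdeg_I(M)` computed
with Matlis duals taken relative to `E`. -/
inductive HDegRel (R : Type) [CommRing R] [IsLocalRing R] (I : Ideal R)
    (E : Type) [AddCommGroup E] [Module R E] : ModuleCat R → ℕ → Prop where
  | base : ∀ (M : ModuleCat R) (l : ℕ), mDim R M ≤ 0 → mLength R M = (l : ℕ∞) →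
      HDegRel R I E M l
  | step : ∀ (M : ModuleCat R) (r : ℕ), mDim R M = (r : ℕ∞) → 0 < r →
      ∀ (e : ℕ → ℤ) (e0 : ℕ), HasHilbCoeffs R I M r e → e 0 = (e0 : ℤ) →
      ∀ v : ℕ → ℕ,
        (∀ j < r, HDegRel R I E (ModuleCat.of R ((LC R j M) →ₗ[R] E)) (v j)) →
      HDegRel R I E M (e0 + ∑ j ∈ Finset.range r, (r - 1).choose j * v j)

namespace LocalCoh

open CategoryTheory Limits

section Transport

variable {D : Type*} [Category D] [Abelian D] {S : ShortComplex (ChainComplex D ℕ)}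

theorem exact_transport {X Y Z X' Y' Z' : D} {f : X ⟶ Y} {g : Y ⟶ Z} (w : f ≫ g = 0)
    (hE : (ShortComplex.mk f g w).Exact) (a : X' ≅ X) (b : Y' ≅ Y) (c : Z' ≅ Z)
    {f' : X' ⟶ Y'} {g' : Y' ⟶ Z'} (hf : f' = a.hom ≫ f ≫ b.inv)
    (hg : g' = b.hom ≫ g ≫ c.inv) : ∃ h, (ShortComplex.mk f' g' h).Exact := by
  subst hf hg
  refine ⟨by simp [reassoc_of% w], ?_⟩
  exact ShortComplex.exact_of_iso
    (ShortComplex.isoMk a.symm b.symm c.symm (by simp) (by simp)) hE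

theorem δ_transport {S T : ShortComplex (ChainComplex D ℕ)} (hS : S.ShortExact)
    (hT : T.ShortExact) (φ : S ⟶ T) (n : ℕ) {A B A' B' : D}
    (a : A ≅ S.X₃.homology (n + 1)) (b : B ≅ S.X₁.homology n)
    (a' : A' ≅ T.X₃.homology (n + 1)) (b' : B' ≅ T.X₁.homology n)
    {u : A ⟶ A'} {v : B ⟶ B'}
    (hu : u ≫ a'.hom = a.hom ≫ HomologicalComplex.homologyMap φ.τ₃ (n + 1))
    (hv : b.inv ≫ v = HomologicalComplex.homologyMap φ.τ₁ n ≫ b'.inv) :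
    u ≫ a'.hom ≫ hT.δ (n + 1) n rfl ≫ b'.inv = (a.hom ≫ hS.δ (n + 1) n rfl ≫ b.inv) ≫ v := by
  have h3 := HomologicalComplex.HomologySequence.δ_naturality φ hS hT (n + 1) n rfl
  rw [reassoc_of% hu, Category.assoc, Category.assoc, hv, reassoc_of% h3]

end Transport

section LeftDerived

variable {C : Type*} [Category C] {D : Type*} [Category D] [Abelian C] [Abelian D]

/-- A short complex of additive functors applied to a chain complex. -/
noncomputable def complexOfFunctors {F G H : C ⥤ D} [F.Additive] [G.Additive] [H.Additive]
    (α : F ⟶ G) (β : G ⟶ H) (w : α ≫ β = 0) :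
    ChainComplex C ℕ ⥤ ShortComplex (ChainComplex D ℕ) where
  obj K := ShortComplex.mk ((NatTrans.mapHomologicalComplex α _).app K)
    ((NatTrans.mapHomologicalComplex β _).app K) (by
      ext i
      exact congr_app w (K.X i))
  map φ :=
    { τ₁ := (F.mapHomologicalComplex _).map φ
      τ₂ := (G.mapHomologicalComplex _).map φ
      τ₃ := (H.mapHomologicalComplex _).map φ
      comm₁₂ := ((NatTrans.mapHomologicalComplex α _).naturality φ)
      comm₂₃ := ((NatTrans.mapHomologicalComplex β _).naturality φ) }
  map_id K := by ext <;> simp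
  map_comp φ ψ := by ext <;> simp

variable [HasProjectiveResolutions C]

/-- The long exact sequence of left derived functors attached to a short exact sequence
of functors. -/
theorem exists_leftDerived_longExact {F G H : C ⥤ D} [F.Additive] [G.Additive] [H.Additive]
    (α : F ⟶ G) (β : G ⟶ H) (w : α ≫ β = 0)
    (ex : ∀ (X : C) [Projective X],
      (ShortComplex.mk (α.app X) (β.app X) (congr_app w X)).ShortExact) (n : ℕ) :
    (∀ X, ∃ h, (ShortComplex.mk ((NatTrans.leftDerived α n).app X)
      ((NatTrans.leftDerived β n).app X) h).Exact) ∧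
    ∃ δ : H.leftDerived (n + 1) ⟶ F.leftDerived n,
      (∀ X, ∃ h, (ShortComplex.mk ((NatTrans.leftDerived β (n + 1)).app X) (δ.app X) h).Exact) ∧
      (∀ X, ∃ h, (ShortComplex.mk (δ.app X) ((NatTrans.leftDerived α n).app X) h).Exact) := by
  let P : ∀ X : C, ProjectiveResolution X := fun X => projectiveResolution X
  let T := complexOfFunctors α β w
  have hT : ∀ X, (T.obj (P X).complex).ShortExact := fun X =>
    HomologicalComplex.shortExact_of_degreewise_shortExact _ fun i => ex ((P X).complex.X i)
  let a (X : C) (k : ℕ) : (F.leftDerived k).obj X ≅ (T.obj (P X).complex).X₁.homology k :=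
    (P X).isoLeftDerivedObj F k
  let b (X : C) (k : ℕ) : (G.leftDerived k).obj X ≅ (T.obj (P X).complex).X₂.homology k :=
    (P X).isoLeftDerivedObj G k
  let c (X : C) (k : ℕ) : (H.leftDerived k).obj X ≅ (T.obj (P X).complex).X₃.homology k :=
    (P X).isoLeftDerivedObj H k
  have hα : ∀ X k, (NatTrans.leftDerived α k).app X = (a X k).hom ≫
      HomologicalComplex.homologyMap (T.obj (P X).complex).f k ≫ (b X k).inv :=
    fun X k => ProjectiveResolution.leftDerived_app_eq α (P X) k
  have hβ : ∀ X k, (NatTrans.leftDerived β k).app X = (b X k).hom ≫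
      HomologicalComplex.homologyMap (T.obj (P X).complex).g k ≫ (c X k).inv :=
    fun X k => ProjectiveResolution.leftDerived_app_eq β (P X) k
  refine ⟨fun X => exact_transport _ ((hT X).homology_exact₂ n) _ _ _ (hα X n) (hβ X n),
    { app := fun X => (c X (n + 1)).hom ≫ (hT X).δ (n + 1) n rfl ≫ (a X n).inv
      naturality := ?_ },
    fun X => exact_transport _ ((hT X).homology_exact₃ (n + 1) n rfl) _ _ _ (hβ X (n + 1)) rfl,
    fun X => exact_transport _ ((hT X).homology_exact₁ (n + 1) n rfl) _ _ _ rfl (hα X n)⟩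
  intro X Y f
  let φ := ProjectiveResolution.lift f (P X) (P Y)
  have hφ : φ.f 0 ≫ (P Y).π.f 0 = (P X).π.f 0 ≫ f := by
    have := ProjectiveResolution.lift_commutes f (P X) (P Y)
    rw [← HomologicalComplex.comp_f, this, HomologicalComplex.comp_f]
    exact congr_arg ((P X).π.f 0 ≫ ·) (ChainComplex.single₀_map_f_zero f)
  exact δ_transport (hT X) (hT Y) (T.map φ) n (c X (n + 1)) (a X n) (c Y (n + 1)) (a Y n)
    (ProjectiveResolution.isoLeftDerivedObj_hom_naturality f (P X) (P Y) φ hφ H (n + 1))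
    (ProjectiveResolution.isoLeftDerivedObj_inv_naturality f (P X) (P Y) φ hφ F n)

end LeftDerived

end LocalCoh

namespace LocalCoh

open CategoryTheory Limits

section Central

variable {C : Type*} [Category C] [Abelian C] [HasProjectiveResolutions C]
  {D : Type*} [Category D] [Abelian D]

theorem homologyMap_eq_app (μ : 𝟭 D ⟶ 𝟭 D) {K : ChainComplex D ℕ} (φ : K ⟶ K)
    (hφ : ∀ i, φ.f i = μ.app (K.X i)) (n : ℕ) :
    HomologicalComplex.homologyMap φ n = μ.app (K.homology n) := by
  have h1 : HomologicalComplex.cyclesMap φ n = μ.app (K.cycles n) := by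
    rw [← cancel_mono (K.iCycles n), HomologicalComplex.cyclesMap_i, hφ]
    exact μ.naturality (K.iCycles n)
  rw [← cancel_epi (K.homologyπ n), HomologicalComplex.homologyπ_naturality, h1]
  exact (μ.naturality (K.homologyπ n)).symm

theorem app_of_conj (μ : 𝟭 D ⟶ 𝟭 D) {X Y : D} (e : X ≅ Y) {u : X ⟶ X}
    (h : u = e.hom ≫ μ.app Y ≫ e.inv) : u = μ.app X := by
  have h3 : e.hom ≫ μ.app Y = μ.app X ≫ e.hom := μ.naturality e.hom
  rw [h, reassoc_of% h3, Iso.hom_inv_id]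
  exact Category.comp_id _

theorem square_transport {X X' K K' O O' Z Z' : D} (e : X ≅ K) (e' : X' ≅ K') {u : X ⟶ X'}
    {k : K ⟶ K'} (hu : u = e.hom ≫ k ≫ e'.inv) {o : O ⟶ O'} {z : Z ⟶ Z'}
    {g : K ⟶ O} {g' : K' ⟶ O'} {f : O ⟶ Z} {f' : O' ⟶ Z'} (h1 : k ≫ g' = g ≫ o)
    (h2 : o ≫ f' = f ≫ z) :
    u ≫ e'.hom ≫ g' ≫ f' = (e.hom ≫ g ≫ f) ≫ z := by
  simp [hu, reassoc_of% h1, h2]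

theorem leftDerived_app_eq_app {F : C ⥤ D} [F.Additive] (μ : 𝟭 D ⟶ 𝟭 D) (α : F ⟶ F)
    (hα : ∀ X, α.app X = μ.app (F.obj X)) (n : ℕ) (X : C) :
    (NatTrans.leftDerived α n).app X = μ.app ((F.leftDerived n).obj X) := by
  let P := projectiveResolution X
  have h1 := homologyMap_eq_app μ
    ((NatTrans.mapHomologicalComplex α (ComplexShape.down ℕ)).app P.complex)
    (fun i => hα (P.complex.X i)) n
  have h2 : (NatTrans.leftDerived α n).app X = (P.isoLeftDerivedObj F n).hom ≫
    HomologicalComplex.homologyMap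
      ((NatTrans.mapHomologicalComplex α (ComplexShape.down ℕ)).app P.complex) n ≫
      (P.isoLeftDerivedObj F n).inv := ProjectiveResolution.leftDerived_app_eq α P n
  exact app_of_conj μ (P.isoLeftDerivedObj F n) (h2.trans (by rw [h1]; rfl))

theorem leftDerived_map_eq_app {F : C ⥤ D} [F.Additive] (μ : 𝟭 D ⟶ 𝟭 D) (ν : 𝟭 C ⟶ 𝟭 C)
    (hF : ∀ X, F.map (ν.app X) = μ.app (F.obj X)) (n : ℕ) (X : C) :
    (F.leftDerived n).map (ν.app X) = μ.app ((F.leftDerived n).obj X) := by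
  let P := projectiveResolution X
  let φ : P.complex ⟶ P.complex :=
    { f := fun i => ν.app (P.complex.X i)
      comm' := fun i j _ => (ν.naturality (P.complex.d i j)).symm }
  have hφ : φ.f 0 ≫ P.π.f 0 = P.π.f 0 ≫ ν.app X := (ν.naturality (P.π.f 0)).symm
  have h1 := homologyMap_eq_app μ ((F.mapHomologicalComplex (ComplexShape.down ℕ)).map φ)
    (fun i => hF (P.complex.X i)) n
  have h2 : (F.leftDerived n).map (ν.app X) ≫ (P.isoLeftDerivedObj F n).hom =
    (P.isoLeftDerivedObj F n).hom ≫ HomologicalComplex.homologyMap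
      ((F.mapHomologicalComplex (ComplexShape.down ℕ)).map φ) n :=
    ProjectiveResolution.isoLeftDerivedObj_hom_naturality (ν.app X) P P φ hφ F n
  rw [← cancel_mono (P.isoLeftDerivedObj F n).hom, h2, h1]
  exact μ.naturality (P.isoLeftDerivedObj F n).hom

theorem leftDerived_app_zero {F G : C ⥤ D} [F.Additive] [G.Additive] (α : F ⟶ G) (X : C) :
    (NatTrans.leftDerived α 0).app X ≫ G.fromLeftDerivedZero.app X =
      F.fromLeftDerivedZero.app X ≫ α.app X := by
  let P := projectiveResolution X
  have h1 : HomologicalComplex.opcyclesMap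
      ((NatTrans.mapHomologicalComplex α (ComplexShape.down ℕ)).app P.complex) 0 ≫
      P.fromLeftDerivedZero' G = P.fromLeftDerivedZero' F ≫ α.app X := by
    rw [← cancel_epi (HomologicalComplex.pOpcycles _ _), HomologicalComplex.p_opcyclesMap_assoc,
      ProjectiveResolution.pOpcycles_comp_fromLeftDerivedZero',
      ProjectiveResolution.pOpcycles_comp_fromLeftDerivedZero'_assoc]
    exact (α.naturality _).symm
  have h2 : (NatTrans.leftDerived α 0).app X = (P.isoLeftDerivedObj F 0).hom ≫
    HomologicalComplex.homologyMap
      ((NatTrans.mapHomologicalComplex α (ComplexShape.down ℕ)).app P.complex) 0 ≫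
      (P.isoLeftDerivedObj G 0).inv := ProjectiveResolution.leftDerived_app_eq α P 0
  rw [P.fromLeftDerivedZero_eq F, P.fromLeftDerivedZero_eq G]
  exact square_transport (P.isoLeftDerivedObj F 0) (P.isoLeftDerivedObj G 0) h2
    (HomologicalComplex.homologyι_naturality _ _) h1

end Central

end LocalCoh

namespace LocalCoh

open CategoryTheory Limits

section ExtSequence

variable {A : Type} [CommRing A]

/-- The contravariant Hom functor, as a covariant functor to the opposite category. -/
noncomputable abbrev homOp (X : ModuleCat.{0} A) : ModuleCat.{0} A ⥤ (ModuleCat.{0} A)ᵒᵖ :=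
  ((linearYoneda A (ModuleCat.{0} A)).obj X).rightOp

/-- Functoriality of `homOp`. -/
noncomputable abbrev homOpMap {X Y : ModuleCat.{0} A} (f : X ⟶ Y) : homOp Y ⟶ homOp X :=
  NatTrans.rightOp ((linearYoneda A (ModuleCat.{0} A)).map f)

/-- `Ext` with fixed second argument. -/
noncomputable abbrev extR (i : ℕ) (X : ModuleCat.{0} A) : (ModuleCat.{0} A)ᵒᵖ ⥤ ModuleCat.{0} A :=
  ((homOp X).leftDerived i).leftOp

/-- Functoriality of `extR`. -/
noncomputable abbrev extRMap (i : ℕ) {X Y : ModuleCat.{0} A} (f : X ⟶ Y) : extR i X ⟶ extR i Y :=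
  NatTrans.leftOp (NatTrans.leftDerived (homOpMap f) i)

theorem homOp_shortExact {S : ShortComplex (ModuleCat.{0} A)} (hS : S.ShortExact)
    (w : homOpMap S.g ≫ homOpMap S.f = 0)
    (P : ModuleCat.{0} A) [Projective P] :
    (ShortComplex.mk ((homOpMap S.g).app P) ((homOpMap S.f).app P) (congr_app w P)).ShortExact := by
  let T : ShortComplex (ModuleCat.{0} A) :=
    ShortComplex.mk (((linearYoneda A (ModuleCat.{0} A)).map S.f).app (Opposite.op P))
      (((linearYoneda A (ModuleCat.{0} A)).map S.g).app (Opposite.op P)) (by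
        ext (x : P ⟶ S.X₁)
        change (x ≫ S.f) ≫ S.g = 0
        rw [Category.assoc, S.zero, comp_zero])
  have hm := hS.mono_f
  have he := hS.epi_g
  have hT : T.ShortExact :=
    { exact := by
        rw [ShortComplex.moduleCat_exact_iff]
        intro (x : P ⟶ S.X₂) (hx : x ≫ S.g = 0)
        exact ⟨hS.exact.lift x hx, hS.exact.lift_f x hx⟩
      mono_f := by
        rw [ModuleCat.mono_iff_injective]
        intro (x : P ⟶ S.X₁) (y : P ⟶ S.X₁) (hxy : x ≫ S.f = y ≫ S.f)
        exact (cancel_mono S.f).1 hxy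
      epi_g := by
        rw [ModuleCat.epi_iff_surjective]
        intro (x : P ⟶ S.X₃)
        exact ⟨Projective.factorThru x S.g, Projective.factorThru_comp x S.g⟩ }
  exact hT.op

theorem extR_longExact {S : ShortComplex (ModuleCat.{0} A)} (hS : S.ShortExact) (n : ℕ) :
    (∀ W, Function.Exact ((extRMap n S.f).app W).hom ((extRMap n S.g).app W).hom) ∧
    ∃ δ : extR n S.X₃ ⟶ extR (n + 1) S.X₁,
      (∀ W, Function.Exact ((extRMap n S.g).app W).hom (δ.app W).hom) ∧
      (∀ W, Function.Exact (δ.app W).hom ((extRMap (n + 1) S.f).app W).hom) := by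
  have w : homOpMap S.g ≫ homOpMap S.f = 0 := by
    ext P
    refine Quiver.Hom.unop_inj ?_
    ext (x : P ⟶ S.X₁)
    change (x ≫ S.f) ≫ S.g = 0
    rw [Category.assoc, S.zero, comp_zero]
  have key : ∀ {X Y Z : (ModuleCat.{0} A)ᵒᵖ} (f : X ⟶ Y) (g : Y ⟶ Z),
      (∃ h, (ShortComplex.mk f g h).Exact) → Function.Exact g.unop.hom f.unop.hom := by
    rintro X Y Z f g ⟨h, hE⟩
    exact (ShortComplex.ShortExact.moduleCat_exact_iff_function_exact _).1 hE.unop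
  obtain ⟨h1, δ, h2, h3⟩ :=
    exists_leftDerived_longExact _ _ w (fun P _ => homOp_shortExact hS w P) n
  exact ⟨fun W => key _ _ (h1 W.unop), NatTrans.leftOp δ, fun W => key _ _ (h3 W.unop),
    fun W => key _ _ (h2 W.unop)⟩

/-- Multiplication by a scalar, as an endomorphism of the identity functor. -/
def smulNat (a : A) : 𝟭 (ModuleCat.{0} A) ⟶ 𝟭 (ModuleCat.{0} A) where
  app X := ModuleCat.ofHom (LinearMap.lsmul A X a)
  naturality _ _ f := by ext x; simp

/-- Multiplication by a scalar on the opposite category. -/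
def smulNatOp (a : A) : 𝟭 (ModuleCat.{0} A)ᵒᵖ ⟶ 𝟭 (ModuleCat.{0} A)ᵒᵖ where
  app X := ((smulNat a).app X.unop).op
  naturality _ _ f := congr_arg Quiver.Hom.op ((smulNat a).naturality f.unop).symm

theorem extRMap_smul (i : ℕ) (X : ModuleCat.{0} A) (a : A) (W) (x : (extR i X).obj W) :
    ((extRMap i ((smulNat a).app X)).app W).hom x = a • x := by
  have := leftDerived_app_eq_app (smulNatOp a) (homOpMap ((smulNat a).app X)) (fun P => by
    refine congr_arg Quiver.Hom.op ?_
    ext (u : P ⟶ X)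
    change u ≫ _ = a • u
    ext y
    simp [smulNat]) i W.unop
  exact congr_arg (fun t : ((homOp X).leftDerived i).obj W.unop ⟶
    ((homOp X).leftDerived i).obj W.unop => t.unop.hom x) this

theorem extR_map_smul (i : ℕ) (X W : ModuleCat.{0} A) (a : A) (x : (extR i X).obj (Opposite.op W)) :
    ((extR i X).map ((smulNat a).app W).op).hom x = a • x := by
  have := leftDerived_map_eq_app (F := homOp X) (smulNatOp a) (smulNat a) (fun P => by
    refine congr_arg Quiver.Hom.op ?_
    ext (u : P ⟶ X)
    change _ ≫ u = a • u
    ext y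
    simp [smulNat]) i W
  exact congr_arg (fun t : ((homOp X).leftDerived i).obj W ⟶
    ((homOp X).leftDerived i).obj W => t.unop.hom x) this

theorem extR_succ_subsingleton (i : ℕ) (X : ModuleCat.{0} A) [Injective X] (W) :
    Subsingleton ((extR (i + 1) X).obj W) := by
  let P := projectiveResolution W.unop
  rw [← ModuleCat.isZero_iff_subsingleton]
  refine IsZero.of_iso ?_ (P.isoExt (R := A) (i + 1) X)
  rw [← HomologicalComplex.exactAt_iff_isZero_homology, HomologicalComplex.exactAt_iff' _ i (i + 1) (i + 2)
    (by simp) (by simp)]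
  rw [ShortComplex.moduleCat_exact_iff]
  intro (x : P.complex.X (i + 1) ⟶ X) (hx : P.complex.d (i + 2) (i + 1) ≫ x = 0)
  exact ⟨(P.exact_succ i).descToInjective x hx, (P.exact_succ i).comp_descToInjective x hx⟩

end ExtSequence

end LocalCoh

namespace LocalCoh

open CategoryTheory Limits

section Colimit

variable {A : Type} [CommRing A]

theorem colimMap_exact {K : Type} [SmallCategory K] [IsFiltered K] {F G H : K ⥤ ModuleCat.{0} A}
    (α : F ⟶ G) (β : G ⟶ H)
    (h : ∀ k, Function.Exact (α.app k).hom (β.app k).hom) :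
    Function.Exact (colimMap α).hom (colimMap β).hom := by
  have hα : ∀ k (x : F.obj k), (colimMap α).hom ((colimit.ι F k).hom x) =
      (colimit.ι G k).hom ((α.app k).hom x) := fun k x =>
    congr_arg (fun t => t.hom x) (ι_colimMap α k)
  have hβ : ∀ k (x : G.obj k), (colimMap β).hom ((colimit.ι G k).hom x) =
      (colimit.ι H k).hom ((β.app k).hom x) := fun k x =>
    congr_arg (fun t => t.hom x) (ι_colimMap β k)
  intro y
  constructor
  · intro hy
    obtain ⟨k, x, rfl⟩ := Concrete.colimit_exists_rep G y
    replace hy : (colimit.ι H k).hom ((β.app k).hom x) = (colimit.ι H k).hom 0 := by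
      rw [← hβ, map_zero]; exact hy
    obtain ⟨k', f, g, hfg⟩ := Concrete.colimit_exists_of_rep_eq H _ _ hy
    have h0 : (β.app k').hom ((G.map f).hom x) = 0 := by
      have := congr_arg (fun t => t.hom x) (β.naturality f)
      refine this.trans (hfg.trans (map_zero (H.map g).hom))
    obtain ⟨z, hz⟩ := (h k' _).1 h0
    refine ⟨(colimit.ι F k').hom z, ?_⟩
    rw [hα, hz]
    exact congr_arg (fun t => t.hom x) (colimit.w G f)
  · rintro ⟨z, rfl⟩
    obtain ⟨k, x, rfl⟩ := Concrete.colimit_exists_rep F z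
    refine (congr_arg _ (hα k x)).trans ((hβ k _).trans ?_)
    rw [(h k).apply_apply_eq_zero, map_zero]

open localCohomology

variable (J : Ideal A)

/-- The directed system whose colimit is local cohomology. -/
noncomputable abbrev extSystem (i : ℕ) (X : ModuleCat.{0} A) : ℕᵒᵖᵒᵖ ⥤ ModuleCat.{0} A :=
  (ringModIdeals (idealPowersDiagram J)).op ⋙ extR i X

/-- Local cohomology as a colimit computed objectwise. -/
noncomputable def isoColim (i : ℕ) :
    localCohomology J i ≅ (diagram (idealPowersDiagram J) i).flip ⋙ colim :=
  colimitIsoFlipCompColim _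

/-- The object part of `isoColim`. -/
noncomputable def isoColimObj (i : ℕ) (X : ModuleCat.{0} A) :
    (localCohomology J i).obj X ≅ colimit (extSystem J i X) :=
  (isoColim J i).app X

theorem map_isoColimObj (i : ℕ) {X Y : ModuleCat.{0} A} (f : X ⟶ Y) :
    (localCohomology J i).map f = (isoColimObj J i X).hom ≫
      colimMap (Functor.whiskerLeft (ringModIdeals (idealPowersDiagram J)).op (extRMap i f)) ≫
      (isoColimObj J i Y).inv := by
  rw [← Category.assoc, Iso.eq_comp_inv]
  exact (isoColim J i).hom.naturality f

theorem exact_conj {X Y Z X' Y' Z' : ModuleCat.{0} A} (a : X ≅ X') (b : Y ≅ Y') (c : Z ≅ Z')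
    {f : X' ⟶ Y'} {g : Y' ⟶ Z'} (h : Function.Exact f.hom g.hom) :
    Function.Exact (a.hom ≫ f ≫ b.inv).hom (b.hom ≫ g ≫ c.inv).hom := by
  have w : f ≫ g = 0 := by ext x; exact h.apply_apply_eq_zero x
  obtain ⟨_, h'⟩ := exact_transport w
    ((ShortComplex.ShortExact.moduleCat_exact_iff_function_exact _).2 h) a b c rfl rfl
  exact (ShortComplex.ShortExact.moduleCat_exact_iff_function_exact _).1 h'

/-- The long exact sequence of local cohomology. -/
theorem localCohomology_longExact {S : ShortComplex (ModuleCat.{0} A)} (hS : S.ShortExact)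
    (n : ℕ) :
    Function.Exact ((localCohomology J n).map S.f).hom ((localCohomology J n).map S.g).hom ∧
    ∃ δ : (localCohomology J n).obj S.X₃ ⟶ (localCohomology J (n + 1)).obj S.X₁,
      Function.Exact ((localCohomology J n).map S.g).hom δ.hom ∧
      Function.Exact δ.hom ((localCohomology J (n + 1)).map S.f).hom := by
  obtain ⟨h1, δ, h2, h3⟩ := extR_longExact hS n
  refine ⟨?_, (isoColimObj J n S.X₃).hom ≫
      colimMap (Functor.whiskerLeft (ringModIdeals (idealPowersDiagram J)).op δ) ≫
      (isoColimObj J (n + 1) S.X₁).inv, ?_, ?_⟩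
  · rw [map_isoColimObj, map_isoColimObj]
    exact exact_conj _ _ _ (colimMap_exact _ _ fun k => h1 _)
  · rw [map_isoColimObj]
    exact exact_conj _ _ _ (colimMap_exact _ _ fun k => h2 _)
  · rw [map_isoColimObj]
    exact exact_conj _ _ _ (colimMap_exact _ _ fun k => h3 _)

/-- The structure map from a term of the directed system. -/
noncomputable def fromExt (i : ℕ) (X : ModuleCat.{0} A) (t : ℕᵒᵖᵒᵖ) :
    (extSystem J i X).obj t ⟶ (localCohomology J i).obj X :=
  colimit.ι (extSystem J i X) t ≫ (isoColimObj J i X).inv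

theorem exists_fromExt (i : ℕ) (X : ModuleCat.{0} A) (x : (localCohomology J i).obj X) :
    ∃ t y, (fromExt J i X t).hom y = x := by
  obtain ⟨t, y, hy⟩ := Concrete.colimit_exists_rep (extSystem J i X)
    ((isoColimObj J i X).hom.hom x)
  refine ⟨t, y, ?_⟩
  have : (isoColimObj J i X).inv.hom ((isoColimObj J i X).hom.hom x) = x :=
    congr_arg (fun t => t.hom x) (isoColimObj J i X).hom_inv_id
  rw [← this, ← hy]
  rfl

theorem fromExt_naturality (i : ℕ) {X Y : ModuleCat.{0} A} (f : X ⟶ Y) (t : ℕᵒᵖᵒᵖ)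
    (y : (extSystem J i X).obj t) :
    ((localCohomology J i).map f).hom ((fromExt J i X t).hom y) =
      (fromExt J i Y t).hom (((extRMap i f).app _).hom y) := by
  have : fromExt J i X t ≫ (localCohomology J i).map f =
      (extRMap i f).app _ ≫ fromExt J i Y t := by
    rw [map_isoColimObj, fromExt, fromExt, Category.assoc, Iso.inv_hom_id_assoc, ι_colimMap_assoc]
    rfl
  exact congr_arg (fun t => t.hom y) this

theorem localCohomology_map_smul (i : ℕ) (X : ModuleCat.{0} A) (a : A)
    (x : (localCohomology J i).obj X) :
    ((localCohomology J i).map ((smulNat a).app X)).hom x = a • x := by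
  obtain ⟨t, y, rfl⟩ := exists_fromExt J i X x
  refine (fromExt_naturality J i _ t y).trans ?_
  rw [← map_smul]
  exact congr_arg _ (extRMap_smul i X a _ y)

theorem localCohomology_torsion (i : ℕ) (X : ModuleCat.{0} A) (x : (localCohomology J i).obj X) :
    ∃ n : ℕ, ∀ a ∈ J ^ n, a • x = 0 := by
  obtain ⟨t, y, rfl⟩ := exists_fromExt J i X x
  refine ⟨t.unop.unop, fun a ha => ?_⟩
  have h0 : (smulNat a).app ((ringModIdeals (idealPowersDiagram J)).obj t.unop) = 0 := by
    ext x
    obtain ⟨x, rfl⟩ := Ideal.Quotient.mk_surjective x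
    change (Ideal.Quotient.mk (J ^ t.unop.unop) (a * x)) = (Ideal.Quotient.mk (J ^ t.unop.unop) 0)
    exact Ideal.Quotient.eq.2 (by simpa using Ideal.mul_mem_right x _ ha)
  have h1 := extR_map_smul i X ((ringModIdeals (idealPowersDiagram J)).obj t.unop) a y
  have h3 : (smulNat (0 : A)).app ((ringModIdeals (idealPowersDiagram J)).obj t.unop) = 0 := by
    ext x
    exact zero_smul A x
  have h2 : a • y = 0 := by
    rw [← h1, h0, ← h3]
    exact (extR_map_smul i X ((ringModIdeals (idealPowersDiagram J)).obj t.unop) 0 y).trans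
      (zero_smul A y)
  rw [← map_smul]
  exact (congr_arg _ h2).trans (map_zero _)

theorem localCohomology_injective_subsingleton (i : ℕ) (X : ModuleCat.{0} A) [Injective X] :
    Subsingleton ((localCohomology J (i + 1)).obj X) := by
  refine ⟨fun x y => ?_⟩
  obtain ⟨t, x, rfl⟩ := exists_fromExt J _ X x
  obtain ⟨s, y, rfl⟩ := exists_fromExt J _ X y
  have h1 := extR_succ_subsingleton i X
    (Opposite.op ((ringModIdeals (idealPowersDiagram J)).obj t.unop))
  have h2 := extR_succ_subsingleton i X
    (Opposite.op ((ringModIdeals (idealPowersDiagram J)).obj s.unop))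
  rw [show x = 0 from h1.elim _ _, show y = 0 from h2.elim _ _, map_zero, map_zero]

instance homOp_preservesFiniteColimits (X : ModuleCat.{0} A) :
    PreservesFiniteColimits (homOp X) := by
  have : PreservesFiniteLimits ((linearYoneda A (ModuleCat.{0} A)).obj X) := by
    have : PreservesFiniteLimits
        ((linearYoneda A (ModuleCat.{0} A)).obj X ⋙ forget (ModuleCat.{0} A)) :=
      inferInstanceAs (PreservesFiniteLimits (yoneda.obj X))
    exact preservesFiniteLimits_of_reflects_of_preserves _ (forget (ModuleCat.{0} A))
  exact preservesFiniteColimits_rightOp _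

/-- `Ext` in degree zero is `Hom`. -/
noncomputable def homOfExt (X : ModuleCat.{0} A) :
    extR 0 X ≅ (linearYoneda A (ModuleCat.{0} A)).obj X where
  hom := NatTrans.leftOp (homOp X).leftDerivedZeroIsoSelf.inv
  inv := NatTrans.leftOp (homOp X).leftDerivedZeroIsoSelf.hom
  hom_inv_id := congr_arg NatTrans.leftOp (homOp X).leftDerivedZeroIsoSelf.hom_inv_id
  inv_hom_id := congr_arg NatTrans.leftOp (homOp X).leftDerivedZeroIsoSelf.inv_hom_id

theorem homOfExt_naturality {X Y : ModuleCat.{0} A} (f : X ⟶ Y) :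
    extRMap 0 f ≫ (homOfExt Y).hom =
      (homOfExt X).hom ≫ (linearYoneda A (ModuleCat.{0} A)).map f := by
  rw [← Iso.inv_comp_eq, ← Category.assoc, ← Iso.eq_comp_inv]
  ext W : 2
  exact congr_arg Quiver.Hom.unop (leftDerived_app_zero (homOpMap f) W.unop)

/-- The evaluation of homomorphisms from a cyclic module at the generator. -/
noncomputable def evalOne (X : ModuleCat.{0} A) :
    (ringModIdeals (idealPowersDiagram J)).op ⋙ (linearYoneda A (ModuleCat.{0} A)).obj X ⟶
      (Functor.const _).obj X where
  app t := ModuleCat.ofHom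
    { toFun := fun u : (ringModIdeals (idealPowersDiagram J)).obj t.unop ⟶ X =>
        u.hom (Ideal.Quotient.mk _ 1)
      map_add' := fun _ _ => rfl
      map_smul' := fun _ _ => rfl }
  naturality _ _ _ := by
    ext u
    rfl

/-- The natural map from local cohomology in degree zero. -/
noncomputable def gammaMap (X : ModuleCat.{0} A) : (localCohomology J 0).obj X ⟶ X :=
  (isoColimObj J 0 X).hom ≫ colimit.desc (extSystem J 0 X)
    { pt := X
      ι := Functor.whiskerLeft (ringModIdeals (idealPowersDiagram J)).op (homOfExt X).hom ≫
        evalOne J X }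

theorem gammaMap_fromExt (X : ModuleCat.{0} A) (t : ℕᵒᵖᵒᵖ) (y : (extSystem J 0 X).obj t) :
    (gammaMap J X).hom ((fromExt J 0 X t).hom y) =
      (((homOfExt X).hom.app _).hom y : (ringModIdeals (idealPowersDiagram J)).obj t.unop ⟶ X).hom
        (Ideal.Quotient.mk _ 1) := by
  have : fromExt J 0 X t ≫ gammaMap J X = (homOfExt X).hom.app _ ≫ (evalOne J X).app t := by
    rw [fromExt, gammaMap, Category.assoc, Iso.inv_hom_id_assoc, colimit.ι_desc]
    rfl
  exact congr_arg (fun t => t.hom y) this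

theorem gammaMap_naturality {X Y : ModuleCat.{0} A} (f : X ⟶ Y)
    (x : (localCohomology J 0).obj X) :
    (gammaMap J Y).hom (((localCohomology J 0).map f).hom x) = f.hom ((gammaMap J X).hom x) := by
  obtain ⟨t, y, rfl⟩ := exists_fromExt J _ X x
  refine (congr_arg _ (fromExt_naturality J 0 f t y)).trans ?_
  refine (gammaMap_fromExt J Y t _).trans ?_
  refine Eq.trans ?_ (congr_arg f.hom (gammaMap_fromExt J X t y).symm)
  have := congr_arg (fun u => u.app (Opposite.op
    ((ringModIdeals (idealPowersDiagram J)).obj t.unop))) (homOfExt_naturality f)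
  have := congr_arg (fun u => u.hom y) this
  exact congr_arg (fun u : (ringModIdeals (idealPowersDiagram J)).obj t.unop ⟶ Y =>
    u.hom (Ideal.Quotient.mk _ 1)) this

theorem homOfExt_injective (X : ModuleCat.{0} A) (W) :
    Function.Injective ((homOfExt X).hom.app W).hom :=
  (ModuleCat.mono_iff_injective _).1 inferInstance

theorem homOfExt_surjective (X : ModuleCat.{0} A) (W) :
    Function.Surjective ((homOfExt X).hom.app W).hom :=
  (ModuleCat.epi_iff_surjective _).1 inferInstance

theorem gammaMap_injective (X : ModuleCat.{0} A) : Function.Injective (gammaMap J X).hom := by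
  rw [injective_iff_map_eq_zero]
  intro x hx
  obtain ⟨t, y, rfl⟩ := exists_fromExt J _ X x
  have h1 := (gammaMap_fromExt J X t y).symm.trans hx
  have h2 : (((homOfExt X).hom.app _).hom y :
      (ringModIdeals (idealPowersDiagram J)).obj t.unop ⟶ X) = 0 := by
    refine ModuleCat.hom_ext (LinearMap.ext fun z => ?_)
    obtain ⟨z, rfl⟩ := Ideal.Quotient.mk_surjective z
    have : (Ideal.Quotient.mk _ z : A ⧸ J ^ t.unop.unop) = z • Ideal.Quotient.mk _ 1 := by
      change _ = Ideal.Quotient.mk _ (z * 1)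
      rw [mul_one]
    refine (congr_arg _ this).trans ?_
    refine (LinearMap.map_smul (ModuleCat.Hom.hom _) z _).trans ?_
    exact (congr_arg (z • ·) h1).trans (smul_zero z)
  have h3 : y = 0 := homOfExt_injective X _ (h2.trans (map_zero _).symm)
  exact (congr_arg _ h3).trans (map_zero _)

theorem mem_range_gammaMap (X : ModuleCat.{0} A) (x : X) :
    x ∈ LinearMap.range (gammaMap J X).hom ↔ ∃ n : ℕ, ∀ a ∈ J ^ n, a • x = 0 := by
  constructor
  · rintro ⟨y, rfl⟩
    obtain ⟨n, hn⟩ := localCohomology_torsion J 0 X y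
    exact ⟨n, fun a ha => by rw [← map_smul, hn a ha, map_zero]⟩
  · rintro ⟨n, hn⟩
    let t : ℕᵒᵖᵒᵖ := Opposite.op (Opposite.op n)
    let u : (ringModIdeals (idealPowersDiagram J)).obj t.unop ⟶ X := ModuleCat.ofHom
      (Submodule.liftQ (J ^ n) (LinearMap.toSpanSingleton A X x) (fun a ha => hn a ha))
    obtain ⟨y, hy⟩ := homOfExt_surjective X (Opposite.op _) u
    refine ⟨(fromExt J 0 X t).hom y, (gammaMap_fromExt J X t y).trans ?_⟩
    rw [hy]
    exact one_smul A x

end Colimit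

end LocalCoh

namespace LocalCoh

open CategoryTheory Limits

section Api

variable {A : Type} [CommRing A] [IsLocalRing A]
variable {X Y Z : Type} [AddCommGroup X] [Module A X] [AddCommGroup Y] [Module A Y]
  [AddCommGroup Z] [Module A Z]

/-- The map induced on local cohomology. -/
noncomputable def LCm (i : ℕ) (f : X →ₗ[A] Y) : LC A i X →ₗ[A] LC A i Y :=
  ((localCohomology (maximalIdeal A) i).map (ModuleCat.ofHom f)).hom

theorem LCm_smul (i : ℕ) (a : A) (x : LC A i X) :
    LCm i (LinearMap.lsmul A X a) x = a • x :=
  localCohomology_map_smul (maximalIdeal A) i (ModuleCat.of A X) a x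

theorem LC_torsion (i : ℕ) (x : LC A i X) : ∃ n : ℕ, ∀ a ∈ maximalIdeal A ^ n, a • x = 0 :=
  localCohomology_torsion (maximalIdeal A) i (ModuleCat.of A X) x

theorem LC_longExact {f : X →ₗ[A] Y} {g : Y →ₗ[A] Z} (hf : Function.Injective f)
    (hg : Function.Surjective g) (hfg : Function.Exact f g) (i : ℕ) :
    Function.Exact (LCm i f) (LCm i g) ∧ ∃ δ : LC A i Z →ₗ[A] LC A (i + 1) X,
      Function.Exact (LCm i g) δ ∧ Function.Exact δ (LCm (i + 1) f) := by
  let S : ShortComplex (ModuleCat.{0} A) :=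
    ShortComplex.mk (ModuleCat.ofHom f) (ModuleCat.ofHom g) (by
      ext x; exact hfg.apply_apply_eq_zero x)
  have hS : S.ShortExact :=
    { exact := (ShortComplex.ShortExact.moduleCat_exact_iff_function_exact S).2 hfg
      mono_f := (ModuleCat.mono_iff_injective _).2 hf
      epi_g := (ModuleCat.epi_iff_surjective _).2 hg }
  obtain ⟨h1, δ, h2, h3⟩ := localCohomology_longExact (maximalIdeal A) hS i
  exact ⟨h1, δ.hom, h2, h3⟩

/-- The inclusion of local cohomology in degree zero. -/
noncomputable def LCzero (X : Type) [AddCommGroup X] [Module A X] : LC A 0 X →ₗ[A] X :=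
  (gammaMap (maximalIdeal A) (ModuleCat.of A X)).hom

theorem LCzero_injective : Function.Injective (LCzero (A := A) X) :=
  gammaMap_injective _ _

theorem LCzero_naturality (f : X →ₗ[A] Y) (x : LC A 0 X) :
    LCzero Y (LCm 0 f x) = f (LCzero X x) :=
  gammaMap_naturality (maximalIdeal A) (ModuleCat.ofHom f) x

theorem mem_range_LCzero (x : X) :
    x ∈ LinearMap.range (LCzero (A := A) X) ↔ ∃ n : ℕ, ∀ a ∈ maximalIdeal A ^ n, a • x = 0 :=
  mem_range_gammaMap _ _ _

theorem LCm_zero_injective {f : X →ₗ[A] Y} (hf : Function.Injective f) :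
    Function.Injective (LCm 0 f) := fun x y hxy => by
  apply LCzero_injective
  apply hf
  rw [← LCzero_naturality, ← LCzero_naturality, hxy]

/-- The submodule of elements killed by a power of the maximal ideal. -/
def gam (X : Type) [AddCommGroup X] [Module A X] : Submodule A X where
  carrier := {x | ∃ n : ℕ, ∀ a ∈ maximalIdeal A ^ n, a • x = 0}
  zero_mem' := ⟨0, fun _ _ => smul_zero _⟩
  add_mem' := by
    rintro x y ⟨n, hn⟩ ⟨k, hk⟩
    refine ⟨n + k, fun a ha => ?_⟩
    rw [smul_add, hn a (Ideal.pow_le_pow_right (Nat.le_add_right _ _) ha),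
      hk a (Ideal.pow_le_pow_right (Nat.le_add_left _ _) ha), add_zero]
  smul_mem' := by
    rintro c x ⟨n, hn⟩
    exact ⟨n, fun a ha => by rw [smul_comm, hn a ha, smul_zero]⟩

theorem mem_gam {x : X} : x ∈ gam (A := A) X ↔ ∃ n : ℕ, ∀ a ∈ maximalIdeal A ^ n, a • x = 0 :=
  Iff.rfl

/-- Local cohomology in degree zero is the torsion submodule. -/
noncomputable def LCzeroEquiv (X : Type) [AddCommGroup X] [Module A X] :
    LC A 0 X ≃ₗ[A] gam (A := A) X :=
  (LinearEquiv.ofInjective (LCzero X) LCzero_injective).trans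
    (LinearEquiv.ofEq _ _ (Submodule.ext fun x => mem_range_LCzero x))

theorem gam_injective [IsNoetherianRing A] (hX : Module.Injective A X) :
    Module.Injective A (gam (A := A) X) := by
  apply Module.Baer.injective
  intro I g
  obtain ⟨n, hn⟩ : ∃ n, ∀ a ∈ maximalIdeal A ^ n, ∀ x : I, a • g x = 0 := by
    obtain ⟨s, hs⟩ : (⊤ : Submodule A I).FG := IsNoetherian.noetherian _
    have : ∀ x : I, ∃ n, ∀ a ∈ maximalIdeal A ^ n, a • g x = 0 := fun x => by
      obtain ⟨n, hn⟩ := (g x).2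
      exact ⟨n, fun a ha => Subtype.ext (hn a ha)⟩
    choose k hk using this
    refine ⟨s.sup k, fun a ha x => ?_⟩
    have hx : x ∈ Submodule.span A (s : Set I) := hs ▸ Submodule.mem_top
    induction hx using Submodule.span_induction with
    | mem x hx => exact hk x a (Ideal.pow_le_pow_right (Finset.le_sup hx) ha)
    | zero => simp
    | add x y _ _ hx hy => rw [map_add, smul_add, hx, hy, add_zero]
    | smul c x _ hx => rw [map_smul, smul_comm, hx, smul_zero]
  obtain ⟨k, hk⟩ := Ideal.exists_pow_inf_eq_pow_smul (maximalIdeal A) I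
  have hker : Submodule.comap I.subtype (maximalIdeal A ^ (n + k)) ≤ LinearMap.ker g := by
    intro x hx
    have h1 := hk (n + k) (Nat.le_add_left _ _)
    have h2 : maximalIdeal A ^ n • I ≤ (LinearMap.ker g).map I.subtype := by
      rw [Submodule.smul_le]
      intro a ha b hb
      exact ⟨a • ⟨b, hb⟩, by rw [SetLike.mem_coe, LinearMap.mem_ker, map_smul, hn a ha], rfl⟩
    have h3 : (x : A) ∈ maximalIdeal A ^ (n + k) • (⊤ : Submodule A A) ⊓ I :=
      ⟨by simpa using hx, x.2⟩
    rw [h1, Nat.add_sub_cancel] at h3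
    obtain ⟨y, hy, hyx⟩ := h2 (Submodule.smul_mono le_rfl inf_le_right h3)
    rwa [← Subtype.ext hyx]
  have hinj : Function.Injective (Submodule.mapQ (Submodule.comap I.subtype (maximalIdeal A ^ (n + k)))
      (maximalIdeal A ^ (n + k)) I.subtype le_rfl) := by
    rw [← LinearMap.ker_eq_bot, Submodule.mapQ, Submodule.ker_liftQ_eq_bot]
    rw [LinearMap.ker_comp, Submodule.ker_mkQ]
  obtain ⟨h, hh⟩ := hX.out _ hinj
    (Submodule.liftQ _ ((gam (A := A) X).subtype ∘ₗ g) (by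
      rw [LinearMap.ker_comp, Submodule.ker_subtype]; exact hker))
  refine ⟨(h ∘ₗ Submodule.mkQ _).codRestrict _ fun a => ⟨n + k, fun b hb => ?_⟩, ?_⟩
  · rw [← map_smul, LinearMap.comp_apply, Submodule.mkQ_apply, (Submodule.Quotient.mk_eq_zero _).2, map_zero]
    · exact Ideal.mul_mem_right a _ hb
  · intro x hx
    exact Subtype.ext (hh (Submodule.Quotient.mk ⟨x, hx⟩))

theorem LC_succ_subsingleton_of_injective (hX : Module.Injective A X) (i : ℕ) :
    Subsingleton (LC A (i + 1) X) := by
  have : Injective (ModuleCat.of A X) := (Module.injective_iff_injective_object A X).1 hX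
  exact localCohomology_injective_subsingleton (maximalIdeal A) i (ModuleCat.of A X)

theorem gam_eq_top_of_surjective {g : Y →ₗ[A] Z} (hg : Function.Surjective g)
    (hY : gam (A := A) Y = ⊤) : gam (A := A) Z = ⊤ := by
  rw [eq_top_iff]
  rintro z -
  obtain ⟨y, rfl⟩ := hg z
  obtain ⟨n, hn⟩ : y ∈ gam (A := A) Y := hY ▸ Submodule.mem_top
  exact ⟨n, fun a ha => by rw [← map_smul, hn a ha, map_zero]⟩

theorem LCzero_surjective (hX : gam (A := A) X = ⊤) : Function.Surjective (LCzero (A := A) X) := by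
  intro x
  have hx : x ∈ gam (A := A) X := hX ▸ Submodule.mem_top
  exact (mem_range_LCzero x).2 hx

theorem exists_embedding_gam_injective [IsNoetherianRing A] (hX : gam (A := A) X = ⊤) :
    ∃ (E : Type) (_ : AddCommGroup E) (_ : Module A E) (f : X →ₗ[A] E),
      Function.Injective f ∧ Module.Injective A E ∧ gam (A := A) E = ⊤ := by
  obtain ⟨E⟩ := EnoughInjectives.presentation (ModuleCat.of A X)
  have hE : Module.Injective A E.J := by
    have := E.injective
    exact (Module.injective_iff_injective_object A E.J).2 this
  let f : X →ₗ[A] gam (A := A) E.J := E.f.hom.codRestrict _ fun x => by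
    obtain ⟨n, hn⟩ : x ∈ gam (A := A) X := hX ▸ Submodule.mem_top
    exact ⟨n, fun a ha => by rw [← map_smul]; exact (congr_arg _ (hn a ha)).trans (map_zero _)⟩
  refine ⟨gam (A := A) E.J, inferInstance, inferInstance, f, ?_, gam_injective hE, ?_⟩
  · have := (ModuleCat.mono_iff_injective E.f).1 E.mono
    exact fun x y hxy => this (congr_arg Subtype.val hxy)
  · rw [eq_top_iff]
    rintro ⟨x, n, hn⟩ -
    exact ⟨n, fun a ha => Subtype.ext (hn a ha)⟩

theorem LC_succ_subsingleton [IsNoetherianRing A] (i : ℕ) :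
    ∀ (X : Type) [AddCommGroup X] [Module A X], gam (A := A) X = ⊤ →
      Subsingleton (LC A (i + 1) X) := by
  induction i with
  | zero =>
    intro X _ _ hX
    obtain ⟨E, _, _, f, hf, hE, hgG⟩ := exists_embedding_gam_injective hX
    obtain ⟨-, δ, h2, h3⟩ := LC_longExact hf (LinearMap.range f).mkQ_surjective
      (LinearMap.exact_map_mkQ_range f) 0
    have h4 := LC_succ_subsingleton_of_injective hE 0
    have h7 : ∀ u : LC A (0 + 1) X, u = 0 := by
      intro u
      obtain ⟨y, rfl⟩ := (h3 u).1 (h4.elim _ _)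
      refine (h2 y).2 ?_
      obtain ⟨z, hz⟩ := (LinearMap.range f).mkQ_surjective (LCzero _ y)
      obtain ⟨z, rfl⟩ := LCzero_surjective hgG z
      exact ⟨z, LCzero_injective ((LCzero_naturality _ z).trans hz)⟩
    exact ⟨fun u v => (h7 u).trans (h7 v).symm⟩
  | succ i ih =>
    intro X _ _ hX
    obtain ⟨E, _, _, f, hf, hE, hgG⟩ := exists_embedding_gam_injective hX
    obtain ⟨-, δ, -, h3⟩ := LC_longExact hf (LinearMap.range f).mkQ_surjective
      (LinearMap.exact_map_mkQ_range f) (i + 1)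
    have h4 := LC_succ_subsingleton_of_injective hE (i + 1)
    have h6 := ih _ (gam_eq_top_of_surjective (LinearMap.range f).mkQ_surjective hgG)
    have h5 : Function.Surjective δ := fun u => (h3 u).1 (h4.elim _ _)
    exact h5.subsingleton

end Api

end LocalCoh

namespace LocalCoh

section Length

variable {A : Type} [CommRing A]
variable {X Y Z : Type} [AddCommGroup X] [Module A X] [AddCommGroup Y] [Module A Y]
  [AddCommGroup Z] [Module A Z]

theorem length_le_of_exact {f : X →ₗ[A] Y} {g : Y →ₗ[A] Z} (h : Function.Exact f g) :
    Module.length A Y ≤ Module.length A X + Module.length A Z := by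
  have h1 := Module.length_eq_add_of_exact (LinearMap.range f).subtype (LinearMap.range f).mkQ
    (LinearMap.range f).subtype_injective (LinearMap.range f).mkQ_surjective
    (LinearMap.exact_subtype_mkQ _)
  rw [h1]
  refine add_le_add (Module.length_le_of_surjective f.rangeRestrict f.surjective_rangeRestrict) ?_
  refine Module.length_le_of_injective ((LinearMap.range f).liftQ g
    (LinearMap.exact_iff.1 h).ge) ?_
  rw [← LinearMap.ker_eq_bot, Submodule.ker_liftQ_eq_bot]
  exact (LinearMap.exact_iff.1 h).le

variable [IsLocalRing A]

/-- The length of local cohomology. -/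
noncomputable def hl (A : Type) [CommRing A] [IsLocalRing A] (i : ℕ) (X : Type) [AddCommGroup X]
    [Module A X] : ℕ∞ := Module.length A (LC A i X)

theorem hl_zero_eq : hl A 0 X = Module.length A (gam (A := A) X) :=
  (LCzeroEquiv X).length_eq

theorem hl_of_torsion [IsNoetherianRing A] (hX : gam (A := A) X = ⊤) (i : ℕ) :
    hl A (i + 1) X = 0 := by
  have := LC_succ_subsingleton i X hX
  exact Module.length_eq_zero

theorem hl_mid_le {f : X →ₗ[A] Y} {g : Y →ₗ[A] Z} (hf : Function.Injective f)
    (hg : Function.Surjective g) (hfg : Function.Exact f g) (i : ℕ) :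
    hl A i Y ≤ hl A i X + hl A i Z :=
  length_le_of_exact (LC_longExact hf hg hfg i).1

theorem hl_right_le {f : X →ₗ[A] Y} {g : Y →ₗ[A] Z} (hf : Function.Injective f)
    (hg : Function.Surjective g) (hfg : Function.Exact f g) (i : ℕ) :
    hl A i Z ≤ hl A i Y + hl A (i + 1) X := by
  obtain ⟨-, δ, h1, -⟩ := LC_longExact hf hg hfg i
  exact length_le_of_exact h1

theorem hl_left_le {f : X →ₗ[A] Y} {g : Y →ₗ[A] Z} (hf : Function.Injective f)
    (hg : Function.Surjective g) (hfg : Function.Exact f g) (i : ℕ) :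
    hl A (i + 1) X ≤ hl A i Z + hl A (i + 1) Y := by
  obtain ⟨-, δ, -, h1⟩ := LC_longExact hf hg hfg i
  exact length_le_of_exact h1

theorem hl_zero_right_le {f : X →ₗ[A] Y} {g : Y →ₗ[A] Z} (hf : Function.Injective f)
    (hg : Function.Surjective g) (hfg : Function.Exact f g) :
    hl A 0 X + hl A 0 Z ≤ hl A 0 Y + hl A 1 X := by
  obtain ⟨h0, δ, h1, -⟩ := LC_longExact hf hg hfg 0
  have h2 : hl A 0 Y = hl A 0 X + Module.length A (LinearMap.range (LCm 0 g)) :=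
    Module.length_eq_add_of_exact (LCm 0 f) (LCm 0 g).rangeRestrict (LCm_zero_injective hf)
      (LCm 0 g).surjective_rangeRestrict fun y => by
        rw [← h0 y, ← Subtype.coe_inj]; rfl
  have h3 : hl A 0 Z ≤ Module.length A (LinearMap.range (LCm 0 g)) + hl A 1 X :=
    length_le_of_exact (f := (LinearMap.range (LCm 0 g)).subtype) (g := δ) fun y => by
      rw [h1 y]; simp
  rw [h2, add_assoc]
  exact add_le_add le_rfl h3

/-- The elements of local cohomology killed by a regular element. -/
theorem length_ker_smul_le (x : A) (hx : Function.Injective (LinearMap.lsmul A X x)) (i : ℕ) :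
    Module.length A (LinearMap.ker (LinearMap.lsmul A (LC A (i + 1) X) x)) ≤
      hl A i (X ⧸ LinearMap.range (LinearMap.lsmul A X x)) := by
  obtain ⟨-, δ, -, h⟩ := LC_longExact hx (Submodule.mkQ_surjective _)
    (LinearMap.exact_map_mkQ_range _) i
  have h1 : LinearMap.ker (LinearMap.lsmul A (LC A (i + 1) X) x) = LinearMap.range δ := by
    rw [← LinearMap.exact_iff.1 h]
    ext y
    rw [LinearMap.mem_ker, LinearMap.mem_ker, LCm_smul]; rfl
  rw [h1]
  exact Module.length_le_of_surjective δ.rangeRestrict δ.surjective_rangeRestrict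

end Length

end LocalCoh

namespace LocalCoh

open Filter Topology

/-- The polynomial with given coefficients in the alternating binomial basis. -/
def bsum (r : ℕ) (s : ℕ → ℤ) (n : ℕ) : ℤ :=
  ∑ i ∈ Finset.range (r + 1), (-1 : ℤ) ^ i * s i * ((n + r - i).choose (r - i) : ℤ)

theorem bsum_zero (s : ℕ → ℤ) (n : ℕ) : bsum 0 s n = s 0 := by
  simp [bsum]

theorem bsum_succ' (r : ℕ) (s : ℕ → ℤ) (n : ℕ) :
    bsum (r + 1) s n = s 0 * ((n + (r + 1)).choose (r + 1) : ℤ) - bsum r (fun i => s (i + 1)) n := by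
  rw [bsum, Finset.sum_range_succ', bsum]
  simp only [pow_zero, one_mul, Nat.sub_zero]
  rw [add_comm, sub_eq_add_neg, ← Finset.sum_neg_distrib]
  congr 1
  refine Finset.sum_congr rfl fun i hi => ?_
  rw [Nat.add_sub_add_right, show n + (r + 1) - (i + 1) = n + r - i by omega, pow_succ]
  ring

theorem bsum_diff (r : ℕ) (s : ℕ → ℤ) (n : ℕ) :
    bsum (r + 1) s (n + 1) - bsum (r + 1) s n = bsum r s (n + 1) := by
  induction r generalizing s with
  | zero => simp [bsum, Finset.sum_range_succ]; ring
  | succ r ih =>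
    rw [bsum_succ', bsum_succ' (r + 1) s n, bsum_succ' r s (n + 1), ← ih]
    have h : (n + 1 + (r + 1 + 1)).choose (r + 1 + 1) =
        (n + 1 + (r + 1)).choose (r + 1) + (n + (r + 1 + 1)).choose (r + 1 + 1) := by
      rw [show n + 1 + (r + 1 + 1) = (n + 1 + (r + 1)) + 1 by ring, Nat.choose_succ_succ]
      congr 2
      ring
    rw [h]
    push_cast
    ring

theorem bsum_succ (r : ℕ) (s : ℕ → ℤ) (n : ℕ) :
    bsum (r + 1) s n = (∑ i ∈ Finset.range (r + 1), (-1 : ℤ) ^ i * s i *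
      ((n + (r + 1) - i).choose (r + 1 - i) : ℤ)) + (-1) ^ (r + 1) * s (r + 1) := by
  rw [bsum, Finset.sum_range_succ]
  simp

theorem bsum_add (r : ℕ) (s t : ℕ → ℤ) (n : ℕ) :
    bsum r (fun i => s i + t i) n = bsum r s n + bsum r t n := by
  rw [bsum, bsum, bsum, ← Finset.sum_add_distrib]
  exact Finset.sum_congr rfl fun i _ => by ring

theorem bsum_congr {r : ℕ} {s t : ℕ → ℤ} (h : ∀ i ≤ r, s i = t i) (n : ℕ) :
    bsum r s n = bsum r t n :=
  Finset.sum_congr rfl fun i hi => by rw [h i (by simpa [Nat.lt_succ_iff] using hi)]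

theorem tendsto_choose_div (k : ℕ) {u : ℕ → ℕ} {c : ℝ}
    (hu : Tendsto (fun n => (u n : ℝ) / n) atTop (𝓝 c)) (hu' : Tendsto u atTop atTop) :
    Tendsto (fun n => ((u n + k).choose k : ℝ) / (n : ℝ) ^ k) atTop (𝓝 (c ^ k / k.factorial)) := by
  have h1 : Tendsto (fun n => (u n + k : ℝ) / n) atTop (𝓝 c) := by
    have := hu.add (tendsto_const_div_atTop_nhds_zero_nat (k : ℝ))
    simpa [add_div] using this
  have h2 : Tendsto (fun n => u n + k) atTop atTop := tendsto_atTop_mono (fun n => Nat.le_add_right _ _) hu'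
  have h3 : Tendsto (fun m : ℕ => (m.choose k : ℝ) / ((m : ℝ) ^ k / k.factorial)) atTop (𝓝 1) := by
    refine (Asymptotics.isEquivalent_iff_tendsto_one ?_).1 (isEquivalent_choose k)
    filter_upwards [eventually_ne_atTop 0] with m hm
    have : (m : ℝ) ≠ 0 := by exact_mod_cast hm
    positivity
  have h4 := (h3.comp h2).mul ((h1.pow k).div_const (k.factorial : ℝ))
  rw [one_mul] at h4
  refine h4.congr' ?_
  filter_upwards [h2.eventually_ne_atTop 0, eventually_ne_atTop 0] with n hn hn0
  have h5 : ((u n + k : ℕ) : ℝ) ≠ 0 := by exact_mod_cast hn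
  have h6 : (n : ℝ) ≠ 0 := by exact_mod_cast hn0
  have h7 : (u n + k : ℝ) ≠ 0 := by exact_mod_cast hn
  simp only [Function.comp]
  push_cast
  rw [div_pow]
  field_simp

theorem tendsto_bsum_div (r : ℕ) (s : ℕ → ℤ) {u : ℕ → ℕ} {c : ℝ}
    (hu : Tendsto (fun n => (u n : ℝ) / n) atTop (𝓝 c)) (hu' : Tendsto u atTop atTop) :
    Tendsto (fun n => (bsum r s (u n) : ℝ) / (n : ℝ) ^ r) atTop
      (𝓝 (s 0 * (c ^ r / r.factorial))) := by
  induction r generalizing s with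
  | zero => simp [bsum_zero]
  | succ r ih =>
    have h1 := (tendsto_choose_div (r + 1) hu hu').const_mul (s 0 : ℝ)
    have h2 := (ih (fun i => s (i + 1))).mul tendsto_one_div_atTop_nhds_zero_nat
    rw [mul_zero] at h2
    have h3 := h1.sub h2
    rw [sub_zero] at h3
    refine h3.congr fun n => ?_
    rw [bsum_succ', pow_succ]
    push_cast
    rcases eq_or_ne n 0 with rfl | hn
    · simp
    · have : (n : ℝ) ≠ 0 := by exact_mod_cast hn
      field_simp

theorem tendsto_bsum_div_self (r : ℕ) (s : ℕ → ℤ) :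
    Tendsto (fun n => (bsum r s n : ℝ) / (n : ℝ) ^ r) atTop (𝓝 (s 0 / r.factorial)) := by
  have := tendsto_bsum_div r s (u := id) (c := 1) (by
    refine tendsto_const_nhds.congr' ?_
    filter_upwards [eventually_ne_atTop 0] with n hn
    have : (n : ℝ) ≠ 0 := by exact_mod_cast hn
    simp [this]) tendsto_id
  simpa [div_eq_mul_inv] using this

theorem le_of_bsum_le {r : ℕ} {s t : ℕ → ℤ} (h : ∀ᶠ n in atTop, bsum r s n ≤ bsum r t n) :
    s 0 ≤ t 0 := by
  have := le_of_tendsto_of_tendsto (tendsto_bsum_div_self r s) (tendsto_bsum_div_self r t) (by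
    filter_upwards [h] with n hn
    have : (bsum r s n : ℝ) ≤ bsum r t n := by exact_mod_cast hn
    gcongr)
  have h2 : (0 : ℝ) < r.factorial := by positivity
  rw [div_le_div_iff_of_pos_right h2] at this
  exact_mod_cast this

theorem one_le_of_bsum_le {r : ℕ} {s t : ℕ → ℤ}
    (h : ∀ᶠ n in atTop, bsum (r + 1) s n ≤ bsum (r + 1) t n) (h0 : s 0 = t 0) : t 1 ≤ s 1 := by
  refine le_of_bsum_le (r := r) (s := fun i => t (i + 1)) (t := fun i => s (i + 1)) ?_
  filter_upwards [h] with n hn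
  rw [bsum_succ', bsum_succ', h0] at hn
  linarith

theorem zero_eq_of_bsum_eq {r : ℕ} {s t : ℕ → ℤ} (h : ∀ᶠ n in atTop, bsum r s n = bsum r t n) :
    s 0 = t 0 :=
  le_antisymm (le_of_bsum_le (h.mono fun _ => le_of_eq))
    (le_of_bsum_le (h.mono fun _ => ge_of_eq))

theorem one_eq_of_bsum_eq {r : ℕ} {s t : ℕ → ℤ}
    (h : ∀ᶠ n in atTop, bsum (r + 1) s n = bsum (r + 1) t n) : s 1 = t 1 :=
  le_antisymm (one_le_of_bsum_le (h.mono fun _ => ge_of_eq) (zero_eq_of_bsum_eq h).symm)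
    (one_le_of_bsum_le (h.mono fun _ => le_of_eq) (zero_eq_of_bsum_eq h))

/-- Summation of a function whose differences are eventually polynomial. -/
theorem exists_bsum_of_diff {r : ℕ} {s : ℕ → ℤ} {f : ℕ → ℤ}
    (h : ∀ᶠ n in atTop, f (n + 1) - f n = bsum r s (n + 1)) :
    ∃ t : ℕ → ℤ, (∀ i ≤ r, t i = s i) ∧ ∀ᶠ n in atTop, f n = bsum (r + 1) t n := by
  obtain ⟨N, hN⟩ := eventually_atTop.1 h
  let t : ℕ → ℤ := fun i => if i ≤ r then s i else (-1) ^ (r + 1) * (f N - bsum (r + 1)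
    (fun i => if i ≤ r then s i else 0) N)
  have ht : ∀ i ≤ r, t i = s i := fun i hi => by simp [t, hi]
  refine ⟨t, ht, eventually_atTop.2 ⟨N, fun n hn => ?_⟩⟩
  induction n, hn using Nat.le_induction with
  | base =>
    have h2 : bsum (r + 1) t N - bsum (r + 1) (fun i => if i ≤ r then s i else 0) N =
        (-1) ^ (r + 1) * t (r + 1) := by
      rw [bsum_succ, bsum_succ]
      rw [Finset.sum_congr rfl (g := fun i => (-1 : ℤ) ^ i * s i *
        ((N + (r + 1) - i).choose (r + 1 - i) : ℤ))]
      · rw [Finset.sum_congr rfl (g := fun i => (-1 : ℤ) ^ i * s i *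
          ((N + (r + 1) - i).choose (r + 1 - i) : ℤ)) (s₁ := Finset.range (r + 1)) (f := fun i =>
          (-1 : ℤ) ^ i * (if i ≤ r then s i else 0) * ((N + (r + 1) - i).choose (r + 1 - i) : ℤ))]
        · simp
        · intro i hi
          rw [if_pos (by simpa [Nat.lt_succ_iff] using hi)]
      · intro i hi
        rw [ht i (by simpa [Nat.lt_succ_iff] using hi)]
    have h3 : t (r + 1) = (-1) ^ (r + 1) * (f N - bsum (r + 1)
      (fun i => if i ≤ r then s i else 0) N) := by simp [t]
    rw [h3, ← mul_assoc, ← mul_pow] at h2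
    simp at h2
    linarith
  | succ n hn ih =>
    have h1 := hN n hn
    have h2 := bsum_diff r t n
    rw [bsum_congr ht] at h2
    linarith

end LocalCoh

namespace LocalCoh

section Index

variable {A : Type} [CommRing A]
variable {X Y Z : Type} [AddCommGroup X] [Module A X] [AddCommGroup Y] [Module A Y]
  [AddCommGroup Z] [Module A Z]

theorem length_range_le_of_ker_le {f : X →ₗ[A] Y} {g : X →ₗ[A] Z}
    (h : LinearMap.ker f ≤ LinearMap.ker g) :
    Module.length A (LinearMap.range g) ≤ Module.length A (LinearMap.range f) := by
  rw [← f.quotKerEquivRange.length_eq, ← g.quotKerEquivRange.length_eq]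
  exact Module.length_le_of_surjective (Submodule.factor h) (Submodule.factor_surjective h)

/-- The length of `L / (K ∩ L)`. -/
noncomputable def ix (K L : Submodule A X) : ℕ∞ :=
  Module.length A (LinearMap.range (K.mkQ ∘ₗ L.subtype))

theorem ker_mkQ_comp_subtype (K L : Submodule A X) :
    LinearMap.ker (K.mkQ ∘ₗ L.subtype) = Submodule.comap L.subtype K := by
  rw [LinearMap.ker_comp, Submodule.ker_mkQ]

theorem range_mkQ_comp_subtype (K L : Submodule A X) :
    LinearMap.range (K.mkQ ∘ₗ L.subtype) = Submodule.map K.mkQ L := by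
  rw [LinearMap.range_comp, Submodule.range_subtype]

theorem ix_top (K : Submodule A X) : ix K ⊤ = Module.length A (X ⧸ K) := by
  rw [ix, range_mkQ_comp_subtype, Submodule.map_top, Submodule.range_mkQ, Module.length_top]

theorem ix_bot (L : Submodule A X) : ix ⊥ L = Module.length A L := by
  rw [ix]
  refine (LinearEquiv.ofInjective ((⊥ : Submodule A X).mkQ ∘ₗ L.subtype) ?_).length_eq.symm
  rw [← LinearMap.ker_eq_bot, ker_mkQ_comp_subtype, Submodule.comap_bot, Submodule.ker_subtype]

theorem ix_mono_right (K : Submodule A X) {L L' : Submodule A X} (h : L ≤ L') :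
    ix K L ≤ ix K L' := by
  rw [ix, ix, range_mkQ_comp_subtype, range_mkQ_comp_subtype]
  have h' : L.map K.mkQ ≤ L'.map K.mkQ := Submodule.map_mono h
  exact Module.length_le_of_injective (Submodule.inclusion h') (Submodule.inclusion_injective h')

theorem ix_anti_left {K K' : Submodule A X} (L : Submodule A X) (h : K ⊓ L ≤ K') :
    ix K' L ≤ ix K L := by
  refine length_range_le_of_ker_le ?_
  rw [ker_mkQ_comp_subtype, ker_mkQ_comp_subtype]
  exact fun x hx => h ⟨hx, x.2⟩

theorem ix_inf (K L : Submodule A X) : ix (K ⊓ L) L = ix K L :=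
  le_antisymm (ix_anti_left L (by simp)) (ix_anti_left L (fun _ h => h.1.1))

theorem ix_le_length (K L : Submodule A X) : ix K L ≤ Module.length A L :=
  (ix_anti_left L (by simp)).trans (ix_bot L).le

theorem length_sup_le (S T : Submodule A X) :
    Module.length A ↥(S ⊔ T) ≤ Module.length A S + Module.length A T := by
  rw [← Module.length_prod]
  have h : LinearMap.range (S.subtype.coprod T.subtype) = S ⊔ T := by
    rw [LinearMap.range_coprod, Submodule.range_subtype, Submodule.range_subtype]
  rw [← h]
  exact Module.length_le_of_surjective _ (LinearMap.surjective_rangeRestrict _)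

theorem ix_sup_right (K L L' : Submodule A X) : ix K (L ⊔ L') ≤ ix K L + ix K L' := by
  rw [ix, ix, ix, range_mkQ_comp_subtype, range_mkQ_comp_subtype, range_mkQ_comp_subtype,
    Submodule.map_sup]
  exact length_sup_le _ _

theorem ix_add (K P : Submodule A X) :
    Module.length A (X ⧸ K) = ix K P + Module.length A (X ⧸ (K ⊔ P)) := by
  refine Module.length_eq_add_of_exact (LinearMap.range (K.mkQ ∘ₗ P.subtype)).subtype
    (Submodule.factor (le_sup_left : K ≤ K ⊔ P)) (Submodule.subtype_injective _)
    (Submodule.factor_surjective _) ?_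
  rw [LinearMap.exact_iff, Submodule.range_subtype, range_mkQ_comp_subtype]
  rw [Submodule.factor, Submodule.mapQ, Submodule.ker_liftQ]
  simp [Submodule.map_sup, Submodule.ker_mkQ]

theorem ix_self (K : Submodule A X) {L : Submodule A X} (h : L ≤ K) : ix K L = 0 := by
  rw [ix, range_mkQ_comp_subtype, Module.length_eq_zero_iff,
    (Submodule.eq_bot_iff (L.map K.mkQ)).2 (by
      rintro _ ⟨x, hx, rfl⟩
      exact (Submodule.Quotient.mk_eq_zero _).2 (h hx))]
  infer_instance

theorem ix_map_le (f : X →ₗ[A] Y) (K L : Submodule A X) : ix (K.map f) (L.map f) ≤ ix K L := by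
  have h : LinearMap.range ((K.map f).mkQ ∘ₗ (L.map f).subtype) =
      LinearMap.range ((K.map f).mkQ ∘ₗ f ∘ₗ L.subtype) := by
    rw [range_mkQ_comp_subtype, LinearMap.range_comp, LinearMap.range_comp, Submodule.range_subtype]
  rw [ix, h, ix]
  refine length_range_le_of_ker_le ?_
  rw [ker_mkQ_comp_subtype, LinearMap.ker_comp, Submodule.ker_mkQ, Submodule.comap_comp]
  exact Submodule.comap_mono (Submodule.le_comap_map f K)

end Index

end LocalCoh

namespace LocalCoh

open Filter

section Hilbert

variable {A : Type} [CommRing A]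
variable {X Y Z : Type} [AddCommGroup X] [Module A X] [AddCommGroup Y] [Module A Y]
  [AddCommGroup Z] [Module A Z]

theorem sup_pow_succ (I J : Ideal A) (m : ℕ) :
    (I ⊔ J) ^ (m + 1) = I * (I ⊔ J) ^ m ⊔ J ^ (m + 1) := by
  induction m with
  | zero => simp
  | succ m ih =>
    apply le_antisymm
    · rw [pow_succ' (I ⊔ J) (m + 1), Ideal.sup_mul]
      refine sup_le le_sup_left ?_
      rw [ih, Ideal.mul_sup, ← pow_succ']
      refine sup_le (le_sup_of_le_left ?_) le_sup_right
      rw [mul_left_comm, ← ih, pow_succ' (I ⊔ J) m]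
      exact Ideal.mul_mono le_rfl (Ideal.mul_mono le_sup_right le_rfl)
    · refine sup_le ?_ (Ideal.pow_right_mono le_sup_right _)
      rw [pow_succ' (I ⊔ J) (m + 1)]
      exact Ideal.mul_mono le_sup_left le_rfl

theorem span_singleton_smul_eq_map (x : A) (K : Submodule A X) :
    Ideal.span {x} • K = K.map (LinearMap.lsmul A X x) := by
  rw [Submodule.ideal_span_singleton_smul]
  rfl

theorem ix_pow_smul_le (l : List A) (m : ℕ) (K L : Submodule A X) :
    ix (Ideal.ofList l ^ m • K) (Ideal.ofList l ^ m • L) ≤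
      (Nat.multichoose l.length m : ℕ∞) * ix K L := by
  induction l generalizing m with
  | nil =>
    cases m with
    | zero => simp
    | succ m => simp [ix_self]
  | cons x l ih =>
    induction m with
    | zero => simp
    | succ m ihm =>
      rw [List.length_cons, Nat.multichoose_succ_succ, Ideal.ofList_cons, sup_pow_succ,
        Submodule.sup_smul, Submodule.sup_smul]
      refine (ix_sup_right _ _ _).trans ?_
      rw [Nat.cast_add, add_mul, add_comm]
      refine add_le_add ((ix_anti_left _ (inf_le_left.trans le_sup_right)).trans (ih _))
        ((ix_anti_left _ (inf_le_left.trans le_sup_left)).trans ?_)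
      rw [mul_smul, mul_smul, span_singleton_smul_eq_map, span_singleton_smul_eq_map]
      refine (ix_map_le _ _ _).trans ?_
      rw [← Ideal.ofList_cons]
      exact ihm

/-- The Hilbert function. -/
noncomputable def hf (Q : Ideal A) (X : Type) [AddCommGroup X] [Module A X] (n : ℕ) : ℕ∞ :=
  Module.length A (X ⧸ (Q ^ n • (⊤ : Submodule A X)))

theorem hf_zero (Q : Ideal A) : hf Q X 0 = 0 := by
  rw [hf, Module.length_eq_zero_iff]
  simp only [pow_zero, Ideal.one_eq_top, Submodule.top_smul]
  infer_instance

theorem hf_succ (Q : Ideal A) (n : ℕ) : hf Q X (n + 1) =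
    ix (Q ^ (n + 1) • (⊤ : Submodule A X)) (Q ^ n • (⊤ : Submodule A X)) + hf Q X n := by
  have h : Q ^ (n + 1) • (⊤ : Submodule A X) ≤ Q ^ n • (⊤ : Submodule A X) :=
    Submodule.smul_mono (Ideal.pow_le_pow_right n.le_succ) le_rfl
  rw [hf, ix_add _ (Q ^ n • (⊤ : Submodule A X)), sup_eq_right.2 h, hf]

theorem hf_mono (Q : Ideal A) {n m : ℕ} (h : n ≤ m) : hf Q X n ≤ hf Q X m :=
  Module.length_le_of_surjective
    (Submodule.factor (Submodule.smul_mono (Ideal.pow_le_pow_right h) le_rfl))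
    (Submodule.factor_surjective _)

theorem hf_anti {Q Q' : Ideal A} (h : Q ≤ Q') (n : ℕ) : hf Q' X n ≤ hf Q X n :=
  Module.length_le_of_surjective
    (Submodule.factor (Submodule.smul_mono (Ideal.pow_right_mono h n) le_rfl))
    (Submodule.factor_surjective _)

theorem hf_one (Q : Ideal A) : hf Q X 1 = Module.length A (X ⧸ Q • (⊤ : Submodule A X)) := by
  rw [hf, pow_one]

theorem hf_le (l : List A) (n : ℕ) : hf (Ideal.ofList l) X (n + 1) ≤
    ((n + l.length).choose l.length : ℕ∞) * hf (Ideal.ofList l) X 1 := by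
  induction n with
  | zero => simp
  | succ n ih =>
    rw [hf_succ]
    have h1 := ix_pow_smul_le l (n + 1) (Ideal.ofList l • (⊤ : Submodule A X)) ⊤
    rw [← mul_smul, ← pow_succ, ix_top, ← hf_one] at h1
    refine (add_le_add h1 ih).trans ?_
    rw [← add_mul, ← Nat.cast_add]
    gcongr
    rcases Nat.eq_zero_or_pos l.length with h | h
    · rw [h]; simp
    · obtain ⟨k, hk⟩ := Nat.exists_eq_succ_of_ne_zero h.ne'
      rw [hk, Nat.multichoose_eq, Nat.succ_eq_add_one, show n + 1 + (k + 1) = (n + k + 1) + 1 by ring,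
        Nat.choose_succ_succ, show k + 1 + (n + 1) - 1 = n + k + 1 by omega,
        show n + (k + 1) = n + k + 1 by ring, ← Nat.choose_symm_of_eq_add (a := k)]
      omega

theorem hf_ne_top (l : List A) (h : hf (Ideal.ofList l) X 1 ≠ ⊤) (n : ℕ) :
    hf (Ideal.ofList l) X n ≠ ⊤ := by
  refine ne_top_of_le_ne_top ?_ ((hf_mono _ n.le_succ).trans (hf_le l n))
  exact WithTop.mul_ne_top (ENat.natCast_ne_top _) h

theorem hf_congr (e : X ≃ₗ[A] Y) (Q : Ideal A) (n : ℕ) : hf Q X n = hf Q Y n := by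
  refine (Submodule.Quotient.equiv _ _ e ?_).length_eq
  rw [Submodule.map_smul'', Submodule.map_top, LinearEquiv.range]

theorem hf_le_of_surjective {f : X →ₗ[A] Y} (hf' : Function.Surjective f) (Q : Ideal A) (n : ℕ) :
    hf Q Y n ≤ hf Q X n := by
  refine Module.length_le_of_surjective (Submodule.mapQ (Q ^ n • ⊤) (Q ^ n • ⊤) f ?_) ?_
  · rw [← Submodule.map_le_iff_le_comap, Submodule.map_smul'']
    exact Submodule.smul_mono le_rfl le_top
  · intro y
    obtain ⟨y, rfl⟩ := Submodule.mkQ_surjective _ y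
    obtain ⟨x, rfl⟩ := hf' y
    exact ⟨Submodule.Quotient.mk x, rfl⟩

/-- The quotient of a quotient by a power. -/
theorem hf_quotient (V : Submodule A X) (Q : Ideal A) (n : ℕ) :
    hf Q (X ⧸ V) n = Module.length A (X ⧸ ((Q ^ n • (⊤ : Submodule A X)) ⊔ V)) := by
  have h : Q ^ n • (⊤ : Submodule A (X ⧸ V)) =
      ((Q ^ n • (⊤ : Submodule A X)) ⊔ V).map V.mkQ := by
    rw [Submodule.map_sup, Submodule.map_smul'', Submodule.map_top, Submodule.range_mkQ]
    simp
  rw [hf, h]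
  exact (Submodule.quotientQuotientEquivQuotient V _ le_sup_right).length_eq

/-- Comparison of the Hilbert functions of a module and a quotient. -/
theorem hf_eq_add (V : Submodule A X) (Q : Ideal A) (n : ℕ) :
    hf Q X n = ix (Q ^ n • (⊤ : Submodule A X)) V + hf Q (X ⧸ V) n := by
  rw [hf_quotient, hf, ix_add]

theorem ix_le_hf (V : Submodule A X) (Q : Ideal A) (n : ℕ) :
    ix (Q ^ n • (⊤ : Submodule A X)) V ≤ hf Q V n := by
  have h : (Q ^ n • (⊤ : Submodule A V)).map V.subtype = Q ^ n • V := by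
    rw [Submodule.map_smul'', Submodule.map_top, Submodule.range_subtype]
  rw [hf, ← ix_top]
  have h2 := ix_anti_left V (K := Q ^ n • V) (K' := Q ^ n • (⊤ : Submodule A X))
    (inf_le_left.trans (Submodule.smul_mono le_rfl le_top))
  refine h2.trans ?_
  rw [← h]
  have h3 := ix_map_le V.subtype (Q ^ n • (⊤ : Submodule A V)) ⊤
  rwa [Submodule.map_top, Submodule.range_subtype] at h3

/-- The kernel of multiplication by `x` on the graded pieces. -/
noncomputable def dfun (x : A) (Q : Ideal A) (X : Type) [AddCommGroup X] [Module A X] (n : ℕ) :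
    ℕ∞ :=
  ix (Q ^ n • (⊤ : Submodule A X)) ((Q ^ (n + 1) • ⊤ : Submodule A X).comap (LinearMap.lsmul A X x))

theorem hf_add_dfun {x : A} {Q : Ideal A} (hx : x ∈ Q) (n : ℕ) :
    hf Q X (n + 1) + dfun x Q X n =
      hf Q X n + hf Q (X ⧸ LinearMap.range (LinearMap.lsmul A X x)) (n + 1) := by
  have hle : (Q ^ n • (⊤ : Submodule A X)) ≤
      (Q ^ (n + 1) • ⊤ : Submodule A X).comap (LinearMap.lsmul A X x) := by
    rw [← Submodule.map_le_iff_le_comap, ← span_singleton_smul_eq_map, ← mul_smul, pow_succ']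
    exact Submodule.smul_mono (Ideal.mul_mono ((Ideal.span_singleton_le_iff_mem _).2 hx) le_rfl)
      le_rfl
  have h1 : hf Q X n = dfun x Q X n + Module.length A
      (X ⧸ (Q ^ (n + 1) • ⊤ : Submodule A X).comap (LinearMap.lsmul A X x)) := by
    rw [hf, ix_add _ ((Q ^ (n + 1) • ⊤ : Submodule A X).comap (LinearMap.lsmul A X x)),
      sup_eq_right.2 hle, dfun]
  have h2 : ix (Q ^ (n + 1) • (⊤ : Submodule A X)) (LinearMap.range (LinearMap.lsmul A X x)) =
      Module.length A (X ⧸ (Q ^ (n + 1) • ⊤ : Submodule A X).comap (LinearMap.lsmul A X x)) := by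
    rw [ix, range_mkQ_comp_subtype, ← LinearMap.range_comp,
      ← (LinearMap.quotKerEquivRange _).length_eq, LinearMap.ker_comp, Submodule.ker_mkQ]
  rw [hf_eq_add (LinearMap.range (LinearMap.lsmul A X x)) Q (n + 1), h1, h2]
  ring

end Hilbert

end LocalCoh

namespace LocalCoh

open Filter

section Content

variable {A : Type} [CommRing A] {N : Type} [AddCommGroup N] [Module A N]

/-- The product of a polynomial, given by the list of its coefficients, with a sequence. -/
def mulL : List A → (ℕ → N) → ℕ → N
  | [], _, _ => 0
  | x :: _, f, 0 => x • f 0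
  | x :: l, f, k + 1 => x • f (k + 1) + mulL l f k

theorem mulL_smul (l : List A) (a : A) (f : ℕ → N) (k : ℕ) :
    mulL l (fun j => a • f j) k = a • mulL l f k := by
  induction l generalizing k with
  | nil => simp [mulL]
  | cons x l ih =>
    cases k with
    | zero => simp only [mulL]; rw [smul_comm]
    | succ k => simp only [mulL, ih, smul_add]; rw [smul_comm]

theorem mulL_mem (l : List A) (f : ℕ → N) (k : ℕ) (P : Submodule A N) (h : ∀ j ≤ k, f j ∈ P) :
    mulL l f k ∈ Ideal.ofList l • P := by
  induction l generalizing k with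
  | nil => simp [mulL]
  | cons x l ih =>
    have hx : x ∈ Ideal.ofList (x :: l) := Ideal.subset_span (by simp)
    have hl : Ideal.ofList l ≤ Ideal.ofList (x :: l) := by
      rw [Ideal.ofList_cons]; exact le_sup_right
    cases k with
    | zero => exact Submodule.smul_mem_smul hx (h 0 le_rfl)
    | succ k =>
      exact add_mem (Submodule.smul_mem_smul hx (h _ le_rfl))
        (Submodule.smul_mono hl le_rfl (ih k fun j hj => h j (by omega)))

theorem pow_smul_smul_le {Q Q' : Ideal A} (h : Q' ≤ Q) (m n : ℕ) (W : Submodule A N) :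
    Q' ^ m • (Q ^ n • W) ≤ Q ^ (m + n) • W := by
  rw [← mul_smul, pow_add]
  exact Submodule.smul_mono (Ideal.mul_mono (Ideal.pow_right_mono h m) le_rfl) le_rfl

/-- A form of the Dedekind-Mertens lemma for modules. -/
theorem exists_pow_smul_content_le (l : List A) (d : ℕ) : ∃ J : ℕ, ∀ (f : ℕ → N),
    (∀ j > d, f j = 0) → ∀ W : Submodule A N, (∀ k, mulL l f k ∈ W) →
    ∀ j, ∀ a ∈ Ideal.ofList l ^ (J + 1), a • f j ∈ Ideal.ofList l ^ J • W := by
  induction l with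
  | nil => exact ⟨0, fun f _ W _ j a ha => by simp at ha; simp [ha]⟩
  | cons x l ih =>
    obtain ⟨J, hJ⟩ := ih
    set Q := Ideal.ofList (x :: l) with hQ
    have hxQ : x ∈ Q := Ideal.subset_span (by simp)
    have hlQ : Ideal.ofList l ≤ Q := by
      rw [hQ, Ideal.ofList_cons]; exact le_sup_right
    have hxpow : ∀ (n m : ℕ) (W : Submodule A N) (u : N), u ∈ Q ^ m • W →
        x ^ n • u ∈ Q ^ (n + m) • W := fun n m W u hu =>
      pow_smul_smul_le le_rfl n m W (Submodule.smul_mem_smul (Ideal.pow_mem_pow hxQ n) hu)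
    have key : ∀ e ≤ d + 1, ∃ K : ℕ, ∀ (f : ℕ → N), (∀ j > d, f j = 0) → ∀ W : Submodule A N,
        (∀ k, mulL (x :: l) f k ∈ W) → ∀ j, ∀ a ∈ Q ^ (K + 1), a • x ^ e • f j ∈ Q ^ (K + e) • W := by
      intro e he
      induction he using Nat.decreasingInduction with
      | self =>
        refine ⟨0, fun f hf W hW j a ha => ?_⟩
        have h1 : ∀ j, ∀ i ≤ j, x ^ (j + 1) • f i ∈ Q ^ j • W := by
          intro j
          induction j with
          | zero =>
            intro i hi
            obtain rfl : i = 0 := by omega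
            simpa [mulL] using hW 0
          | succ j ihj =>
            intro i hi
            rcases Nat.lt_or_ge i (j + 1) with hi' | hi'
            · have := hxpow 1 j W _ (ihj i (by omega))
              rwa [smul_smul, ← pow_add, add_comm 1 (j + 1), add_comm 1 j] at this
            · obtain rfl : i = j + 1 := by omega
              have h2 := hW (j + 1)
              simp only [mulL] at h2
              have h3 : x ^ (j + 1) • mulL l f j ∈ Q ^ (j + 1) • W := by
                rw [← mulL_smul]
                have := mulL_mem l _ j (Q ^ j • W) ihj
                rw [show Q ^ (j + 1) = Q ^ (1 + j) by rw [add_comm]]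
                have h4 := pow_smul_smul_le hlQ 1 j W
                rw [pow_one] at h4
                exact h4 this
              have h4 : x ^ (j + 1) • (x • f (j + 1) + mulL l f j) ∈ Q ^ (j + 1) • W :=
                Submodule.smul_mem_smul (Ideal.pow_mem_pow hxQ _) h2
              have h5 := sub_mem h4 h3
              rwa [smul_add, add_sub_cancel_right, smul_smul, ← pow_succ] at h5
        have h2 : x ^ (d + 1) • f j ∈ Q ^ d • W := by
          rcases le_or_gt j d with hj | hj
          · exact h1 d j hj
          · rw [hf j hj, smul_zero]; exact zero_mem _
        have h3 := Submodule.smul_mem_smul ha h2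
        have h4 := pow_smul_smul_le le_rfl (0 + 1) d W h3
        rwa [show 0 + (d + 1) = 0 + 1 + d by ring]
      | of_succ e he ihe =>
        obtain ⟨K, hK⟩ := ihe
        refine ⟨J + K + 1, fun f hf W hW j a ha => ?_⟩
        have h1 : a ∈ (Ideal.span {x} * Q ^ J ⊔ Ideal.ofList l ^ (J + 1)) * Q ^ (K + 1) := by
          rw [hQ, Ideal.ofList_cons, ← sup_pow_succ, ← Ideal.ofList_cons, ← hQ, ← pow_add,
            show J + 1 + (K + 1) = J + K + 1 + 1 by ring]
          exact ha
        rw [Ideal.sup_mul] at h1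
        obtain ⟨u, hu, v, hv, rfl⟩ := Submodule.mem_sup.1 h1
        rw [add_smul]
        refine add_mem ?_ ?_
        · rw [mul_assoc, ← pow_add] at hu
          obtain ⟨w, hw, rfl⟩ := Ideal.mem_span_singleton_mul.1 hu
          rw [show J + (K + 1) = J + (K + 1) from rfl, pow_add] at hw
          have : (x * w) • x ^ e • f j = w • x ^ (e + 1) • f j := by
            rw [pow_succ', mul_comm, mul_smul, mul_smul, smul_smul x (x ^ e)]
          rw [this]
          refine Submodule.mul_induction_on hw ?_ ?_
          · intro b hb c hc
            rw [mul_smul]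
            have := pow_smul_smul_le le_rfl J _ W
              (Submodule.smul_mem_smul hb (hK f hf W hW j c hc))
            rwa [show J + K + 1 + e = J + (K + (e + 1)) by ring]
          · intro b c hb hc
            rw [add_smul]
            exact add_mem hb hc
        · refine Submodule.mul_induction_on hv ?_ ?_
          · intro b hb c hc
            have h2 := hJ (fun j => c • x ^ e • f j) (fun j hj => by simp [hf j hj])
              (Q ^ (K + 1 + e) • W) (fun k => by
                have h3 : mulL (x :: l) (fun j => c • x ^ e • f j) (k + 1) ∈
                    Q ^ (K + 1 + e) • W := by
                  rw [mulL_smul, mulL_smul, smul_smul, pow_add]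
                  exact Submodule.smul_mem_smul (Ideal.mul_mem_mul hc (Ideal.pow_mem_pow hxQ e))
                    (hW _)
                have h4 : x • c • x ^ e • f (k + 1) ∈ Q ^ (K + 1 + e) • W := by
                  rw [smul_comm, smul_smul x, ← pow_succ', show K + 1 + e = K + (e + 1) by ring]
                  exact hK f hf W hW _ c hc
                simp only [mulL] at h3
                have h5 := sub_mem h3 h4
                rwa [add_sub_cancel_left] at h5) j b hb
            rw [mul_smul]
            have h6 : Ideal.ofList l ^ J • (Q ^ (K + 1 + e) • W) ≤ Q ^ (J + K + 1 + e) • W := by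
              rw [show J + K + 1 + e = J + (K + 1 + e) by ring]
              exact pow_smul_smul_le hlQ _ _ _
            exact h6 h2
          · intro b c hb hc
            rw [add_smul]
            exact add_mem hb hc
    obtain ⟨K, hK⟩ := key 0 (Nat.zero_le _)
    exact ⟨K, fun f hf W hW j a ha => by simpa using hK f hf W hW j a ha⟩

end Content

end LocalCoh

namespace LocalCoh

open TensorProduct

section GaussExtension

variable (A : Type) [CommRing A] [IsLocalRing A]

/-- The local ring `A(T)`, the localization of `A[T]` at the extension of the maximal ideal. -/
abbrev GaussExt : Type := Localization.AtPrime (Ideal.map Polynomial.C (maximalIdeal A))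

instance gaussExt_flat : Module.Flat A (GaussExt A) :=
  Module.Flat.trans A (Polynomial A) (GaussExt A)

theorem map_maximalIdeal_gaussExt :
    (maximalIdeal A).map (algebraMap A (GaussExt A)) = maximalIdeal (GaussExt A) := by
  rw [IsScalarTower.algebraMap_eq A (Polynomial A) (GaussExt A), ← Ideal.map_map,
    Polynomial.algebraMap_eq]
  exact Localization.AtPrime.map_eq_maximalIdeal

instance gaussExt_isLocalHom : IsLocalHom (algebraMap A (GaussExt A)) :=
  ((IsLocalRing.local_hom_TFAE (algebraMap A (GaussExt A))).out 0 2).2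
    (map_maximalIdeal_gaussExt A).le

variable {A}

theorem algebraMap_C_gaussExt (a : A) : algebraMap (Polynomial A) (GaussExt A) (Polynomial.C a) =
    algebraMap A (GaussExt A) a := by
  rw [IsScalarTower.algebraMap_apply A (Polynomial A) (GaussExt A), Polynomial.algebraMap_eq]

theorem isUnit_algebraMap_gaussExt {p : Polynomial A} {k : ℕ} (h : p.coeff k ∉ maximalIdeal A) :
    IsUnit (algebraMap (Polynomial A) (GaussExt A) p) := by
  refine IsLocalization.map_units (M := (Ideal.map Polynomial.C (maximalIdeal A)).primeCompl)
    (GaussExt A) ⟨p, fun hp => h ?_⟩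
  exact Ideal.mem_map_C_iff.1 hp k

variable {X Y : Type} [AddCommGroup X] [Module A X] [AddCommGroup Y] [Module A Y]

/-- The element `∑ T ^ j ⊗ f j`. -/
noncomputable def evT (D : ℕ) (f : ℕ → X) : GaussExt A ⊗[A] X :=
  ∑ j ∈ Finset.range D, algebraMap (Polynomial A) (GaussExt A) (Polynomial.X ^ j) ⊗ₜ f j

theorem lTensor_evT (φ : X →ₗ[A] Y) (D : ℕ) (f : ℕ → X) :
    φ.lTensor (GaussExt A) (evT D f) = evT D (fun j => φ (f j)) := by
  simp [evT, map_sum]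

theorem exists_eval_ne_zero [IsNoetherianRing A] [Module.Finite A X] {ι : Type*} (g : ι → X)
    (hg : Submodule.span A (Set.range g) = ⊤) [Nontrivial X] :
    ∃ φ : X →ₗ[A] ResidueField A, ∃ k, φ (g k) ≠ 0 := by
  have h1 : (maximalIdeal A) • (⊤ : Submodule A X) ≠ ⊤ := fun h => by
    have := Submodule.eq_bot_of_le_smul_of_le_jacobson_bot (maximalIdeal A) (⊤ : Submodule A X)
      Module.Finite.fg_top h.ge (IsLocalRing.maximalIdeal_le_jacobson _)
    exact top_ne_bot this
  have : ∃ k, g k ∉ (maximalIdeal A) • (⊤ : Submodule A X) := by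
    by_contra! h
    have h2 : Submodule.span A (Set.range g) ≤ (maximalIdeal A) • (⊤ : Submodule A X) := by
      rw [Submodule.span_le]
      rintro _ ⟨k, rfl⟩
      exact h k
    exact h1 (eq_top_iff.2 (hg ▸ h2))
  obtain ⟨k, hk⟩ := this
  have h2 : (1 : ResidueField A) ⊗ₜ[A] (g k) ≠ 0 := fun h => hk (by
    have h0 : (1 : A ⧸ maximalIdeal A) ⊗ₜ[A] (g k) = 0 := h
    have h4 := TensorProduct.quotTensorEquivQuotSMul_mk_one_tmul (maximalIdeal A) (g k)
    rw [h0, map_zero] at h4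
    exact (Submodule.Quotient.mk_eq_zero _).1 h4.symm)
  obtain ⟨ψ, hψ⟩ := Module.Projective.exists_dual_ne_zero (ResidueField A) h2
  exact ⟨ψ.restrictScalars A ∘ₗ TensorProduct.mk A (ResidueField A) X 1, k, hψ⟩

theorem eq_zero_of_evT_eq_zero [IsNoetherianRing A] [Module.Finite A X] (D : ℕ) (g : ℕ → X)
    (h : evT (A := A) D g = 0) : ∀ k < D, g k = 0 := by
  set P : Submodule A X := Submodule.span A (Set.range fun k : Fin D => g k) with hP
  have hmem : ∀ k < D, g k ∈ P := fun k hk => Submodule.subset_span ⟨⟨k, hk⟩, rfl⟩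
  rcases subsingleton_or_nontrivial P with hs | hs
  · intro k hk
    exact congrArg Subtype.val (Subsingleton.elim (⟨g k, hmem k hk⟩ : P) 0)
  exfalso
  let g' : ℕ → P := fun k => if hk : k < D then ⟨g k, hmem k hk⟩ else 0
  have h1 : evT (A := A) D g' = 0 := by
    apply Module.Flat.lTensor_preserves_injective_linearMap (M := GaussExt A) P.subtype
      P.subtype_injective
    rw [lTensor_evT, map_zero, ← h]
    refine Finset.sum_congr rfl fun k hk => ?_
    simp [g', Finset.mem_range.1 hk]
  have h2 : Submodule.span A (Set.range fun k : Fin D => g' k) = ⊤ := by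
    apply Submodule.map_injective_of_injective P.subtype_injective
    rw [Submodule.map_span, Submodule.map_top, Submodule.range_subtype, ← Set.range_comp]
    refine Eq.trans ?_ hP.symm
    congr 2
    ext k
    simp [g']
  obtain ⟨φ, k, hk⟩ := exists_eval_ne_zero _ h2
  choose a ha using fun j => IsLocalRing.residue_surjective (φ (g' j))
  have h3 : algebraMap (Polynomial A) (GaussExt A)
      (∑ j ∈ Finset.range D, Polynomial.C (a j) * Polynomial.X ^ j) ⊗ₜ[A] (1 : ResidueField A)
        = 0 := by
    have h4 := lTensor_evT φ D g'
    rw [h1, map_zero] at h4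
    rw [h4, evT, map_sum, TensorProduct.sum_tmul]
    refine Finset.sum_congr rfl fun j _ => ?_
    rw [← ha j, map_mul, algebraMap_C_gaussExt,
      ← Algebra.smul_def, TensorProduct.smul_tmul]
    congr 1
    rw [Algebra.smul_def, mul_one]
    rfl
  have h4 : IsUnit (algebraMap (Polynomial A) (GaussExt A)
      (∑ j ∈ Finset.range D, Polynomial.C (a j) * Polynomial.X ^ j)) := by
    refine isUnit_algebraMap_gaussExt (k := k) fun h5 => hk ?_
    have h6 : (∑ j ∈ Finset.range D, Polynomial.C (a j) * Polynomial.X ^ j).coeff k = a k := by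
      simp [Polynomial.coeff_C_mul, Polynomial.coeff_X_pow]
    rw [h6] at h5
    rw [← ha k]
    exact (IsLocalRing.residue_eq_zero_iff _).2 h5
  obtain ⟨u, hu⟩ := h4
  have h5 : (1 : GaussExt A ⊗[A] ResidueField A) = 0 := by
    have := congrArg (fun z => (↑u⁻¹ : GaussExt A) • z) h3
    simpa [← hu, TensorProduct.smul_tmul', smul_zero, Algebra.TensorProduct.one_def] using this
  have : Module.FaithfullyFlat A (GaussExt A) := Module.FaithfullyFlat.of_flat_of_isLocalHom
  have : Nontrivial (GaussExt A ⊗[A] ResidueField A) :=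
    Module.FaithfullyFlat.lTensor_nontrivial A (GaussExt A) (ResidueField A)
  exact one_ne_zero h5

/-- The polynomial with a given list of coefficients. -/
noncomputable def polL : List A → Polynomial A
  | [] => 0
  | x :: l => Polynomial.C x + Polynomial.X * polL l

theorem evT_succ (D : ℕ) (f : ℕ → X) : evT (A := A) (D + 1) f = (1 : GaussExt A) ⊗ₜ f 0 +
    algebraMap (Polynomial A) (GaussExt A) Polynomial.X • evT D (fun j => f (j + 1)) := by
  rw [evT, Finset.sum_range_succ', add_comm, pow_zero, map_one, evT, Finset.smul_sum]
  congr 1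
  refine Finset.sum_congr rfl fun j _ => ?_
  rw [TensorProduct.smul_tmul', pow_succ', map_mul, smul_eq_mul]

theorem evT_add (D : ℕ) (f g : ℕ → X) :
    evT (A := A) D (fun j => f j + g j) = evT D f + evT D g := by
  simp [evT, TensorProduct.tmul_add, Finset.sum_add_distrib]

theorem evT_smul (D : ℕ) (x : A) (f : ℕ → X) :
    evT (A := A) D (fun j => x • f j) = algebraMap A (GaussExt A) x • evT D f := by
  simp [evT, Finset.smul_sum, TensorProduct.smul_tmul', TensorProduct.tmul_smul,
    algebraMap_smul]

theorem evT_of_le {D E : ℕ} (h : D ≤ E) (f : ℕ → X) (hf : ∀ j ≥ D, f j = 0) :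
    evT (A := A) E f = evT D f := by
  refine (Finset.sum_subset (Finset.range_mono h) fun j _ hj => ?_).symm
  rw [hf j (by simpa using hj), TensorProduct.tmul_zero]

theorem polL_smul_evT (l : List A) (D : ℕ) (f : ℕ → X) (hf : ∀ j ≥ D, f j = 0) :
    algebraMap (Polynomial A) (GaussExt A) (polL l) • evT (A := A) D f =
      evT (D + l.length) (mulL l f) := by
  induction l with
  | nil => simp [polL, evT, mulL]
  | cons x l ih =>
    have h1 : mulL (x :: l) f = fun j => x • f j + (match j with
      | 0 => 0
      | k + 1 => mulL l f k) := by
      funext j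
      cases j with
      | zero => simp [mulL]
      | succ j => simp [mulL]
    rw [polL, map_add, map_mul, add_smul, mul_smul, ih, h1, evT_add, evT_smul,
      evT_of_le (Nat.le_add_right _ _) f hf, List.length_cons, ← add_assoc, evT_succ]
    simp only [TensorProduct.tmul_zero, zero_add]
    rw [algebraMap_C_gaussExt]

theorem exists_add_evT (D E : ℕ) (f g : ℕ → X) (hf : ∀ j ≥ D, f j = 0) (hg : ∀ j ≥ E, g j = 0) :
    ∃ (D' : ℕ) (f' : ℕ → X), (∀ j ≥ D', f' j = 0) ∧
      evT (A := A) D f + evT E g = evT D' f' := by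
  refine ⟨D + E, fun j => f j + g j, fun j hj => ?_, ?_⟩
  · simp only [hf j (by omega), hg j (by omega), add_zero]
  · rw [evT_add, evT_of_le (Nat.le_add_right D E) f hf, evT_of_le (Nat.le_add_left E D) g hg]

theorem exists_smul_evT (p : Polynomial A) (D : ℕ) (f : ℕ → X) (hf : ∀ j ≥ D, f j = 0) :
    ∃ (D' : ℕ) (f' : ℕ → X), (∀ j ≥ D', f' j = 0) ∧
      algebraMap (Polynomial A) (GaussExt A) p • evT (A := A) D f = evT D' f' := by
  induction p using Polynomial.induction_on' generalizing D f with
  | add p q hp hq =>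
    obtain ⟨D₁, f₁, h₁, e₁⟩ := hp D f hf
    obtain ⟨D₂, f₂, h₂, e₂⟩ := hq D f hf
    rw [map_add, add_smul, e₁, e₂]
    exact exists_add_evT _ _ _ _ h₁ h₂
  | monomial n a =>
    induction n with
    | zero =>
      refine ⟨D, fun j => a • f j, fun j hj => by simp only [hf j hj, smul_zero], ?_⟩
      rw [evT_smul, Polynomial.monomial_zero_left, algebraMap_C_gaussExt]
    | succ n ih =>
      obtain ⟨D₁, f₁, h₁, e₁⟩ := ih
      refine ⟨D₁ + 1, fun j => match j with
        | 0 => 0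
        | k + 1 => f₁ k, fun j hj => ?_, ?_⟩
      · cases j with
        | zero => rfl
        | succ j => exact h₁ j (by omega)
      · rw [evT_succ, ← e₁, TensorProduct.tmul_zero, zero_add, smul_smul, ← map_mul,
          Polynomial.X_mul_monomial]

theorem exists_smul_eq_evT (z : GaussExt A ⊗[A] X) : ∃ u : GaussExt A, IsUnit u ∧
    ∃ (D : ℕ) (f : ℕ → X), (∀ j ≥ D, f j = 0) ∧ u • z = evT D f := by
  suffices ∃ s : (Ideal.map Polynomial.C (maximalIdeal A)).primeCompl,
      ∃ (D : ℕ) (f : ℕ → X), (∀ j ≥ D, f j = 0) ∧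
        algebraMap (Polynomial A) (GaussExt A) s • z = evT D f by
    obtain ⟨s, h⟩ := this
    exact ⟨_, IsLocalization.map_units (GaussExt A) s, h⟩
  induction z with
  | zero => exact ⟨1, 0, 0, fun _ _ => rfl, by simp [evT]⟩
  | tmul b x =>
    obtain ⟨⟨p, s⟩, h⟩ := IsLocalization.surj
      (Ideal.map Polynomial.C (maximalIdeal A)).primeCompl b
    refine ⟨s, ?_⟩
    have h1 : algebraMap (Polynomial A) (GaussExt A) s • (b ⊗ₜ[A] x) =
        algebraMap (Polynomial A) (GaussExt A) p • evT 1 (fun j => if j = 0 then x else 0) := by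
      rw [TensorProduct.smul_tmul', smul_eq_mul, mul_comm, h]
      simp [evT, TensorProduct.smul_tmul', Algebra.smul_def]
    rw [h1]
    exact exists_smul_evT p 1 _ fun j hj => if_neg (by omega)
  | add z w hz hw =>
    obtain ⟨s, D, f, hf, hs⟩ := hz
    obtain ⟨t, E, g, hg, ht⟩ := hw
    obtain ⟨D₁, f₁, h₁, e₁⟩ := exists_smul_evT t.1 D f hf
    obtain ⟨D₂, f₂, h₂, e₂⟩ := exists_smul_evT s.1 E g hg
    refine ⟨s * t, ?_⟩
    have : algebraMap (Polynomial A) (GaussExt A) ↑(s * t) • (z + w) =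
        evT D₁ f₁ + evT D₂ f₂ := by
      rw [← e₁, ← e₂, ← hs, ← ht, smul_smul, smul_smul, ← map_mul, ← map_mul, smul_add,
        Submonoid.coe_mul, mul_comm t.1 s.1]
    rw [this]
    exact exists_add_evT _ _ _ _ h₁ h₂

end GaussExtension

section BaseChange

variable {A B X : Type} [CommRing A] [CommRing B] [Algebra A B] [AddCommGroup X] [Module A X]

theorem one_tmul_mem (I : Ideal A) {u : X} (hu : u ∈ I • (⊤ : Submodule A X)) (b : B) :
    b ⊗ₜ[A] u ∈ I.map (algebraMap A (B)) •
      (⊤ : Submodule (B) (B ⊗[A] X)) := by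
  induction hu using Submodule.smul_induction_on' with
  | smul a ha v _ =>
    rw [← TensorProduct.smul_tmul, ← algebraMap_smul (B) a b, ← TensorProduct.smul_tmul']
    exact Submodule.smul_mem_smul (Ideal.mem_map_of_mem _ ha) trivial
  | add v _ w _ hv hw =>
    rw [TensorProduct.tmul_add]
    exact add_mem hv hw

theorem lTensor_mkQ_eq_zero (I : Ideal A) {z : B ⊗[A] X}
    (hz : z ∈ I.map (algebraMap A (B)) •
      (⊤ : Submodule (B) (B ⊗[A] X))) :
    AlgebraTensorModule.lTensor (B) (B) (I • (⊤ : Submodule A X)).mkQ z = 0 := by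
  set φ := AlgebraTensorModule.lTensor (B) (B) (I • (⊤ : Submodule A X)).mkQ
  suffices h : I.map (algebraMap A (B)) • (⊤ : Submodule (B) _) ≤
      LinearMap.ker φ from h hz
  rw [Submodule.smul_le]
  intro b hb w _
  rw [LinearMap.mem_ker]
  refine Submodule.span_induction (p := fun b _ => φ (b • w) = 0) ?_ ?_ ?_ ?_ hb
  · rintro _ ⟨a, ha, rfl⟩
    induction w with
    | zero => simp
    | add v w hv hw => rw [smul_add, map_add, hv trivial, hw trivial, add_zero]
    | tmul c v =>
      rw [algebraMap_smul, TensorProduct.smul_tmul', TensorProduct.smul_tmul]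
      have : (I • (⊤ : Submodule A X)).mkQ (a • v) = 0 :=
        (Submodule.Quotient.mk_eq_zero _).2 (Submodule.smul_mem_smul ha trivial)
      rw [AlgebraTensorModule.lTensor_tmul, this, TensorProduct.tmul_zero]
  · simp
  · intro b c _ _ hb hc
    rw [add_smul, map_add, hb, hc, add_zero]
  · intro b c _ hc
    rw [smul_assoc, map_smul, hc, smul_zero]

/-- Lengths are preserved by flat local extensions with trivial closed fibre. -/
theorem length_baseChange_quotient [Module.Flat A B] [IsLocalRing A] [IsLocalRing B]
    [IsLocalHom (algebraMap A B)]
    (hB : (maximalIdeal A).map (algebraMap A B) = maximalIdeal B) (I : Ideal A) :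
    Module.length (B) ((B ⊗[A] X) ⧸ (I.map (algebraMap A (B)) •
      (⊤ : Submodule (B) (B ⊗[A] X)))) =
    Module.length A (X ⧸ I • (⊤ : Submodule A X)) := by
  have h1 := IsLocalRing.length_baseChange A (B) (X ⧸ I • (⊤ : Submodule A X))
  have h2 : Module.length (B)
      (B ⧸ (maximalIdeal A).map (algebraMap A (B))) = 1 := by
    rw [hB, Module.length_eq_one_iff]
    exact isSimpleModule_iff_quot_maximal.2 ⟨_, inferInstance, ⟨LinearEquiv.refl _ _⟩⟩
  rw [h2, mul_one] at h1
  rw [← h1]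
  set φ := AlgebraTensorModule.lTensor (B) (B) (I • (⊤ : Submodule A X)).mkQ
  have hφ : Function.Surjective φ :=
    LinearMap.lTensor_surjective _ (Submodule.mkQ_surjective _)
  have hk : LinearMap.ker φ = I.map (algebraMap A (B)) • ⊤ := by
    apply le_antisymm
    · intro z hz
      have h3 := (lTensor_exact (B) (LinearMap.exact_subtype_mkQ (I • (⊤ : Submodule A X)))
        (Submodule.mkQ_surjective _) z).1 hz
      obtain ⟨w, rfl⟩ := h3
      clear hz
      induction w with
      | zero => simp
      | add v w hv hw =>
        rw [map_add]
        exact add_mem hv hw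
      | tmul c v => exact one_tmul_mem I v.2 c
    · intro z hz
      exact lTensor_mkQ_eq_zero I hz
  rw [← hk]
  exact (φ.quotKerEquivOfSurjective hφ).length_eq

end BaseChange

end LocalCoh

namespace LocalCoh

section FiniteLength

variable {A : Type} [CommRing A] [IsLocalRing A] {X : Type} [AddCommGroup X] [Module A X]

theorem exists_ofList_eq [IsNoetherianRing A] (I : Ideal A) : ∃ l : List A, Ideal.ofList l = I := by
  obtain ⟨s, hs⟩ := (isNoetherianRing_iff_ideal_fg A).1 inferInstance I
  exact ⟨s.toList, by rw [Ideal.ofList, ← hs]; congr 1; ext; simp⟩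

theorem exists_pow_smul_eq_bot_of_length (h : Module.length A X ≠ ⊤) :
    ∃ k, maximalIdeal A ^ k • (⊤ : Submodule A X) = ⊥ := by
  rw [Module.length_ne_top_iff, isFiniteLength_iff_isNoetherian_isArtinian] at h
  obtain ⟨_, _⟩ := h
  let f : ℕ →o (Submodule A X)ᵒᵈ := ⟨fun k => OrderDual.toDual
    (maximalIdeal A ^ k • (⊤ : Submodule A X)), fun i j hij =>
      Submodule.smul_mono (Ideal.pow_le_pow_right hij) le_rfl⟩
  obtain ⟨k, hk⟩ := IsArtinian.monotone_stabilizes f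
  refine ⟨k, Submodule.eq_bot_of_le_smul_of_le_jacobson_bot (maximalIdeal A) _
    (IsNoetherian.noetherian _) ?_ (IsLocalRing.maximalIdeal_le_jacobson _)⟩
  have h1 : maximalIdeal A ^ k • (⊤ : Submodule A X) = maximalIdeal A ^ (k + 1) • ⊤ :=
    hk (k + 1) k.le_succ
  rw [← mul_smul, ← pow_succ']
  exact h1.le

theorem length_ne_top_of_pow_smul [IsNoetherianRing A] [Module.Finite A X] {k : ℕ}
    (h : maximalIdeal A ^ k • (⊤ : Submodule A X) = ⊥) : Module.length A X ≠ ⊤ := by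
  obtain ⟨l, hl⟩ := exists_ofList_eq (maximalIdeal A)
  have h1 : hf (maximalIdeal A) X 1 ≠ ⊤ := by
    rw [hf_one]
    let _ : Field (A ⧸ maximalIdeal A) := Ideal.Quotient.field _
    have : IsArtinian (A ⧸ maximalIdeal A) (X ⧸ maximalIdeal A • (⊤ : Submodule A X)) :=
      have : Module.Finite (A ⧸ maximalIdeal A) (X ⧸ maximalIdeal A • (⊤ : Submodule A X)) :=
        Module.Finite.of_restrictScalars_finite A _ _
      inferInstance
    rw [Module.length_eq_of_surjective (R := A ⧸ maximalIdeal A) Ideal.Quotient.mk_surjective]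
    exact Module.length_ne_top_iff.2
      (isFiniteLength_iff_isNoetherian_isArtinian.2
        ⟨isNoetherian_of_tower A inferInstance, inferInstance⟩)
  have h2 := hf_ne_top l (X := X) (by rwa [hl]) k
  rw [hl, hf, h] at h2
  rwa [(Submodule.quotEquivOfEqBot _ rfl).length_eq] at h2

/-- Powers of the maximal ideal are contained in `Q` modulo the annihilator when `X / Q X` has
finite length. -/
theorem exists_pow_le_sup_annihilator [IsNoetherianRing A] [Module.Finite A X] {Q : Ideal A}
    (h : hf Q X 1 ≠ ⊤) : ∃ k, maximalIdeal A ^ k ≤ Q ⊔ Module.annihilator A X := by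
  rw [hf_one] at h
  obtain ⟨k, hk⟩ := exists_pow_smul_eq_bot_of_length h
  have h1 : maximalIdeal A ^ k ≤ Module.annihilator A (X ⧸ Q • (⊤ : Submodule A X)) := by
    intro a ha
    rw [Module.mem_annihilator]
    intro u
    exact (Submodule.mem_bot A).1 (hk ▸ Submodule.smul_mem_smul ha trivial)
  have h2 : Module.annihilator A (X ⧸ Q • (⊤ : Submodule A X)) ≤
      (Q ⊔ Module.annihilator A X).radical := by
    have h3 := Module.support_quotient (M := X) Q
    rw [Module.support_eq_zeroLocus, Module.support_eq_zeroLocus, Set.inter_comm,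
      ← PrimeSpectrum.zeroLocus_sup] at h3
    rw [← PrimeSpectrum.vanishingIdeal_zeroLocus_eq_radical, ← h3]
    exact PrimeSpectrum.subset_vanishingIdeal_zeroLocus _
  have h3 : maximalIdeal A ≤ (Q ⊔ Module.annihilator A X).radical := fun a ha => by
    obtain ⟨j, hj⟩ := h2 (h1 (Ideal.pow_mem_pow ha k))
    exact ⟨k * j, by rwa [pow_mul]⟩
  exact Ideal.exists_pow_le_of_le_radical_of_fg h3 (IsNoetherian.noetherian _)

theorem gam_eq_top_of_pow_smul {k : ℕ} (h : maximalIdeal A ^ k • (⊤ : Submodule A X) = ⊥) :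
    gam (A := A) X = ⊤ := by
  rw [eq_top_iff]
  exact fun u _ => ⟨k, fun a ha => (Submodule.mem_bot A).1 (h ▸ Submodule.smul_mem_smul ha trivial)⟩

theorem exists_pow_smul_gam [IsNoetherianRing A] [Module.Finite A X] :
    ∃ k, ∀ a ∈ maximalIdeal A ^ k, ∀ u ∈ gam (A := A) X, a • u = 0 := by
  obtain ⟨s, hs⟩ : (gam (A := A) X).FG := IsNoetherian.noetherian _
  have h1 : ∀ u ∈ s, ∃ k, ∀ a ∈ maximalIdeal A ^ k, a • u = 0 := fun u hu =>
    (hs ▸ Submodule.subset_span hu : u ∈ gam (A := A) X)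
  choose! e he using h1
  refine ⟨s.sup e, fun a ha u hu => ?_⟩
  rw [← hs] at hu
  induction hu using Submodule.span_induction with
  | mem u hu => exact he u hu a (Ideal.pow_le_pow_right (Finset.le_sup hu) ha)
  | zero => exact smul_zero _
  | add u v _ _ hu hv => rw [smul_add, hu, hv, add_zero]
  | smul b u _ hu => rw [smul_comm, hu, smul_zero]

theorem length_gam_ne_top [IsNoetherianRing A] [Module.Finite A X] :
    Module.length A (gam (A := A) X) ≠ ⊤ := by
  obtain ⟨k, hk⟩ := exists_pow_smul_gam (A := A) (X := X)
  refine length_ne_top_of_pow_smul (k := k) ?_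
  rw [eq_bot_iff, Submodule.smul_le]
  exact fun a ha u _ => Subtype.ext (hk a ha u u.2)

theorem gam_quotient_gam [IsNoetherianRing A] [Module.Finite A X] :
    gam (A := A) (X ⧸ gam (A := A) X) = ⊥ := by
  rw [eq_bot_iff]
  intro u hu
  obtain ⟨u, rfl⟩ := Submodule.mkQ_surjective _ u
  obtain ⟨n, hn⟩ := hu
  obtain ⟨k, hk⟩ := exists_pow_smul_gam (A := A) (X := X)
  refine (Submodule.Quotient.mk_eq_zero _).2 ⟨n + k, fun a ha => ?_⟩
  rw [pow_add, mul_comm] at ha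
  refine Submodule.mul_induction_on ha (fun b hb c hc => ?_) fun b c hb hc => ?_
  · rw [mul_smul]
    exact hk b hb _ ((Submodule.Quotient.mk_eq_zero _).1 (hn c hc))
  · rw [add_smul, hb, hc, add_zero]

/-- The intersection of a submodule of finite length with `Q ^ n X` eventually vanishes. -/
theorem exists_pow_smul_inf_eq_bot [IsNoetherianRing A] [Module.Finite A X] {Q : Ideal A}
    (hQ : Q ≤ maximalIdeal A) {V : Submodule A X} (hV : Module.length A V ≠ ⊤) :
    ∃ c, ∀ n ≥ c, Q ^ n • (⊤ : Submodule A X) ⊓ V = ⊥ := by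
  obtain ⟨k, hk⟩ := exists_pow_smul_eq_bot_of_length hV
  obtain ⟨c, hc⟩ := Ideal.exists_pow_inf_eq_pow_smul Q V
  refine ⟨c + k, fun n hn => ?_⟩
  rw [hc n (by omega), eq_bot_iff]
  have h1 : maximalIdeal A ^ k • V = ⊥ := by
    have := congrArg (Submodule.map V.subtype) hk
    rwa [Submodule.map_smul'', Submodule.map_top, Submodule.range_subtype, Submodule.map_bot] at this
  rw [← h1]
  refine Submodule.smul_mono ?_ inf_le_right
  exact (Ideal.pow_le_pow_right (by omega : k ≤ n - c)).trans (Ideal.pow_right_mono hQ k)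

theorem mem_gam_of_smul_eq_zero [IsNoetherianRing A] [Module.Finite A X] {Q : Ideal A}
    (h : hf Q X 1 ≠ ⊤) {u : X} (hu : ∀ x ∈ Q, x • u = 0) : u ∈ gam (A := A) X := by
  obtain ⟨k, hk⟩ := exists_pow_le_sup_annihilator h
  refine ⟨k, fun a ha => ?_⟩
  obtain ⟨b, hb, c, hc, rfl⟩ := Submodule.mem_sup.1 (hk ha)
  rw [add_smul, hu b hb, Module.mem_annihilator.1 hc u, add_zero]

end FiniteLength

section Colon

variable {A : Type} [CommRing A] [IsNoetherianRing A] {X : Type} [AddCommGroup X] [Module A X]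
  [Module.Finite A X]

theorem mem_smul_top_pi {r : ℕ} (I : Ideal A) (f : Fin r → X) :
    f ∈ I • (⊤ : Submodule A (Fin r → X)) ↔ ∀ i, f i ∈ I • (⊤ : Submodule A X) := by
  constructor
  · intro h i
    have := Submodule.mem_map_of_mem (f := LinearMap.proj (R := A) (φ := fun _ => X) i) h
    rw [Submodule.map_smul''] at this
    exact Submodule.smul_mono le_rfl le_top this
  · intro h
    rw [← Finset.univ_sum_single f]
    refine sum_mem fun i _ => ?_
    have := Submodule.mem_map_of_mem (f := LinearMap.single A (fun _ => X) i) (h i)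
    rw [Submodule.map_smul''] at this
    exact Submodule.smul_mono le_rfl le_top this

theorem exists_colon_eq {Q : Ideal A} (h : ∀ u : X, (∀ x ∈ Q, x • u = 0) → u = 0) :
    ∃ c, ∀ n ≥ c, ∀ u : X, (∀ x ∈ Q, x • u ∈ Q ^ (n + 1) • (⊤ : Submodule A X)) →
      u ∈ Q ^ n • (⊤ : Submodule A X) := by
  obtain ⟨s, hs⟩ := (isNoetherianRing_iff_ideal_fg A).1 inferInstance Q
  obtain ⟨r, g, hg⟩ : ∃ (r : ℕ) (g : Fin r → A), Ideal.span (Set.range g) = Q := by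
    refine ⟨s.card, fun i => (s.equivFin.symm i : A), ?_⟩
    rw [← hs]
    congr 1
    ext a
    simp only [Set.mem_range, SetLike.mem_coe]
    exact ⟨fun ⟨i, hi⟩ => hi ▸ (s.equivFin.symm i).2, fun ha => ⟨s.equivFin ⟨a, ha⟩, by simp⟩⟩
  have hext : ∀ (n : ℕ) (u : X), (∀ i, g i • u ∈ Q ^ n • (⊤ : Submodule A X)) →
      ∀ x ∈ Q, x • u ∈ Q ^ n • (⊤ : Submodule A X) := by
    intro n u hu x hx
    rw [← hg] at hx
    induction hx using Submodule.span_induction with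
    | mem x hx => obtain ⟨i, rfl⟩ := hx; exact hu i
    | zero => rw [zero_smul]; exact zero_mem _
    | add a b _ _ ha hb => rw [add_smul]; exact add_mem ha hb
    | smul a b _ hb => rw [smul_assoc]; exact Submodule.smul_mem _ _ hb
  let φ : X →ₗ[A] (Fin r → X) := LinearMap.pi fun i => LinearMap.lsmul A X (g i)
  have hφ : Function.Injective φ := by
    rw [← LinearMap.ker_eq_bot, eq_bot_iff]
    intro u hu
    refine h u fun x hx => ?_
    rw [← hg] at hx
    induction hx using Submodule.span_induction with
    | mem x hx => obtain ⟨i, rfl⟩ := hx; exact congrFun hu i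
    | zero => rw [zero_smul]
    | add a b _ _ ha hb => rw [add_smul, ha, hb, add_zero]
    | smul a b _ hb => rw [smul_assoc, hb, smul_zero]
  obtain ⟨c, hc⟩ := Ideal.exists_pow_inf_eq_pow_smul Q (LinearMap.range φ)
  refine ⟨c, fun n hn u hu => ?_⟩
  have h1 : φ u ∈ Q ^ (n + 1) • (⊤ : Submodule A (Fin r → X)) ⊓ LinearMap.range φ :=
    ⟨(mem_smul_top_pi _ _).2 fun i => hu _ (hg ▸ Ideal.subset_span ⟨i, rfl⟩), ⟨u, rfl⟩⟩
  rw [hc (n + 1) (by omega)] at h1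
  set W : Submodule A X := (Q ^ c • (⊤ : Submodule A (Fin r → X))).comap φ
  have h2 : Q ^ c • (⊤ : Submodule A (Fin r → X)) ⊓ LinearMap.range φ = W.map φ := by
    rw [Submodule.map_comap_eq, inf_comm]
  rw [h2, ← Submodule.map_smul'', Submodule.mem_map] at h1
  obtain ⟨v, hv, hvu⟩ := h1
  obtain rfl := hφ hvu
  have h3 : Q • W ≤ Q ^ c • (⊤ : Submodule A X) := by
    rw [Submodule.smul_le]
    intro x hx w hw
    exact hext c w (fun i => (mem_smul_top_pi _ _).1 hw i) x hx
  rw [show n + 1 - c = (n - c) + 1 by omega, pow_succ, mul_smul] at hv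
  have h4 := Submodule.smul_mono (le_refl (Q ^ (n - c))) h3 hv
  rwa [← mul_smul, ← pow_add, Nat.sub_add_cancel hn] at h4

theorem mem_pow_smul_of_pow_smul_mem {Q : Ideal A} {c : ℕ}
    (hc : ∀ n ≥ c, ∀ u : X, (∀ x ∈ Q, x • u ∈ Q ^ (n + 1) • (⊤ : Submodule A X)) →
      u ∈ Q ^ n • (⊤ : Submodule A X)) (j : ℕ) {n : ℕ} (hn : c ≤ n) {u : X}
    (hu : ∀ a ∈ Q ^ j, a • u ∈ Q ^ (n + j) • (⊤ : Submodule A X)) :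
    u ∈ Q ^ n • (⊤ : Submodule A X) := by
  induction j with
  | zero => simpa using hu 1 (by simp)
  | succ j ih =>
    refine ih fun a ha => hc (n + j) (by omega) _ fun x hx => ?_
    rw [smul_smul]
    exact hu _ (by rw [pow_succ']; exact Ideal.mul_mem_mul hx ha)

end Colon

end LocalCoh

namespace LocalCoh

open TensorProduct Filter

section HilbertCoefficients

variable {A : Type} [CommRing A] {X Y : Type} [AddCommGroup X] [Module A X]
  [AddCommGroup Y] [Module A Y]

/-- The Hilbert function of `X` with respect to `Q` is eventually given by the numbers `s`. -/
def HC (Q : Ideal A) (X : Type) [AddCommGroup X] [Module A X] (r : ℕ) (s : ℕ → ℤ) : Prop :=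
  ∀ᶠ n in atTop, ∃ l : ℕ, hf Q X (n + 1) = l ∧ (l : ℤ) = bsum r s n

theorem HC.congr {B Z : Type} [CommRing B] [AddCommGroup Z] [Module B Z] {Q : Ideal A} {Q' : Ideal B} {r : ℕ}
    {s : ℕ → ℤ} (hs : HC Q X r s) (h : ∀ᶠ n in atTop, hf Q X n = hf Q' Z n) : HC Q' Z r s := by
  filter_upwards [hs, (tendsto_add_atTop_nat 1).eventually h] with n ⟨l, h1, h2⟩ h3
  exact ⟨l, h3 ▸ h1, h2⟩

theorem HC.le {B Z : Type} [CommRing B] [AddCommGroup Z] [Module B Z] {Q : Ideal A} {Q' : Ideal B} {r : ℕ}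
    {s t : ℕ → ℤ} (hs : HC Q X r s) (ht : HC Q' Z r t)
    (h : ∀ᶠ n in atTop, hf Q X (n + 1) ≤ hf Q' Z (n + 1)) :
    ∀ᶠ n in atTop, bsum r s n ≤ bsum r t n := by
  filter_upwards [hs, ht, h] with n ⟨l, h1, h2⟩ ⟨l', h1', h2'⟩ h3
  rw [h1, h1'] at h3
  rw [← h2, ← h2']
  exact_mod_cast h3

theorem HC.bsum_eq {Q : Ideal A} {r : ℕ} {s t : ℕ → ℤ} (hs : HC Q X r s) (ht : HC Q X r t) :
    ∀ᶠ n in atTop, bsum r s n = bsum r t n := by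
  filter_upwards [hs.le ht (.of_forall fun _ => le_rfl), ht.le hs (.of_forall fun _ => le_rfl)]
    with n h1 h2 using le_antisymm h1 h2

theorem HC.one_eq {Q : Ideal A} {r : ℕ} {s t : ℕ → ℤ} (hr : 1 ≤ r) (hs : HC Q X r s)
    (ht : HC Q X r t) : s 1 = t 1 := by
  obtain ⟨r, rfl⟩ := Nat.exists_eq_add_of_le' hr
  exact one_eq_of_bsum_eq (hs.bsum_eq ht)

theorem bsum_update (r : ℕ) (s : ℕ → ℤ) (c : ℤ) (n : ℕ) :
    bsum r (Function.update s r (s r + (-1) ^ r * c)) n = bsum r s n + c := by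
  rw [bsum, Finset.sum_range_succ, bsum, Finset.sum_range_succ, Function.update_self]
  have : ((-1 : ℤ) ^ r) * (-1) ^ r = 1 := by rw [← mul_pow]; simp
  rw [Finset.sum_congr rfl fun i hi => by
    rw [Function.update_of_ne (Finset.mem_range.1 hi).ne]]
  simp only [Nat.sub_self, Nat.choose_zero_right, Nat.cast_one, mul_one]
  linear_combination c * this

theorem HC.of_add {Q : Ideal A} {Q' : Ideal A} {r : ℕ} {s : ℕ → ℤ} (hs : HC Q X r s) {c : ℕ}
    (h : ∀ᶠ n in atTop, hf Q' Y n = hf Q X n + c) :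
    HC Q' Y r (Function.update s r (s r + (-1) ^ r * c)) := by
  filter_upwards [hs, (tendsto_add_atTop_nat 1).eventually h] with n ⟨l, h1, h2⟩ h3
  refine ⟨l + c, by rw [h3, h1]; push_cast; rfl, ?_⟩
  rw [bsum_update, ← h2]
  push_cast; rfl

theorem HC.of_diff {Q : Ideal A} {r : ℕ} {s : ℕ → ℤ} {B Z : Type} [CommRing B] [AddCommGroup Z] [Module B Z]
    {Q' : Ideal B} (hs : HC Q' Z r s) (hX : ∀ n, hf Q X n ≠ ⊤)
    (h : ∀ᶠ n in atTop, hf Q X (n + 1) = hf Q X n + hf Q' Z (n + 1)) :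
    ∃ t : ℕ → ℤ, (∀ i ≤ r, t i = s i) ∧ HC Q X (r + 1) t := by
  have h1 : ∀ᶠ n in atTop, ((hf Q X (n + 1 + 1)).toNat : ℤ) - ((hf Q X (n + 1)).toNat : ℤ) =
      bsum r s (n + 1) := by
    filter_upwards [(tendsto_add_atTop_nat 1).eventually hs,
      (tendsto_add_atTop_nat 1).eventually h] with n ⟨l, h1, h2⟩ h3
    obtain ⟨a, ha⟩ := ENat.ne_top_iff_exists.1 (hX (n + 1))
    rw [h3, h1, ← ha, ← h2]
    rw [← Nat.cast_add, ENat.toNat_natCast, ENat.toNat_natCast]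
    push_cast; ring
  obtain ⟨t, ht, ht'⟩ := exists_bsum_of_diff (f := fun n => ((hf Q X (n + 1)).toNat : ℤ)) h1
  refine ⟨t, ht, ht'.mono fun n hn => ⟨_, (ENat.natCast_toNat (hX (n + 1))).symm, hn⟩⟩

theorem hf_sup_of_smul_eq_zero {y : A} (hy : ∀ u : X, y • u = 0) (q : Ideal A) (n : ℕ) :
    hf (Ideal.span {y} ⊔ q) X n = hf q X n := by
  cases n with
  | zero => rw [hf_zero, hf_zero]
  | succ n =>
    rw [hf, hf, sup_pow_succ, Submodule.sup_smul, mul_smul, span_singleton_smul_eq_map,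
      show LinearMap.lsmul A X y = 0 from LinearMap.ext hy, Submodule.map_zero, bot_sup_eq]

theorem smul_quotient_range_eq_zero (x : A) (u : X ⧸ LinearMap.range (LinearMap.lsmul A X x)) :
    x • u = 0 := by
  obtain ⟨u, rfl⟩ := Submodule.Quotient.mk_surjective _ u
  rw [← Submodule.Quotient.mk_smul, Submodule.Quotient.mk_eq_zero]
  exact ⟨u, rfl⟩

theorem hf_ofList_cons_quotient (x : A) (l : List A) (n : ℕ) :
    hf (Ideal.ofList (x :: l)) (X ⧸ LinearMap.range (LinearMap.lsmul A X x)) n =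
      hf (Ideal.ofList l) (X ⧸ LinearMap.range (LinearMap.lsmul A X x)) n := by
  rw [Ideal.ofList_cons]
  exact hf_sup_of_smul_eq_zero (smul_quotient_range_eq_zero x) _ n

theorem span_add_sup {x a : A} {q : Ideal A} (ha : a ∈ q) :
    Ideal.span {x + a} ⊔ q = Ideal.span {x} ⊔ q := by
  apply le_antisymm <;> refine sup_le ?_ le_sup_right <;>
    rw [Ideal.span_singleton_le_iff_mem]
  · exact add_mem (Ideal.mem_sup_left (Ideal.mem_span_singleton_self x)) (Ideal.mem_sup_right ha)
  · have := Ideal.sub_mem _ (Ideal.mem_sup_left (Ideal.mem_span_singleton_self (x + a)))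
      (Ideal.mem_sup_right ha : a ∈ Ideal.span {x + a} ⊔ q)
    simpa using this

theorem hf_eq_add_gam [IsLocalRing A] [IsNoetherianRing A] [Module.Finite A X] {Q : Ideal A}
    (hQ : Q ≤ maximalIdeal A) : ∀ᶠ n in atTop, hf Q X n =
      hf Q (X ⧸ gam (A := A) X) n + (Module.length A (gam (A := A) X)).toNat := by
  obtain ⟨c, hc⟩ := exists_pow_smul_inf_eq_bot hQ (length_gam_ne_top (A := A) (X := X))
  filter_upwards [eventually_ge_atTop c] with n hn
  rw [hf_eq_add (gam (A := A) X), add_comm, ENat.natCast_toNat length_gam_ne_top]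
  congr 1
  rw [← ix_inf, hc n hn, ix_bot]

theorem HC.of_gam [IsLocalRing A] [IsNoetherianRing A] [Module.Finite A X] {Q : Ideal A}
    (hQ : Q ≤ maximalIdeal A) {r : ℕ} {s : ℕ → ℤ} (hs : HC Q (X ⧸ gam (A := A) X) r s) :
    HC Q X r (Function.update s r
      (s r + (-1) ^ r * ((Module.length A (gam (A := A) X)).toNat : ℕ))) :=
  hs.of_add (hf_eq_add_gam hQ)

theorem hf_singleton_of_injective {x : A} (hx : ∀ u : X, x • u = 0 → u = 0) (n : ℕ) :
    hf (Ideal.span {x}) X n = n * hf (Ideal.span {x}) X 1 := by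
  induction n with
  | zero => simp [hf_zero]
  | succ n ih =>
    have h1 := hf_add_dfun (X := X) (Ideal.mem_span_singleton_self x) n
    have h2 : dfun x (Ideal.span {x}) X n = 0 := by
      refine ix_self _ fun u hu => ?_
      rw [Submodule.mem_comap, LinearMap.lsmul_apply, Ideal.span_singleton_pow,
        Submodule.ideal_span_singleton_smul, Submodule.mem_smul_pointwise_iff_exists] at hu
      obtain ⟨v, -, hv⟩ := hu
      have := hx (u - x ^ n • v) (by rw [smul_sub, smul_smul, ← pow_succ', hv, sub_self])
      rw [sub_eq_zero.1 this]
      exact Submodule.smul_mem_smul (Ideal.pow_mem_pow (Ideal.mem_span_singleton_self x) n) trivial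
    have h3 (n) := hf_sup_of_smul_eq_zero (smul_quotient_range_eq_zero (X := X) x) ⊥ (n + 1)
    have h4 : hf (Ideal.span {x}) (X ⧸ LinearMap.range (LinearMap.lsmul A X x)) (n + 1) =
        hf (Ideal.span {x}) X 1 := by
      rw [sup_bot_eq] at h3
      rw [h3, hf, pow_succ, Ideal.mul_bot, Submodule.bot_smul, hf_one,
        (Submodule.quotEquivOfEqBot _ rfl).length_eq, span_singleton_smul_eq_map,
        Submodule.map_top]
    rw [h2, add_zero, h4, ih] at h1
    rw [h1]
    push_cast; ring

end HilbertCoefficients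

end LocalCoh

namespace LocalCoh

open TensorProduct Filter

section ExistsHilbertCoefficients

theorem mulL_eq_zero {A N : Type} [CommRing A] [AddCommGroup N] [Module A N] (l : List A)
    {D : ℕ} {f : ℕ → N} (hf : ∀ j ≥ D, f j = 0) {k : ℕ} (hk : D + l.length ≤ k) :
    mulL l f k = 0 := by
  induction l generalizing k with
  | nil => rfl
  | cons x l ih =>
    rw [List.length_cons] at hk
    obtain ⟨k, rfl⟩ := Nat.exists_eq_add_of_le' (show 1 ≤ k by omega)
    rw [mulL, hf _ (by omega), smul_zero, zero_add, ih (by omega)]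

theorem lTensor_mkQ_eq_zero' {A B X : Type} [CommRing A] [CommRing B] [Algebra A B]
    [AddCommGroup X] [Module A X] (I : Ideal A) {z : B ⊗[A] X}
    (hz : z ∈ I.map (algebraMap A B) • (⊤ : Submodule B (B ⊗[A] X))) :
    LinearMap.lTensor B (I • (⊤ : Submodule A X)).mkQ z = 0 := lTensor_mkQ_eq_zero I hz

theorem HC.of_dfun {A : Type} [CommRing A] {X : Type} [AddCommGroup X] [Module A X] {x : A}
    {l : List A} {r : ℕ} {s : ℕ → ℤ}
    (hs : HC (Ideal.ofList l) (X ⧸ LinearMap.range (LinearMap.lsmul A X x)) r s)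
    (hX : hf (Ideal.ofList (x :: l)) X 1 ≠ ⊤)
    (h : ∀ᶠ n in atTop, dfun x (Ideal.ofList (x :: l)) X n = 0) :
    ∃ t : ℕ → ℤ, (∀ i ≤ r, t i = s i) ∧ HC (Ideal.ofList (x :: l)) X (r + 1) t := by
  refine HC.of_diff hs (hf_ne_top _ hX) ?_
  filter_upwards [h] with n hn
  rw [← hf_ofList_cons_quotient, ← hf_add_dfun (Q := Ideal.ofList (x :: l))
    (Ideal.subset_span List.mem_cons_self), hn, add_zero]

theorem hf_quotient_range_ne_top {A : Type} [CommRing A] {X : Type} [AddCommGroup X] [Module A X]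
    {x : A} {l : List A} (hX : hf (Ideal.ofList (x :: l)) X 1 ≠ ⊤) :
    hf (Ideal.ofList l) (X ⧸ LinearMap.range (LinearMap.lsmul A X x)) 1 ≠ ⊤ := by
  rw [← hf_ofList_cons_quotient]
  exact ne_top_of_le_ne_top hX (hf_le_of_surjective (Submodule.mkQ_surjective _) _ _)

theorem exists_HC_of_dfun {A : Type} [CommRing A] {x : A} {l : List A} {r : ℕ} (hr : 1 ≤ r)
    (ih : ∀ (X : Type) [AddCommGroup X] [Module A X] [Module.Finite A X],
      hf (Ideal.ofList l) X 1 ≠ ⊤ → ∃ s, HC (Ideal.ofList l) X r s ∧ (1 ≤ r → s 1 ≤ 0))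
    (X : Type) [AddCommGroup X] [Module A X] [Module.Finite A X]
    (hX : hf (Ideal.ofList (x :: l)) X 1 ≠ ⊤)
    (h : ∀ᶠ n in atTop, dfun x (Ideal.ofList (x :: l)) X n = 0) :
    ∃ s, HC (Ideal.ofList (x :: l)) X (r + 1) s ∧ s 1 ≤ 0 := by
  obtain ⟨s, hs, hs1⟩ := ih _ (hf_quotient_range_ne_top hX)
  obtain ⟨t, ht, ht'⟩ := hs.of_dfun hX h
  exact ⟨t, ht', ht 1 hr ▸ hs1 hr⟩

variable {A : Type} [CommRing A] [IsLocalRing A]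

theorem algebraMap_polL_mem (l : List A) : algebraMap (Polynomial A) (GaussExt A) (polL l) ∈
    Ideal.ofList (l.map (algebraMap A (GaussExt A))) := by
  induction l with
  | nil => simp [polL]
  | cons x l ih =>
    rw [polL, List.map_cons, Ideal.ofList_cons, map_add, map_mul, algebraMap_C_gaussExt]
    exact add_mem (Ideal.mem_sup_left (Ideal.mem_span_singleton_self _))
      (Ideal.mem_sup_right (Ideal.mul_mem_left _ _ ih))

theorem ofList_polL_cons (x : A) (l : List A) :
    Ideal.ofList (algebraMap (Polynomial A) (GaussExt A) (polL (x :: l)) ::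
      l.map (algebraMap A (GaussExt A))) =
      (Ideal.ofList (x :: l)).map (algebraMap A (GaussExt A)) := by
  rw [Ideal.ofList_cons, polL, map_add, map_mul, algebraMap_C_gaussExt,
    span_add_sup (Ideal.mul_mem_left _ _ (algebraMap_polL_mem l)), Ideal.map_ofList,
    List.map_cons, Ideal.ofList_cons]

variable {X : Type} [AddCommGroup X] [Module A X]

theorem hf_gaussExt (Q : Ideal A) (n : ℕ) :
    hf (Q.map (algebraMap A (GaussExt A))) (GaussExt A ⊗[A] X) n = hf Q X n := by
  rw [hf, hf, ← Ideal.map_pow]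
  exact length_baseChange_quotient (map_maximalIdeal_gaussExt A) (Q ^ n)

theorem exists_dfun_gaussExt_eq_zero [IsNoetherianRing A] [Module.Finite A X] (l : List A)
    (h : ∀ u : X, (∀ x ∈ Ideal.ofList l, x • u = 0) → u = 0) :
    ∃ c, ∀ n ≥ c, dfun (algebraMap (Polynomial A) (GaussExt A) (polL l))
      ((Ideal.ofList l).map (algebraMap A (GaussExt A))) (GaussExt A ⊗[A] X) n = 0 := by
  obtain ⟨c, hc⟩ := exists_colon_eq h
  refine ⟨c, fun n hn => ix_self _ fun z hz => ?_⟩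
  rw [Submodule.mem_comap, LinearMap.lsmul_apply, ← Ideal.map_pow] at hz
  rw [← Ideal.map_pow]
  obtain ⟨u, hu, D, f, hfD, huz⟩ := exists_smul_eq_evT z
  have h1 := Submodule.smul_mem _ u hz
  rw [smul_comm, huz, polL_smul_evT l D f hfD] at h1
  have h2 := lTensor_mkQ_eq_zero' _ h1
  rw [lTensor_evT] at h2
  have h3 := eq_zero_of_evT_eq_zero _ _ h2
  have h4 : ∀ k, mulL l f k ∈ Ideal.ofList l ^ (n + 1) • (⊤ : Submodule A X) := by
    intro k
    by_cases hk : k < D + l.length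
    · exact (Submodule.Quotient.mk_eq_zero _).1 (h3 k hk)
    · rw [mulL_eq_zero l hfD (not_lt.1 hk)]
      exact zero_mem _
  obtain ⟨J, hJ⟩ := exists_pow_smul_content_le (N := X) l D
  have h5 : ∀ j, f j ∈ Ideal.ofList l ^ n • (⊤ : Submodule A X) := by
    intro j
    refine mem_pow_smul_of_pow_smul_mem hc (J + 1) hn fun a ha => ?_
    have := hJ f (fun j hj => hfD j hj.le) _ h4 j a ha
    rwa [← mul_smul, ← pow_add, show J + (n + 1) = n + (J + 1) by ring] at this
  have h6 : u • z ∈ (Ideal.ofList l ^ n).map (algebraMap A (GaussExt A)) •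
      (⊤ : Submodule (GaussExt A) (GaussExt A ⊗[A] X)) := by
    rw [huz]
    exact sum_mem fun j _ => one_tmul_mem _ (h5 j) _
  obtain ⟨u, rfl⟩ := hu
  have := Submodule.smul_mem _ (↑u⁻¹ : GaussExt A) h6
  rwa [smul_smul, Units.inv_mul, one_smul] at this

theorem ofList_map_le_maximalIdeal {l : List A} (h : Ideal.ofList l ≤ maximalIdeal A) :
    Ideal.ofList (l.map (algebraMap A (GaussExt A))) ≤ maximalIdeal (GaussExt A) := by
  rw [← Ideal.map_ofList, ← map_maximalIdeal_gaussExt A]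
  exact Ideal.map_mono h

/-- Existence of Hilbert coefficients for parameter ideals, and nonpositivity of the first one. -/
theorem exists_HC (r : ℕ) : ∀ (A : Type) [CommRing A] [IsLocalRing A] [IsNoetherianRing A]
    (l : List A), l.length = r → Ideal.ofList l ≤ maximalIdeal A →
    ∀ (X : Type) [AddCommGroup X] [Module A X] [Module.Finite A X], hf (Ideal.ofList l) X 1 ≠ ⊤ →
    ∃ s, HC (Ideal.ofList l) X r s ∧ (1 ≤ r → s 1 ≤ 0) := by
  induction r with
  | zero =>
    intro A _ _ _ l hl _ X _ _ _ hX
    rw [List.length_eq_zero_iff] at hl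
    subst hl
    obtain ⟨a, ha⟩ := ENat.ne_top_iff_exists.1 hX
    refine ⟨fun _ => a, .of_forall fun n => ⟨a, ?_, by simp [bsum_zero]⟩, by simp⟩
    rw [ha, hf, hf, Ideal.ofList_nil, pow_succ, Ideal.mul_bot, pow_one]
  | succ r ih =>
    intro A _ _ _ l hl hlm X _ _ _ hX
    suffices H : ∀ (X : Type) [AddCommGroup X] [Module A X] [Module.Finite A X],
        hf (Ideal.ofList l) X 1 ≠ ⊤ → gam (A := A) X = ⊥ →
        ∃ s, HC (Ideal.ofList l) X (r + 1) s ∧ s 1 ≤ 0 by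
      have hX' := ne_top_of_le_ne_top hX
        (hf_le_of_surjective (Submodule.mkQ_surjective (gam (A := A) X)) (Ideal.ofList l) 1)
      obtain ⟨s, hs, hs1⟩ := H _ hX' gam_quotient_gam
      refine ⟨_, hs.of_gam hlm, fun _ => ?_⟩
      rcases Nat.eq_zero_or_pos r with rfl | hr
      · simp
        omega
      · rwa [Function.update_of_ne (by omega)]
    intro X _ _ _ hX hgam
    obtain ⟨x, l, rfl⟩ : ∃ x l', l = x :: l' := by
      cases l with
      | nil => simp at hl
      | cons x l => exact ⟨x, l, rfl⟩
    rw [List.length_cons, add_left_inj] at hl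
    have hreg : ∀ u : X, (∀ y ∈ Ideal.ofList (x :: l), y • u = 0) → u = 0 := fun u hu => by
      have := mem_gam_of_smul_eq_zero hX hu
      rwa [hgam] at this
    rcases Nat.eq_zero_or_pos r with rfl | hr
    · rw [List.length_eq_zero_iff] at hl
      subst hl
      obtain ⟨a, ha⟩ := ENat.ne_top_iff_exists.1 hX
      rw [Ideal.ofList_singleton] at ha hreg ⊢
      refine ⟨Pi.single 0 a, .of_forall fun n => ⟨(n + 1) * a, ?_, ?_⟩, by simp⟩
      · rw [hf_singleton_of_injective (fun u hu => hreg u fun y hy => ?_), ← ha]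
        · push_cast; rfl
        · obtain ⟨b, rfl⟩ := Ideal.mem_span_singleton'.1 hy
          rw [mul_smul, hu, smul_zero]
      · simp [bsum, Finset.sum_range_succ]
        ring
    · obtain ⟨c, hc⟩ := exists_dfun_gaussExt_eq_zero (X := X) (x :: l) hreg
      obtain ⟨t, ht, ht1⟩ := exists_HC_of_dfun (l := l.map (algebraMap A (GaussExt A))) hr
        (fun Z _ _ _ hZ => ih (GaussExt A) _ (by simpa using hl) (ofList_map_le_maximalIdeal
          (le_trans (by rw [Ideal.ofList_cons]; exact le_sup_right) hlm)) Z hZ)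
        (GaussExt A ⊗[A] X) (x := algebraMap (Polynomial A) (GaussExt A) (polL (x :: l)))
        (by rwa [ofList_polL_cons, hf_gaussExt])
        (by
          filter_upwards [eventually_ge_atTop c] with n hn
          rw [ofList_polL_cons, hc n hn])
      rw [ofList_polL_cons] at ht
      exact ⟨t, ht.congr (.of_forall fun n => hf_gaussExt _ _), ht1⟩

end ExistsHilbertCoefficients

end LocalCoh

namespace LocalCoh

open Filter

section Comparison

theorem bsum_single {r k : ℕ} (hk : k ≤ r) (C : ℤ) (n : ℕ) :
    bsum r (Pi.single (r - k) ((-1) ^ (r - k) * C)) n = C * ((n + k).choose k : ℤ) := by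
  rw [bsum, Finset.sum_eq_single (r - k)]
  · rw [Pi.single_eq_same, ← mul_assoc, ← mul_pow, show n + r - (r - k) = n + k by omega,
      show r - (r - k) = k by omega]
    simp
  · intro i _ hi
    rw [Pi.single_eq_of_ne hi]
    simp
  · intro h
    simp at h

theorem zero_le_of_bsum_le_add {r k : ℕ} (hk : k + 1 ≤ r) {s t : ℕ → ℤ} {C : ℤ}
    (h : ∀ᶠ n in atTop, bsum r s n ≤ bsum r t n + C * ((n + k).choose k : ℤ)) : s 0 ≤ t 0 := by
  simp_rw [← bsum_single (by omega : k ≤ r), ← bsum_add] at h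
  have := le_of_bsum_le h
  rwa [Pi.single_eq_of_ne (by omega), add_zero] at this

theorem one_le_of_bsum_le_add {r k : ℕ} (hk : k + 2 ≤ r) {s t : ℕ → ℤ} {C : ℤ}
    (h : ∀ᶠ n in atTop, bsum r s n ≤ bsum r t n + C * ((n + k).choose k : ℤ))
    (h0 : s 0 = t 0) : t 1 ≤ s 1 := by
  obtain ⟨r, rfl⟩ := Nat.exists_eq_add_of_le' (show 1 ≤ r by omega)
  simp_rw [← bsum_single (by omega : k ≤ r + 1), ← bsum_add] at h
  have := one_le_of_bsum_le h (by rw [Pi.single_eq_of_ne (by omega), add_zero, h0])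
  rwa [Pi.single_eq_of_ne (by omega), add_zero] at this

variable {A : Type} [CommRing A] {X Y Z : Type} [AddCommGroup X] [Module A X]
  [AddCommGroup Y] [Module A Y] [AddCommGroup Z] [Module A Z]

theorem HC.le_add {Q Q' : Ideal A} {r k C : ℕ} {s t : ℕ → ℤ}
    (hs : HC Q X r s) (ht : HC Q' Z r t)
    (h : ∀ᶠ n in atTop, hf Q X (n + 1) ≤ hf Q' Z (n + 1) + (C * (n + k).choose k : ℕ)) :
    ∀ᶠ n in atTop, bsum r s n ≤ bsum r t n + (C : ℤ) * ((n + k).choose k : ℤ) := by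
  filter_upwards [hs, ht, h] with n ⟨l, h1, h2⟩ ⟨l', h1', h2'⟩ h3
  rw [h1, h1'] at h3
  rw [← h2, ← h2']
  exact_mod_cast h3

/-- `X` has growth at most `k` with respect to `Q`. -/
theorem hf_le_of_length {Q : Ideal A} {l : List A} (hl : Ideal.ofList l ≤ Q)
    (h : hf (Ideal.ofList l) X 1 ≠ ⊤) (n : ℕ) : hf Q X (n + 1) ≤
      ((hf (Ideal.ofList l) X 1).toNat * (n + l.length).choose l.length : ℕ) := by
  refine (hf_anti hl _).trans ((hf_le l n).trans ?_)
  rw [Nat.cast_mul, ENat.natCast_toNat h, mul_comm]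

theorem hf_quotient_le (V : Submodule A X) (Q : Ideal A) (n : ℕ) : hf Q (X ⧸ V) n ≤ hf Q X n :=
  hf_le_of_surjective (Submodule.mkQ_surjective _) _ _

theorem hf_le_quotient_add (V : Submodule A X) {Q : Ideal A} {l : List A} (hl : Ideal.ofList l ≤ Q)
    (h : hf (Ideal.ofList l) V 1 ≠ ⊤) (n : ℕ) : hf Q X (n + 1) ≤ hf Q (X ⧸ V) (n + 1) +
      ((hf (Ideal.ofList l) V 1).toNat * (n + l.length).choose l.length : ℕ) := by
  rw [hf_eq_add V, add_comm]
  gcongr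
  exact (ix_le_hf V Q _).trans (hf_le_of_length hl h n)

theorem HC.zero_eq_quotient (V : Submodule A X) {Q : Ideal A} {l : List A}
    (hl : Ideal.ofList l ≤ Q) (h : hf (Ideal.ofList l) V 1 ≠ ⊤) {r : ℕ} (hr : l.length + 1 ≤ r)
    {s t : ℕ → ℤ} (hs : HC Q X r s) (ht : HC Q (X ⧸ V) r t) : s 0 = t 0 :=
  le_antisymm (zero_le_of_bsum_le_add hr (hs.le_add ht (.of_forall (hf_le_quotient_add V hl h))))
    (le_of_bsum_le (ht.le hs (.of_forall fun _ => hf_quotient_le V Q _)))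

theorem HC.one_le_quotient (V : Submodule A X) {Q : Ideal A} {l : List A}
    (hl : Ideal.ofList l ≤ Q) (h : hf (Ideal.ofList l) V 1 ≠ ⊤) {r : ℕ} (hr : l.length + 1 ≤ r)
    {s t : ℕ → ℤ} (hs : HC Q X r s) (ht : HC Q (X ⧸ V) r t) : s 1 ≤ t 1 := by
  have h0 := hs.zero_eq_quotient V hl h hr ht
  obtain ⟨r, rfl⟩ := Nat.exists_eq_add_of_le' (show 1 ≤ r by omega)
  exact one_le_of_bsum_le (ht.le hs (.of_forall fun _ => hf_quotient_le V Q _)) h0.symm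

theorem HC.one_eq_quotient (V : Submodule A X) {Q : Ideal A} {l : List A}
    (hl : Ideal.ofList l ≤ Q) (h : hf (Ideal.ofList l) V 1 ≠ ⊤) {r : ℕ} (hr : l.length + 2 ≤ r)
    {s t : ℕ → ℤ} (hs : HC Q X r s) (ht : HC Q (X ⧸ V) r t) : s 1 = t 1 :=
  le_antisymm (hs.one_le_quotient V hl h (by omega) ht)
    (one_le_of_bsum_le_add hr (hs.le_add ht (.of_forall (hf_le_quotient_add V hl h)))
      (hs.zero_eq_quotient V hl h (by omega) ht))

theorem le_of_bsum_le_shift {r c : ℕ} {s t : ℕ → ℤ}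
    (h : ∀ᶠ n in atTop, bsum r s n ≤ bsum r t (n + c)) : s 0 ≤ t 0 := by
  have h1 := tendsto_bsum_div r t (u := fun n => n + c) (c := 1) (by
    have h2 : Tendsto (fun n : ℕ => 1 + (c : ℝ) / n) atTop (nhds (1 + 0)) :=
      tendsto_const_nhds.add (tendsto_const_div_atTop_nhds_zero_nat _)
    rw [add_zero] at h2
    refine h2.congr' ?_
    filter_upwards [eventually_gt_atTop 0] with n hn
    have : (n : ℝ) ≠ 0 := by positivity
    push_cast
    field_simp) (tendsto_add_atTop_nat c)
  have h3 := le_of_tendsto_of_tendsto (tendsto_bsum_div_self r s) h1 (by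
    filter_upwards [h] with n hn
    gcongr)
  rw [one_pow, mul_one_div] at h3
  have := (div_le_div_iff_of_pos_right (by positivity : (0 : ℝ) < r.factorial)).1 h3
  exact_mod_cast this

theorem length_quotient_eq_ix (V : Submodule A X) (K : Submodule A V) :
    Module.length A (V ⧸ K) = ix (K.map V.subtype) V := by
  rw [ix, ← (LinearMap.quotKerEquivRange _).length_eq, ker_mkQ_comp_subtype,
    Submodule.comap_map_eq_of_injective V.subtype_injective]

theorem eventually_pow_smul_le [IsLocalRing A] {Q : Ideal A} (hQ : Q ≤ maximalIdeal A)
    (V : Submodule A X) (hV : Module.length A (X ⧸ V) ≠ ⊤) :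
    ∃ c, ∀ n ≥ c, Q ^ n • (⊤ : Submodule A X) ≤ V := by
  obtain ⟨c, hc⟩ := exists_pow_smul_eq_bot_of_length hV
  refine ⟨c, fun n hn => ?_⟩
  have h1 : maximalIdeal A ^ c • (⊤ : Submodule A X) ≤ V := by
    rw [← Submodule.ker_mkQ V, LinearMap.le_ker_iff_map, Submodule.map_smul'', Submodule.map_top,
      Submodule.range_mkQ, hc]
  exact (Submodule.smul_mono ((Ideal.pow_le_pow_right hn).trans (Ideal.pow_right_mono hQ c))
    le_rfl).trans h1

theorem HC.one_le_of_finite_colength [IsLocalRing A] {Q : Ideal A} (hQ : Q ≤ maximalIdeal A)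
    (V : Submodule A X) (hV : Module.length A (X ⧸ V) ≠ ⊤) {r : ℕ} (hr : 2 ≤ r) {s t : ℕ → ℤ}
    (hs : HC Q V r s) (ht : HC Q X r t) : s 1 ≤ t 1 := by
  obtain ⟨c, hc⟩ := eventually_pow_smul_le hQ V hV
  have h1 : ∀ n, hf Q V n ≤ hf Q X (n + c) := by
    intro n
    rw [hf_eq_add V Q (n + c)]
    refine le_trans ?_ le_self_add
    have h2 : Q ^ (n + c) • (⊤ : Submodule A X) ≤ Q ^ n • V := by
      rw [pow_add, mul_smul]
      exact Submodule.smul_mono le_rfl (hc c le_rfl)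
    refine le_trans ?_ (ix_anti_left V (K := Q ^ (n + c) • (⊤ : Submodule A X)) (K' := Q ^ n • V)
      (inf_le_left.trans h2))
    rw [hf, length_quotient_eq_ix, Submodule.map_smul'', Submodule.map_top, Submodule.range_subtype]
  have h2 : ∀ n, hf Q X (n + 1) ≤ hf Q V (n + 1) +
      ((Module.length A (X ⧸ V)).toNat * (n + 0).choose 0 : ℕ) := by
    intro n
    rw [hf_eq_add V, Nat.choose_zero_right, mul_one, ENat.natCast_toNat hV, hf_quotient]
    exact add_le_add (ix_le_hf V Q _) (Module.length_le_of_surjective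
      (Submodule.factor le_sup_right) (Submodule.factor_surjective _))
  have h3 := ht.le_add hs (.of_forall h2)
  have h4 : ∀ᶠ n in atTop, bsum r s n ≤ bsum r t (n + c) := by
    filter_upwards [hs, (tendsto_add_atTop_nat c).eventually ht] with n ⟨l, e1, e2⟩ ⟨l', e1', e2'⟩
    have := h1 (n + 1)
    rw [show n + 1 + c = n + c + 1 by ring, e1, e1'] at this
    rw [← e2, ← e2']
    exact_mod_cast this
  exact one_le_of_bsum_le_add (by omega) h3
    (le_antisymm (zero_le_of_bsum_le_add (by omega) h3) (le_of_bsum_le_shift h4))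

end Comparison

end LocalCoh

namespace LocalCoh

open Filter

section ParameterLists

variable {A : Type} [CommRing A]

/-- The quotient `X / x X`. -/
abbrev Quo (x : A) (X : Type) [AddCommGroup X] [Module A X] : Type :=
  X ⧸ LinearMap.range (LinearMap.lsmul A X x)

/-- The first Hilbert coefficient of `X` with respect to the ideal generated by a list. -/
noncomputable def e1 (l : List A) (X : Type) [AddCommGroup X] [Module A X] : ℤ :=
  open Classical in if h : ∃ s, HC (Ideal.ofList l) X l.length s then h.choose 1 else 0

variable {X : Type} [AddCommGroup X] [Module A X]

theorem HC.e1_eq {l : List A} {s : ℕ → ℤ} (hs : HC (Ideal.ofList l) X l.length s)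
    (h : 1 ≤ l.length) : e1 l X = s 1 := by
  have hex : ∃ s, HC (Ideal.ofList l) X l.length s := ⟨s, hs⟩
  rw [e1, dif_pos hex]
  exact hex.choose_spec.one_eq h hs

theorem e1_congr {Y : Type} [AddCommGroup Y] [Module A Y] (e : X ≃ₗ[A] Y) (l : List A) :
    e1 l X = e1 l Y := by
  have : (fun s => HC (Ideal.ofList l) X l.length s) = fun s => HC (Ideal.ofList l) Y l.length s := by
    funext s
    simp only [HC, hf_congr e]
  have key : ∀ P Q : (ℕ → ℤ) → Prop, P = Q →
      (open Classical in if h : ∃ s, P s then h.choose 1 else 0) =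
        (open Classical in if h : ∃ s, Q s then h.choose 1 else 0) := by
    rintro P _ rfl
    rfl
  exact key _ _ this

variable [IsLocalRing A]

/-- The elements of the list generate a proper ideal `Q` such that `X / Q X` has finite length. -/
def PL (l : List A) (X : Type) [AddCommGroup X] [Module A X] : Prop :=
  Ideal.ofList l ≤ maximalIdeal A ∧ hf (Ideal.ofList l) X 1 ≠ ⊤

theorem PL.of_surjective {Y : Type} [AddCommGroup Y] [Module A Y] {l : List A} (h : PL l X)
    {f : X →ₗ[A] Y} (hf' : Function.Surjective f) : PL l Y :=
  ⟨h.1, ne_top_of_le_ne_top h.2 (hf_le_of_surjective hf' _ _)⟩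

theorem PL.quotient {l : List A} (h : PL l X) (V : Submodule A X) : PL l (X ⧸ V) :=
  h.of_surjective (Submodule.mkQ_surjective V)

theorem PL.head_mem {x : A} {l : List A} (h : PL (x :: l) X) : x ∈ maximalIdeal A :=
  h.1 (Ideal.subset_span List.mem_cons_self)

theorem PL.tail_le {x : A} {l : List A} (h : PL (x :: l) X) : Ideal.ofList l ≤ maximalIdeal A :=
  le_trans (by rw [Ideal.ofList_cons]; exact le_sup_right) h.1

theorem PL.tail {x : A} {l : List A} (h : PL (x :: l) X) : PL l (Quo x X) :=
  ⟨h.tail_le, hf_quotient_range_ne_top h.2⟩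

theorem PL.cons {x : A} {l : List A} (hx : x ∈ maximalIdeal A) (h : PL l (Quo x X)) :
    PL (x :: l) X := by
  refine ⟨?_, ?_⟩
  · rw [Ideal.ofList_cons, sup_le_iff, Ideal.span_singleton_le_iff_mem]
    exact ⟨hx, h.1⟩
  · have h1 := h.2
    rw [← hf_ofList_cons_quotient, hf_quotient, pow_one] at h1
    rwa [hf_one, ← sup_eq_left.2 (show LinearMap.range (LinearMap.lsmul A X x) ≤
      Ideal.ofList (x :: l) • ⊤ from ?_)]
    rw [LinearMap.range_eq_map, ← span_singleton_smul_eq_map, Ideal.ofList_cons]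
    exact Submodule.smul_mono le_sup_left le_rfl

variable [IsNoetherianRing A] [Module.Finite A X]

theorem PL.exists_HC {l : List A} (h : PL l X) :
    ∃ s, HC (Ideal.ofList l) X l.length s ∧ (1 ≤ l.length → s 1 ≤ 0) :=
  LocalCoh.exists_HC l.length A l rfl h.1 X h.2

theorem PL.e1_nonpos {l : List A} (h : PL l X) (hl : 1 ≤ l.length) : e1 l X ≤ 0 := by
  obtain ⟨s, hs, hs1⟩ := h.exists_HC
  exact (hs.e1_eq hl).trans_le (hs1 hl)

theorem PL.e1_le_quotient {l l' : List A} (h : PL l X) (V : Submodule A X)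
    (hl : Ideal.ofList l' ≤ Ideal.ofList l) (hV : hf (Ideal.ofList l') V 1 ≠ ⊤)
    (hr : l'.length + 1 ≤ l.length) : e1 l X ≤ e1 l (X ⧸ V) := by
  obtain ⟨s, hs, -⟩ := h.exists_HC
  obtain ⟨t, ht, -⟩ := (h.quotient V).exists_HC
  rw [hs.e1_eq (by omega), ht.e1_eq (by omega)]
  exact hs.one_le_quotient V hl hV hr ht

theorem PL.e1_eq_quotient {l l' : List A} (h : PL l X) (V : Submodule A X)
    (hl : Ideal.ofList l' ≤ Ideal.ofList l) (hV : hf (Ideal.ofList l') V 1 ≠ ⊤)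
    (hr : l'.length + 2 ≤ l.length) : e1 l X = e1 l (X ⧸ V) := by
  obtain ⟨s, hs, -⟩ := h.exists_HC
  obtain ⟨t, ht, -⟩ := (h.quotient V).exists_HC
  rw [hs.e1_eq (by omega), ht.e1_eq (by omega)]
  exact hs.one_eq_quotient V hl hV hr ht

theorem PL.e1_le_of_finite_colength {l : List A} (h : PL l X) (V : Submodule A X) (h' : PL l V)
    (hV : Module.length A (X ⧸ V) ≠ ⊤) (hr : 2 ≤ l.length) : e1 l V ≤ e1 l X := by
  obtain ⟨s, hs, -⟩ := h'.exists_HC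
  obtain ⟨t, ht, -⟩ := h.exists_HC
  rw [hs.e1_eq (by omega), ht.e1_eq (by omega)]
  exact hs.one_le_of_finite_colength h.1 V hV hr ht

theorem PL.e1_singleton {x : A} (h : PL [x] X) :
    e1 [x] X = -((Module.length A (gam (A := A) X)).toNat : ℤ) := by
  have h1 := (h.quotient (gam (A := A) X))
  have hreg : ∀ u : X ⧸ gam (A := A) X, x • u = 0 → u = 0 := fun u hu => by
    have := mem_gam_of_smul_eq_zero h1.2 (u := u) fun y hy => by
      rw [Ideal.ofList_singleton] at hy
      obtain ⟨b, rfl⟩ := Ideal.mem_span_singleton'.1 hy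
      rw [mul_smul, hu, smul_zero]
    rwa [gam_quotient_gam] at this
  obtain ⟨a, ha⟩ := ENat.ne_top_iff_exists.1 h1.2
  rw [Ideal.ofList_singleton] at ha
  have h2 : HC (Ideal.ofList [x]) (X ⧸ gam (A := A) X) 1 (Pi.single 0 a) := by
    rw [Ideal.ofList_singleton]
    refine .of_forall fun n => ⟨(n + 1) * a, ?_, ?_⟩
    · rw [hf_singleton_of_injective hreg, ← ha]
      push_cast; rfl
    · simp [bsum, Finset.sum_range_succ]
      ring
  rw [(h2.of_gam h.1).e1_eq le_rfl]
  simp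

theorem PL.e1_cons_eq {x : A} {l : List A} (h : PL (x :: l) X) (hl : 1 ≤ l.length)
    (hd : ∀ᶠ n in atTop, dfun x (Ideal.ofList (x :: l)) X n = 0) :
    e1 (x :: l) X = e1 l (Quo x X) := by
  obtain ⟨s, hs, -⟩ := h.tail.exists_HC
  obtain ⟨t, ht, ht'⟩ := hs.of_dfun h.2 hd
  rw [hs.e1_eq hl, ← ht 1 hl]
  exact HC.e1_eq (l := x :: l) ht' (by simp)

end ParameterLists

end LocalCoh

namespace LocalCoh

open Filter

section Sections

variable {A : Type} [CommRing A] {X : Type} [AddCommGroup X] [Module A X]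

/-- A list is a relative `d`-sequence on `X / V`, uniformly in the order of its elements. -/
def DS (X : Type) [AddCommGroup X] [Module A X] : Submodule A X → List A → Prop
  | _, [] => True
  | V, x :: l => (∃ S : Submodule A X, ∀ y ∈ x :: l,
      V.comap (LinearMap.lsmul A X y) = S ∧ S.comap (LinearMap.lsmul A X y) = S) ∧
      DS X (V ⊔ Ideal.span {x} • ⊤) l

theorem DS.mem_of_smul_mem {l : List A} {V : Submodule A X} (h : DS X V l) {w : X}
    (hw : w ∈ V ⊔ Ideal.ofList l • (⊤ : Submodule A X)) (hy : ∀ y ∈ l, y • w ∈ V) : w ∈ V := by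
  induction l generalizing V with
  | nil => simpa using hw
  | cons x l ih =>
    obtain ⟨⟨S, hS⟩, h⟩ := h
    have h1 : w ∈ V ⊔ Ideal.span {x} • (⊤ : Submodule A X) := by
      refine ih h ?_ fun y hy' => Submodule.mem_sup_left (hy y (List.mem_cons_of_mem _ hy'))
      rwa [Ideal.ofList_cons, Submodule.sup_smul, ← sup_assoc] at hw
    obtain ⟨v, hv, w', hw', rfl⟩ := Submodule.mem_sup.1 h1
    rw [span_singleton_smul_eq_map] at hw'
    obtain ⟨z, -, rfl⟩ := hw'
    obtain ⟨hS1, hS2⟩ := hS x List.mem_cons_self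
    have h2 : LinearMap.lsmul A X x z ∈ S := by
      rw [← hS1, Submodule.mem_comap]
      have := V.sub_mem (hy x List.mem_cons_self) (V.smul_mem x hv)
      rwa [smul_add, add_sub_cancel_left] at this
    have h3 : z ∈ S := by
      rw [← hS2]
      exact h2
    rw [← hS1] at h3
    exact V.add_mem hv h3

theorem DS.inf_le {l : List A} {I : Ideal A} (h : DS X (I • (⊤ : Submodule A X)) l) (n : ℕ) :
    I • (⊤ : Submodule A X) ⊓ (I ⊔ Ideal.ofList l) ^ (n + 1) • ⊤ ≤
      (I * (I ⊔ Ideal.ofList l) ^ n) • ⊤ := by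
  induction l generalizing I n with
  | nil =>
    rw [Ideal.ofList_nil, sup_bot_eq, ← pow_succ']
    exact inf_le_right
  | cons x l ih =>
    have h1 := h.2
    rw [← Submodule.sup_smul] at h1
    have h2 := fun n => ih h1 n
    rw [sup_assoc, ← Ideal.ofList_cons] at h2
    obtain ⟨⟨S, hS⟩, -⟩ := id h
    induction n with
    | zero => simp
    | succ n ihn =>
      rintro u ⟨hu1, hu2⟩
      have h3 : u ∈ _ := h2 (n + 1)
        ⟨Submodule.smul_mono (le_sup_left : I ≤ I ⊔ Ideal.span {x}) le_rfl hu1, hu2⟩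
      rw [Ideal.sup_mul, Submodule.sup_smul, mul_smul (Ideal.span {x}),
        span_singleton_smul_eq_map] at h3
      obtain ⟨v, hv, w', ⟨w, hw, rfl⟩, rfl⟩ := Submodule.mem_sup.1 h3
      have hvI : v ∈ I • (⊤ : Submodule A X) :=
        (Submodule.smul_mono_left (N := (⊤ : Submodule A X)) (Ideal.mul_le_left :
          I * (I ⊔ Ideal.ofList (x :: l)) ^ (n + 1) ≤ I)) hv
      have h4 : w ∈ (I • (⊤ : Submodule A X)).comap (LinearMap.lsmul A X x) := by
        have := Submodule.sub_mem _ hu1 hvI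
        rwa [add_sub_cancel_left] at this
      rw [(hS x List.mem_cons_self).1] at h4
      have h5 : w ∈ I • (⊤ : Submodule A X) := by
        refine h.mem_of_smul_mem ?_ fun y hy => ?_
        · rw [← Submodule.sup_smul]
          have hle : (I ⊔ Ideal.ofList (x :: l)) ^ (n + 1) ≤ I ⊔ Ideal.ofList (x :: l) :=
            Ideal.pow_le_self (Nat.succ_ne_zero n)
          have hle' := Submodule.smul_mono_left (N := (⊤ : Submodule A X)) hle
          exact hle' hw
        · rw [← (hS y hy).1] at h4
          exact h4
      refine Submodule.add_mem _ hv ?_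
      have h6 := ihn ⟨h5, hw⟩
      rw [pow_succ', mul_left_comm, mul_smul (I ⊔ _)]
      exact Submodule.smul_mem_smul (Ideal.mem_sup_right (Ideal.subset_span List.mem_cons_self)) h6

theorem DS.dfun_eq_zero {x : A} {l : List A} (h : DS X ⊥ (x :: l))
    (hx : ∀ u : X, x • u = 0 → u = 0) (n : ℕ) : dfun x (Ideal.ofList (x :: l)) X n = 0 := by
  have h1 := h.2
  rw [bot_sup_eq] at h1
  refine ix_self _ fun u hu => ?_
  have h2 := h1.inf_le n
  rw [← Ideal.ofList_cons, mul_smul, span_singleton_smul_eq_map, span_singleton_smul_eq_map] at h2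
  obtain ⟨w, hw, hw'⟩ := h2 ⟨⟨u, trivial, rfl⟩, hu⟩
  have : w - u = 0 := hx _ (by
    rw [smul_sub, sub_eq_zero]
    exact hw')
  rwa [← sub_eq_zero.1 this]

variable [IsLocalRing A] [IsNoetherianRing A] [Module.Finite A X]

theorem PL.e1_cons_eq_of_DS {x : A} {l : List A} (h : PL (x :: l) X) (hl : 1 ≤ l.length)
    (hd : DS X ⊥ (x :: l)) (hx : ∀ u : X, x • u = 0 → u = 0) :
    e1 (x :: l) X = e1 l (Quo x X) :=
  h.e1_cons_eq hl (.of_forall (hd.dfun_eq_zero hx))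

theorem eventually_dfun {x : A} {l : List A} (h : PL (x :: l) X) {s t : ℕ → ℤ}
    (hs : HC (Ideal.ofList l) (Quo x X) l.length s)
    (ht : HC (Ideal.ofList (x :: l)) X (l.length + 1) t) :
    ∀ᶠ n in atTop, ∃ d : ℕ, dfun x (Ideal.ofList (x :: l)) X n = d ∧
      (d : ℤ) = bsum l.length s n - bsum l.length t n := by
  have h1 : ∀ᶠ n in atTop, ∃ d : ℕ, dfun x (Ideal.ofList (x :: l)) X (n + 1) = d ∧
      (d : ℤ) = bsum l.length s (n + 1) - bsum l.length t (n + 1) := by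
    filter_upwards [(tendsto_add_atTop_nat 1).eventually hs, ht,
      (tendsto_add_atTop_nat 1).eventually ht] with n ⟨a, ha, ha'⟩ ⟨b, hb, hb'⟩ ⟨c, hc, hc'⟩
    have h2 := hf_add_dfun (X := X) (Ideal.subset_span List.mem_cons_self : x ∈ Ideal.ofList (x :: l))
      (n + 1)
    rw [hc, hb, hf_ofList_cons_quotient, ha] at h2
    have h3 : dfun x (Ideal.ofList (x :: l)) X (n + 1) ≠ ⊤ := fun h => by
      rw [h, add_top] at h2
      exact ENat.top_ne_natCast (b + a) (by exact_mod_cast h2)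
    obtain ⟨d, hd⟩ := ENat.ne_top_iff_exists.1 h3
    refine ⟨d, hd.symm, ?_⟩
    rw [← hd] at h2
    have h4 : c + d = b + a := by exact_mod_cast h2
    have h5 := bsum_diff l.length t n
    omega
  rw [eventually_atTop] at h1 ⊢
  obtain ⟨N, hN⟩ := h1
  refine ⟨N + 1, fun n hn => ?_⟩
  obtain ⟨n, rfl⟩ := Nat.exists_eq_add_of_le' (show 1 ≤ n by omega)
  exact hN n (by omega)

theorem ix_le_length_quotient (K L : Submodule A X) : ix K L ≤ Module.length A (X ⧸ K) :=
  (ix_mono_right K le_top).trans (ix_top K).le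

theorem exists_dfun_le (x y : A) (l : List A) :
    ∃ c, ∀ n ≥ c, dfun x (Ideal.ofList (x :: y :: l)) X n ≤
      Module.length A (LinearMap.ker (LinearMap.lsmul A X x)) +
        ((n + l.length).choose l.length : ℕ) * hf (Ideal.ofList (x :: y :: l)) X c := by
  set Q := Ideal.ofList (x :: y :: l) with hQ
  obtain ⟨k, hk⟩ := Ideal.exists_pow_inf_eq_pow_smul Q (LinearMap.range (LinearMap.lsmul A X x))
  set W := (Q ^ (k + 1) • (⊤ : Submodule A X)).comap (LinearMap.lsmul A X x)
  refine ⟨k, fun n hn => ?_⟩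
  obtain ⟨m, rfl⟩ := Nat.exists_eq_add_of_le hn
  cases m with
  | zero =>
    refine (ix_le_length_quotient _ _).trans (le_add_of_le_right ?_)
    have : 1 ≤ (k + l.length).choose l.length := Nat.choose_pos (by omega)
    exact le_mul_of_one_le_left' (by exact_mod_cast this)
  | succ m =>
  have h1 : Q ^ (k + (m + 1) + 1) • (⊤ : Submodule A X) ⊓
      LinearMap.range (LinearMap.lsmul A X x) ≤ (Q ^ (m + 1) • W).map (LinearMap.lsmul A X x) := by
    rw [hk _ (by omega), show k + (m + 1) + 1 - k = m + 1 + 1 by omega, pow_succ, mul_smul,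
      Submodule.map_smul'', Submodule.map_comap_eq]
    refine Submodule.smul_mono le_rfl (le_inf (Submodule.smul_le_right.trans inf_le_right) ?_)
    rw [pow_succ', mul_smul]
    exact Submodule.smul_mono le_rfl inf_le_left
  have h2 : (Q ^ (k + (m + 1) + 1) • (⊤ : Submodule A X)).comap (LinearMap.lsmul A X x) ≤
      (Ideal.ofList (y :: l) ^ (m + 1) • W ⊔ Q ^ (k + (m + 1)) • ⊤) ⊔
        LinearMap.ker (LinearMap.lsmul A X x) := by
    intro u hu
    have h3 : u ∈ ((Q ^ (m + 1) • W).map (LinearMap.lsmul A X x)).comap (LinearMap.lsmul A X x) :=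
      h1 ⟨hu, u, rfl⟩
    rw [Submodule.comap_map_eq] at h3
    suffices h5 : Q ^ (m + 1) • W ≤ Ideal.ofList (y :: l) ^ (m + 1) • W ⊔ Q ^ (k + (m + 1)) • ⊤ from
      sup_le_sup_right h5 _ h3
    rw [hQ, Ideal.ofList_cons, sup_pow_succ, Submodule.sup_smul, ← Ideal.ofList_cons, ← hQ]
    refine sup_le (le_sup_of_le_right ?_) le_sup_left
    rw [mul_comm, mul_smul, span_singleton_smul_eq_map,
      show k + (m + 1) = m + (k + 1) by omega, pow_add Q m, mul_smul]
    exact Submodule.smul_mono le_rfl (Submodule.map_comap_le _ _)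
  refine (ix_mono_right _ h2).trans ((ix_sup_right _ _ _).trans ?_)
  rw [add_comm]
  refine add_le_add (ix_le_length _ _) ((ix_sup_right _ _ _).trans ?_)
  rw [ix_self _ le_rfl, add_zero]
  have h4 : Ideal.ofList (y :: l) ^ (m + 1) • (Q ^ k • (⊤ : Submodule A X)) ≤
      Q ^ (k + (m + 1)) • ⊤ := by
    rw [add_comm k, pow_add Q, mul_smul]
    refine Submodule.smul_mono (Ideal.pow_right_mono ?_ _) le_rfl
    rw [hQ, Ideal.ofList_cons x]
    exact le_sup_right
  refine (ix_anti_left _ (inf_le_left.trans h4)).trans ((ix_pow_smul_le _ _ _ _).trans ?_)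
  rw [hf]
  refine mul_le_mul' ?_ (ix_le_length_quotient _ _)
  rw [Nat.multichoose_eq, List.length_cons, show l.length + 1 + (m + 1) - 1 = (m + 1) + l.length by omega,
    Nat.choose_symm_add]
  exact_mod_cast Nat.choose_le_choose _ (by omega)

theorem bsum_le_of_HC {x : A} {l : List A} (h : PL (x :: l) X) {s t : ℕ → ℤ}
    (hs : HC (Ideal.ofList l) (Quo x X) l.length s)
    (ht : HC (Ideal.ofList (x :: l)) X (l.length + 1) t) :
    ∀ᶠ n in atTop, bsum l.length t n ≤ bsum l.length s n := by
  filter_upwards [eventually_dfun h hs ht] with n ⟨d, _, hd⟩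
  omega

theorem zero_eq_of_HC {x : A} {l : List A} (h : PL (x :: l) X) (hl : 1 ≤ l.length)
    (hx : Module.length A (LinearMap.ker (LinearMap.lsmul A X x)) ≠ ⊤) {s t : ℕ → ℤ}
    (hs : HC (Ideal.ofList l) (Quo x X) l.length s)
    (ht : HC (Ideal.ofList (x :: l)) X (l.length + 1) t) : t 0 = s 0 := by
  have hd := eventually_dfun h hs ht
  have h1 := bsum_le_of_HC h hs ht
  obtain ⟨y, l, rfl⟩ := List.exists_cons_of_length_pos hl
  obtain ⟨c, hc⟩ := exists_dfun_le (X := X) x y l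
  obtain ⟨a, ha⟩ := ENat.ne_top_iff_exists.1 hx
  obtain ⟨b, hb⟩ := ENat.ne_top_iff_exists.1 (hf_ne_top _ h.2 c)
  rw [← ha, ← hb] at hc
  have h2 : ∀ᶠ n in atTop, bsum (y :: l).length s n ≤ bsum (y :: l).length t n +
      (a + b : ℤ) * ((n + l.length).choose l.length : ℤ) := by
    filter_upwards [hd, eventually_ge_atTop c] with n ⟨d, hd, hd'⟩ hn
    have h3 := hc n hn
    rw [hd] at h3
    have h4 : d ≤ a + (n + l.length).choose l.length * b := by exact_mod_cast h3
    have h5 : 1 ≤ (n + l.length).choose l.length := Nat.choose_pos (by omega)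
    have h6 : d ≤ (a + b) * (n + l.length).choose l.length := by nlinarith
    zify at h6
    linarith
  exact le_antisymm (le_of_bsum_le h1) (zero_le_of_bsum_le_add (by simp) h2)

theorem PL.e1_quo_le {x : A} {l : List A} (h : PL (x :: l) X) (hl : 1 ≤ l.length)
    (hx : Module.length A (LinearMap.ker (LinearMap.lsmul A X x)) ≠ ⊤) :
    e1 l (Quo x X) ≤ e1 (x :: l) X := by
  obtain ⟨s, hs, -⟩ := h.tail.exists_HC
  obtain ⟨t, ht, -⟩ := h.exists_HC
  rw [hs.e1_eq hl, ht.e1_eq (by simp)]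
  have h0 := zero_eq_of_HC h hl hx hs ht
  have h1 := bsum_le_of_HC h hs ht
  obtain ⟨y, l, rfl⟩ := List.exists_cons_of_length_pos hl
  exact one_le_of_bsum_le (r := l.length) (s := t) (t := s) h1 h0

theorem PL.e1_pair_ge {x y : A} (h : PL [x, y] X) {a : ℕ}
    (hx : Module.length A (LinearMap.ker (LinearMap.lsmul A X x)) = a) :
    e1 [y] (Quo x X) + a ≤ e1 [x, y] X := by
  obtain ⟨s, hs, -⟩ := h.tail.exists_HC
  obtain ⟨t, ht, -⟩ := h.exists_HC
  rw [hs.e1_eq (by simp), ht.e1_eq (by simp)]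
  have hd := eventually_dfun h hs ht
  obtain ⟨c, hc⟩ := exists_pow_smul_inf_eq_bot h.1
    (V := LinearMap.ker (LinearMap.lsmul A X x)) (by simp [hx])
  have h1 : ∀ᶠ n in atTop, bsum 1 (fun i => if i = 0 then t 0 else t 1 - a) n ≤ bsum 1 s n := by
    filter_upwards [hd, eventually_ge_atTop c] with n ⟨d, hd, hd'⟩ hn
    have h2 : (a : ℕ∞) ≤ d := by
      rw [← hx, ← hd, ← ix_bot, ← hc n hn, ix_inf]
      refine ix_mono_right _ fun u hu => ?_
      rw [LinearMap.mem_ker] at hu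
      rw [Submodule.mem_comap, hu]
      exact zero_mem _
    have h3 : a ≤ d := by exact_mod_cast h2
    simp [bsum, Finset.sum_range_succ] at hd' ⊢
    linarith
  have h0 := zero_eq_of_HC h (by simp) (by simp [hx]) hs ht
  have h2 := one_le_of_bsum_le (r := 0) h1 (by simpa using h0)
  simp only [one_ne_zero, if_false] at h2
  omega

end Sections

end LocalCoh

namespace LocalCoh

open Filter

section Dimension

variable {A : Type} [CommRing A]
variable {X Y Z : Type} [AddCommGroup X] [Module A X] [AddCommGroup Y] [Module A Y]
  [AddCommGroup Z] [Module A Z]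

/-- The support of `X` has dimension less than `d`. -/
def DL (A : Type) [CommRing A] (d : ℕ) (X : Type) [AddCommGroup X] [Module A X] : Prop :=
  ∀ p ∈ Module.support A X, ringKrullDim (A ⧸ p.asIdeal) < (d : ℕ∞)

theorem DL.of_injective {d : ℕ} (h : DL A d Y) {f : X →ₗ[A] Y} (hf : Function.Injective f) :
    DL A d X := fun p hp => h p (Module.support_subset_of_injective f hf hp)

theorem DL.of_surjective {d : ℕ} (h : DL A d X) {f : X →ₗ[A] Y} (hf : Function.Surjective f) :
    DL A d Y := fun p hp => h p (Module.support_subset_of_surjective f hf hp)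

theorem DL.quotient {d : ℕ} (h : DL A d X) (V : Submodule A X) : DL A d (X ⧸ V) :=
  h.of_surjective (Submodule.mkQ_surjective V)

theorem DL.submodule {d : ℕ} (h : DL A d X) (V : Submodule A X) : DL A d V :=
  h.of_injective (Submodule.subtype_injective V)

theorem DL.of_exact {d : ℕ} {f : X →ₗ[A] Y} {g : Y →ₗ[A] Z} (hfg : Function.Exact f g)
    (hf : Function.Injective f) (hg : Function.Surjective g) (hX : DL A d X) (hZ : DL A d Z) :
    DL A d Y := fun p hp => by
  rw [Module.support_of_exact hfg hf hg] at hp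
  exact hp.elim (hX p) (hZ p)

theorem DL.mono {d d' : ℕ} (h : DL A d X) (hd : d ≤ d') : DL A d' X := fun p hp =>
  (h p hp).trans_le (by exact_mod_cast hd)

theorem DL_zero_iff : DL A 0 X ↔ Subsingleton X := by
  rw [← Module.support_eq_empty_iff (R := A), Set.eq_empty_iff_forall_notMem]
  refine forall_congr' fun p => ⟨fun h hp => ?_, fun h hp => (h hp).elim⟩
  exact not_lt_of_ge ringKrullDim_nonneg_of_nontrivial (h hp)

theorem dim_lt_of_succ_le {a b : WithBot ℕ∞} {d : ℕ} (h : a + 1 ≤ b) (hb : b < ((d + 1 : ℕ) : ℕ∞)) :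
    a < (d : ℕ∞) := by
  have h1 := h.trans_lt hb
  cases a with
  | bot => exact WithBot.bot_lt_coe _
  | coe a =>
    have h2 : a + 1 < ((d + 1 : ℕ) : ℕ∞) := by exact_mod_cast h1
    have h3 : a < (d : ℕ∞) := by
      rw [Nat.cast_add, Nat.cast_one] at h2
      exact lt_of_add_lt_add_right h2
    exact_mod_cast h3

theorem dim_quotient_lt {p q : Ideal A} [p.IsPrime] (h : p < q) {d : ℕ}
    (hp : ringKrullDim (A ⧸ p) < ((d + 1 : ℕ) : ℕ∞)) : ringKrullDim (A ⧸ q) < (d : ℕ∞) := by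
  obtain ⟨r, hr, hr'⟩ := SetLike.exists_of_lt h
  refine dim_lt_of_succ_le (ringKrullDim_succ_le_of_surjective (Ideal.Quotient.factor h.le)
    (Ideal.Quotient.factor_surjective h.le) (r := Ideal.Quotient.mk p r) ?_ ?_) hp
  · rwa [mem_nonZeroDivisors_iff_ne_zero, Ne, Ideal.Quotient.eq_zero_iff_mem]
  · rwa [Ideal.Quotient.factor_mk, Ideal.Quotient.eq_zero_iff_mem]

theorem DL_iff_supportDim {d : ℕ} : DL A d X ↔ Module.supportDim A X < (d : ℕ∞) := by
  constructor
  · intro h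
    rw [Module.supportDim, Order.krullDim]
    rcases d with _ | d
    · have := DL_zero_iff.1 h
      have h1 : Module.support A X = ∅ := Module.support_eq_empty_iff.2 this
      have : IsEmpty (Module.support A X) := by rw [h1]; infer_instance
      have : IsEmpty (LTSeries (Module.support A X)) := ⟨fun l => this.elim l.head⟩
      rw [iSup_of_empty]
      exact WithBot.bot_lt_coe _
    · refine lt_of_le_of_lt (b := ((d : ℕ∞) : WithBot ℕ∞)) (iSup_le fun l => ?_)
        (by exact_mod_cast Nat.lt_succ_self d)
      have h1 := h l.head l.head.2
      rw [ringKrullDim_quotient, Order.krullDim] at h1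
      let l' : LTSeries (PrimeSpectrum.zeroLocus (R := A) (l.head.1.asIdeal : Set A)) :=
        { length := l.length
          toFun := fun i => ⟨(l i).1, l.head_le i⟩
          step := fun i => l.step i }
      have h2 := (le_iSup (fun p : LTSeries (PrimeSpectrum.zeroLocus (R := A)
        (l.head.1.asIdeal : Set A)) => (p.length : WithBot ℕ∞)) l').trans_lt h1
      have h3 : l.length < d + 1 := by exact_mod_cast h2
      exact_mod_cast Nat.lt_succ_iff.1 h3
  · intro h p hp
    refine lt_of_le_of_lt ?_ h
    rw [ringKrullDim_quotient, Module.supportDim]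
    exact Order.krullDim_le_of_strictMono
      (fun q : PrimeSpectrum.zeroLocus (R := A) (p.asIdeal : Set A) =>
        (⟨q.1, Module.mem_support_mono q.2 hp⟩ : Module.support A X)) fun _ _ h => h

theorem mDim_eq_supportDim [Module.Finite A X] : mDim A X = Module.supportDim A X := by
  rw [Module.supportDim_eq_ringKrullDim_quotient_annihilator, mDim, Submodule.annihilator_top]

theorem DL_iff_mDim [Module.Finite A X] {d : ℕ} : DL A d X ↔ mDim A X < (d : ℕ∞) := by
  rw [mDim_eq_supportDim, DL_iff_supportDim]

/-- The largest submodule of dimension less than `d`. -/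
def low (A : Type) [CommRing A] (d : ℕ) (X : Type) [AddCommGroup X] [Module A X] : Submodule A X :=
  sSup {V | DL A d V}

section Noetherian

variable [IsNoetherianRing A] [Module.Finite A X]

theorem DL_low (d : ℕ) : DL A d (low A d X) := by
  refine CompleteLattice.WellFoundedGT.isSupClosedCompact (Submodule A X)
    inferInstance {V | DL A d V} ⟨⊥, ?_⟩ ?_
  · exact (DL_zero_iff.2 inferInstance).mono (Nat.zero_le d)
  · intro V hV V' hV'
    have h : DL A d (V × V') := DL.of_exact (f := LinearMap.inl A V V') (g := LinearMap.snd A V V')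
      Function.Exact.inl_snd LinearMap.inl_injective LinearMap.snd_surjective hV hV'
    have h1 : DL A d (LinearMap.range (V.subtype.coprod V'.subtype)) :=
      h.of_surjective (LinearMap.surjective_rangeRestrict _)
    rw [LinearMap.range_coprod, Submodule.range_subtype, Submodule.range_subtype] at h1
    exact h1

theorem le_low_iff {d : ℕ} {V : Submodule A X} : V ≤ low A d X ↔ DL A d V :=
  ⟨fun h => (DL_low d).of_injective (Submodule.inclusion_injective h), fun h => le_sSup h⟩

theorem low_mono {d d' : ℕ} (h : d ≤ d') : low A d X ≤ low A d' X :=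
  le_low_iff.2 ((DL_low d).mono h)

theorem low_quotient_low (d : ℕ) : low A d (X ⧸ low A d X) = ⊥ := by
  set V := low A d (X ⧸ low A d X) with hV
  have h1 : DL A d (V.comap (low A d X).mkQ) := by
    have hle : low A d X ≤ V.comap (low A d X).mkQ := fun u hu => by
      rw [Submodule.mem_comap, Submodule.mkQ_apply, (Submodule.Quotient.mk_eq_zero _).2 hu]
      exact zero_mem _
    let g : V.comap (low A d X).mkQ →ₗ[A] V := ((low A d X).mkQ.restrict fun _ h => h)
    have hg : Function.Surjective g := fun ⟨v, hv⟩ => by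
      obtain ⟨u, rfl⟩ := Submodule.mkQ_surjective _ v
      exact ⟨⟨u, hv⟩, rfl⟩
    refine DL.of_exact (f := Submodule.inclusion hle) (g := g) ?_
      (Submodule.inclusion_injective hle) hg (DL_low d) (DL_low d)
    rintro ⟨u, hu⟩
    constructor
    · intro h
      have h' : (low A d X).mkQ u = 0 := congrArg Subtype.val h
      exact ⟨⟨u, (Submodule.Quotient.mk_eq_zero _).1 h'⟩, rfl⟩
    · rintro ⟨w, hw⟩
      refine Subtype.ext ((Submodule.Quotient.mk_eq_zero _).2 ?_)
      have h3 : (w : X) = u := congrArg Subtype.val hw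
      exact h3 ▸ w.2
  rw [eq_bot_iff]
  intro v hv
  obtain ⟨u, rfl⟩ := Submodule.mkQ_surjective _ v
  exact (Submodule.Quotient.mk_eq_zero _).2 (le_low_iff.2 h1 hv)

theorem low_eq_bot_of_injective [Module.Finite A Y] {d : ℕ} (h : low A d Y = ⊥) {f : X →ₗ[A] Y}
    (hf : Function.Injective f) : low A d X = ⊥ := by
  have h1 : DL A d ((low A d X).map f) := (DL_low d).of_surjective
    (f := f.submoduleMap (low A d X)) (f.submoduleMap_surjective _)
  have h2 := le_low_iff.2 h1
  rw [h, le_bot_iff] at h2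
  exact (Submodule.map_injective_of_injective hf) (h2.trans (Submodule.map_bot f).symm)

end Noetherian

end Dimension

theorem exists_mem_forall_notMem {A : Type} [CommRing A] {S : Set (Ideal A)} (hS : S.Finite)
    (hp : ∀ p ∈ S, p.IsPrime) {Q : Ideal A} (hQ : ∀ p ∈ S, ¬ Q ≤ p) : ∃ x ∈ Q, ∀ p ∈ S, x ∉ p := by
  by_contra! h
  have h1 : (Q : Set A) ⊆ ⋃ p ∈ (hS.toFinset : Set (Ideal A)), p := fun x hx => by
    obtain ⟨p, hpS, hxp⟩ := h x hx
    simp only [Set.mem_iUnion]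
    exact ⟨p, by simpa using hpS, hxp⟩
  obtain ⟨p, hpS, hle⟩ := (Ideal.subset_union_prime (f := fun p => p) ⊥ ⊥
    (fun p hpS _ _ => hp p (by simpa using hpS))).1 h1
  exact hQ p (by simpa using hpS) hle

section LocalDimension

variable {A : Type} [CommRing A] [IsLocalRing A] {X : Type} [AddCommGroup X] [Module A X]

theorem eq_maximalIdeal_of_dim_lt {p : Ideal A} [hp : p.IsPrime]
    (h : ringKrullDim (A ⧸ p) < ((1 : ℕ) : ℕ∞)) : p = maximalIdeal A := by
  by_contra hne
  have h1 := lt_of_le_of_ne (le_maximalIdeal hp.ne_top) hne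
  exact not_lt_of_ge ringKrullDim_nonneg_of_nontrivial (dim_quotient_lt h1 (d := 0) h)

theorem dim_maximalIdeal_lt : ringKrullDim (A ⧸ maximalIdeal A) < ((1 : ℕ) : ℕ∞) := by
  rw [ringKrullDim_eq_zero_of_isField ((Ideal.Quotient.maximal_ideal_iff_isField_quotient _).1
    inferInstance)]
  exact_mod_cast Nat.zero_lt_one

variable [IsNoetherianRing A] [Module.Finite A X]

theorem DL.exists_pow (h : DL A 1 X) : ∃ k, maximalIdeal A ^ k • (⊤ : Submodule A X) = ⊥ := by
  have h1 : maximalIdeal A ≤ (Module.annihilator A X).radical := by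
    rw [Ideal.radical_eq_sInf]
    rintro a ha
    rw [Submodule.mem_sInf]
    rintro p ⟨hp, hp'⟩
    have h2 : (⟨p, hp'⟩ : PrimeSpectrum A) ∈ Module.support A X := by
      rw [Module.support_eq_zeroLocus]
      exact hp
    have := eq_maximalIdeal_of_dim_lt (h _ h2)
    simp only at this
    rwa [this]
  obtain ⟨k, hk⟩ := Ideal.exists_pow_le_of_le_radical_of_fg h1 ((maximalIdeal A).fg_of_isNoetherianRing)
  refine ⟨k, ?_⟩
  rw [eq_bot_iff, Submodule.smul_le]
  intro a ha u _
  rw [Module.mem_annihilator.1 (hk ha) u]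
  exact zero_mem _

theorem DL.length_ne_top (h : DL A 1 X) : Module.length A X ≠ ⊤ :=
  length_ne_top_of_pow_smul h.exists_pow.choose_spec

theorem DL_one_of_pow_smul {k : ℕ} (h : maximalIdeal A ^ k • (⊤ : Submodule A X) = ⊥) :
    DL A 1 X := by
  intro p hp
  rw [Module.support_eq_zeroLocus] at hp
  have h1 : maximalIdeal A ^ k ≤ p.asIdeal := fun a ha => hp (Module.mem_annihilator.2 fun u => by
    have := Submodule.smul_mem_smul ha (Submodule.mem_top (x := u))
    rwa [h] at this)
  have h2 : p.asIdeal = maximalIdeal A :=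
    le_antisymm (le_maximalIdeal p.2.ne_top) (p.2.le_of_pow_le h1)
  rw [h2]
  exact dim_maximalIdeal_lt

theorem DL_one_iff_length : DL A 1 X ↔ Module.length A X ≠ ⊤ :=
  ⟨DL.length_ne_top, fun h => DL_one_of_pow_smul (exists_pow_smul_eq_bot_of_length h).choose_spec⟩

theorem low_one : low A 1 X = gam (A := A) X := by
  apply le_antisymm
  · intro u hu
    obtain ⟨k, hk⟩ := (DL_low (A := A) (X := X) 1).exists_pow
    refine mem_gam.2 ⟨k, fun a ha => ?_⟩
    have := Submodule.smul_mem_smul ha (Submodule.mem_top (x := (⟨u, hu⟩ : low A 1 X)))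
    rw [hk] at this
    exact congrArg Subtype.val ((Submodule.mem_bot A).1 this)
  · exact le_low_iff.2 (DL_one_iff_length.2 length_gam_ne_top)

theorem DL.quo {d : ℕ} (h : DL A (d + 1) X) (hd : 1 ≤ d) {x : A}
    (hx : ∀ p ∈ (Module.annihilator A X).minimalPrimes, p ≠ maximalIdeal A → x ∉ p) :
    DL A d (Quo x X) := by
  intro q hq
  have h1 : Module.annihilator A X ≤ q.asIdeal := by
    have := Module.support_subset_of_surjective _ (Submodule.mkQ_surjective _) hq
    rw [Module.support_eq_zeroLocus] at this
    exact this
  have h2 : x ∈ q.asIdeal := by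
    rw [Module.support_eq_zeroLocus] at hq
    exact hq (Module.mem_annihilator.2 (smul_quotient_range_eq_zero x))
  obtain ⟨p, hp, hpq⟩ := Ideal.exists_minimalPrimes_le h1
  have := hp.1.1
  rcases hpq.lt_or_eq with hlt | rfl
  · refine dim_quotient_lt hlt (h ⟨p, hp.1.1⟩ ?_)
    rw [Module.support_eq_zeroLocus]
    exact hp.1.2
  · by_cases hm : q.asIdeal = maximalIdeal A
    · rw [hm]
      exact dim_maximalIdeal_lt.trans_le (by exact_mod_cast hd)
    · exact (hx _ hp hm h2).elim

theorem hf_ofList_cons_ne_top {x : A} {l : List A} (h : hf (Ideal.ofList l) (Quo x X) 1 ≠ ⊤) :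
    hf (Ideal.ofList (x :: l)) X 1 ≠ ⊤ := by
  rw [← hf_ofList_cons_quotient, hf_quotient, pow_one] at h
  rwa [hf_one, ← sup_eq_left.2 (show LinearMap.range (LinearMap.lsmul A X x) ≤
    Ideal.ofList (x :: l) • ⊤ from ?_)]
  rw [LinearMap.range_eq_map, ← span_singleton_smul_eq_map, Ideal.ofList_cons]
  exact Submodule.smul_mono le_sup_left le_rfl

theorem exists_list_of_DL {d : ℕ} (h : DL A (d + 1) X) {Q : Ideal A} (hQ : hf Q X 1 ≠ ⊤) :
    ∃ l : List A, l.length = d ∧ Ideal.ofList l ≤ Q ∧ hf (Ideal.ofList l) X 1 ≠ ⊤ := by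
  induction d generalizing X with
  | zero =>
    refine ⟨[], rfl, by simp, ?_⟩
    rw [hf_one, Ideal.ofList_nil, Submodule.bot_smul, (Submodule.quotEquivOfEqBot (⊥ : Submodule A X) rfl).length_eq]
    exact h.length_ne_top
  | succ d ih =>
    obtain ⟨k, hk⟩ := exists_pow_le_sup_annihilator hQ
    have hfin := (Module.annihilator A X).finite_minimalPrimes_of_isNoetherianRing A
    obtain ⟨x, hxQ, hx⟩ := exists_mem_forall_notMem (Q := Q)
      (hfin.subset (Set.sep_subset _ (· ≠ maximalIdeal A))) (fun p hp => hp.1.1.1) fun p hp hle => by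
        have hp' := hp.1.1.1
        exact hp.2 (le_antisymm (le_maximalIdeal hp'.ne_top)
          (hp'.le_of_pow_le (hk.trans (sup_le hle hp.1.1.2))))
    have h2 := h.quo (by omega) (x := x) fun p hp hm => hx p ⟨hp, hm⟩
    obtain ⟨l, hl, hlQ, hlf⟩ := ih h2
      (ne_top_of_le_ne_top hQ (hf_le_of_surjective (Submodule.mkQ_surjective _) Q 1))
    refine ⟨x :: l, by simp [hl], ?_, ?_⟩
    · rw [Ideal.ofList_cons, sup_le_iff, Ideal.span_singleton_le_iff_mem]
      exact ⟨hxQ, hlQ⟩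
    · exact hf_ofList_cons_ne_top hlf

open scoped Pointwise in
theorem DL.of_quo {d : ℕ} {x : A} (hx : x ∈ maximalIdeal A) (h1 : DL A d (Quo x X)) :
    DL A (d + 1) X := by
  rw [DL_iff_supportDim] at h1 ⊢
  have h2 := Module.supportDim_le_supportDim_quotSMulTop_succ (M := X) hx
  have h3 : Module.supportDim A (QuotSMulTop x X) < ((d : ℕ) : ℕ∞) := by
    refine lt_of_le_of_lt (Module.supportDim_le_of_surjective (Submodule.factor (?_ :
      LinearMap.range (LinearMap.lsmul A X x) ≤ x • ⊤)) (Submodule.factor_surjective _)) h1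
    rintro _ ⟨u, rfl⟩
    exact Submodule.smul_mem_pointwise_smul _ _ _ trivial
  refine lt_of_le_of_lt h2 ?_
  revert h3
  cases Module.supportDim A (QuotSMulTop x X) with
  | bot => exact fun _ => WithBot.bot_lt_coe _
  | coe a =>
    intro h
    have h4 : a < ((d : ℕ) : ℕ∞) := by exact_mod_cast h
    have h5 : a + 1 < ((d + 1 : ℕ) : ℕ∞) := by
      rw [Nat.cast_add d, Nat.cast_one]
      exact (ENat.add_lt_add_iff_right (by simp)).2 h4
    exact_mod_cast h5

theorem PL.DL {l : List A} (h : PL l X) : DL A (l.length + 1) X := by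
  induction l generalizing X with
  | nil =>
    have h1 := h.2
    rw [hf_one, Ideal.ofList_nil, Submodule.bot_smul,
      (Submodule.quotEquivOfEqBot (⊥ : Submodule A X) rfl).length_eq] at h1
    exact DL_one_iff_length.2 h1
  | cons x l ih =>
    exact (ih h.tail).of_quo h.head_mem

theorem exists_PL_of_DL {d : ℕ} (h : LocalCoh.DL A (d + 1) X) :
    ∃ l : List A, l.length = d ∧ PL l X := by
  obtain ⟨l, hl, hlm, hlf⟩ := exists_list_of_DL h (Q := maximalIdeal A) (by
    rw [hf_one]
    refine length_ne_top_of_pow_smul (k := 1) ?_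
    rw [eq_bot_iff, Submodule.smul_le]
    rintro a ha u -
    obtain ⟨u, rfl⟩ := Submodule.mkQ_surjective _ u
    rw [pow_one] at ha
    rw [Submodule.mem_bot, ← map_smul, Submodule.mkQ_apply, Submodule.Quotient.mk_eq_zero]
    exact Submodule.smul_mem_smul ha trivial)
  exact ⟨l, hl, hlm, hlf⟩

end LocalDimension

end LocalCoh

namespace LocalCoh

open Filter

section Generic

variable {A : Type} [CommRing A] [IsLocalRing A]

/-- The filter of generic elements deep inside the maximal ideal: it is generated by the sets of
elements of a power of the maximal ideal outside finitely many nonmaximal primes. -/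
def genF (A : Type) [CommRing A] [IsLocalRing A] : Filter A where
  sets := {s | ∃ (e : ℕ) (S : Set (Ideal A)), S.Finite ∧ (∀ p ∈ S, p.IsPrime ∧ p ≠ maximalIdeal A) ∧
    ∀ x ∈ maximalIdeal A ^ e, (∀ p ∈ S, x ∉ p) → x ∈ s}
  univ_sets := ⟨0, ∅, Set.finite_empty, by simp, by simp⟩
  sets_of_superset := by
    rintro s t ⟨e, S, hS, hS', h⟩ hst
    exact ⟨e, S, hS, hS', fun x hx hx' => hst (h x hx hx')⟩
  inter_sets := by
    rintro s t ⟨e, S, hS, hS', h⟩ ⟨e', S', hT, hT', h'⟩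
    refine ⟨max e e', S ∪ S', hS.union hT, fun p hp => hp.elim (hS' p) (hT' p), fun x hx hx' =>
      ⟨h x (Ideal.pow_le_pow_right (le_max_left _ _) hx) fun p hp => hx' p (Or.inl hp),
        h' x (Ideal.pow_le_pow_right (le_max_right _ _) hx) fun p hp => hx' p (Or.inr hp)⟩⟩

theorem mem_genF {s : Set A} : s ∈ genF A ↔ ∃ (e : ℕ) (S : Set (Ideal A)), S.Finite ∧
    (∀ p ∈ S, p.IsPrime ∧ p ≠ maximalIdeal A) ∧
    ∀ x ∈ maximalIdeal A ^ e, (∀ p ∈ S, x ∉ p) → x ∈ s := Iff.rfl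

theorem not_pow_le_of_ne {p : Ideal A} [hp : p.IsPrime] (h : p ≠ maximalIdeal A) (e : ℕ) :
    ¬ maximalIdeal A ^ e ≤ p := fun h' =>
  h (le_antisymm (le_maximalIdeal hp.ne_top) (hp.le_of_pow_le h'))

instance : (genF A).NeBot := by
  refine Filter.neBot_iff.2 fun h => ?_
  obtain ⟨e, S, hS, hS', h⟩ := mem_genF.1 (h ▸ Filter.mem_bot : (∅ : Set A) ∈ genF A)
  obtain ⟨x, hx, hx'⟩ := exists_mem_forall_notMem (Q := maximalIdeal A ^ e) hS
    (fun p hp => (hS' p hp).1) fun p hp => by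
      have := (hS' p hp).1
      exact not_pow_le_of_ne (hS' p hp).2 e
  exact h x hx hx'

theorem eventually_mem_pow (e : ℕ) : ∀ᶠ x in genF A, x ∈ maximalIdeal A ^ e :=
  mem_genF.2 ⟨e, ∅, Set.finite_empty, by simp, fun x hx _ => hx⟩

theorem eventually_mem : ∀ᶠ x in genF A, x ∈ maximalIdeal A := by
  simpa using eventually_mem_pow (A := A) 1

theorem eventually_notMem {S : Set (Ideal A)} (hS : S.Finite) (hp : ∀ p ∈ S, p.IsPrime) :
    ∀ᶠ x in genF A, ∀ p ∈ S, p ≠ maximalIdeal A → x ∉ p :=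
  mem_genF.2 ⟨0, {p ∈ S | p ≠ maximalIdeal A}, hS.subset (Set.sep_subset _ _),
    fun p h => ⟨hp p h.1, h.2⟩, fun _ _ hx p hpS hpm => hx p ⟨hpS, hpm⟩⟩

theorem eventually_pow {P : A → Prop} (h : ∀ᶠ x in genF A, P x) :
    ∀ᶠ x in genF A, ∀ᶠ k in atTop, P (x ^ k) := by
  obtain ⟨e, S, hS, hS', h⟩ := mem_genF.1 h
  refine mem_genF.2 ⟨1, S, hS, hS', fun x hx hx' => ?_⟩
  filter_upwards [eventually_ge_atTop e] with k hk
  refine h _ (Ideal.pow_le_pow_right hk (Ideal.pow_mem_pow (by simpa using hx) k)) fun p hp hk' => ?_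
  have := (hS' p hp).1
  exact hx' p hp (Ideal.IsPrime.mem_of_pow_mem this k hk')

variable {X : Type} [AddCommGroup X] [Module A X] [IsNoetherianRing A] [Module.Finite A X]

theorem eventually_DL {d : ℕ} (h : DL A (d + 1) X) (hd : 1 ≤ d) :
    ∀ᶠ x in genF A, DL A d (Quo x X) := by
  filter_upwards [eventually_notMem (Ideal.finite_minimalPrimes_of_isNoetherianRing A
    (Module.annihilator A X)) fun p hp => hp.1.1] with x hx
  exact h.quo hd hx

theorem eq_zero_of_smul_eq_zero (h : gam (A := A) X = ⊥) {x : A}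
    (hx : ∀ p ∈ associatedPrimes A X, p ≠ maximalIdeal A → x ∉ p) : ∀ u : X, x • u = 0 → u = 0 := by
  by_contra! hu
  obtain ⟨u, hu, hu0⟩ := hu
  have h1 : x ∈ ⋃ p ∈ associatedPrimes A X, (p : Set A) := by
    rw [biUnion_associatedPrimes_eq_zero_divisors]
    exact ⟨u, hu0, hu⟩
  simp only [Set.mem_iUnion] at h1
  obtain ⟨p, hp, hxp⟩ := h1
  by_cases hpm : p = maximalIdeal A
  · rw [AssociatedPrimes.mem_iff, isAssociatedPrime_iff] at hp
    obtain ⟨hp, v, hv⟩ := hp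
    have h2 : v ∈ gam (A := A) X := ⟨1, fun a ha => by
      rw [pow_one, ← hpm, hv] at ha
      simpa [Submodule.mem_colon_singleton] using ha⟩
    rw [h, Submodule.mem_bot] at h2
    rw [h2] at hv
    refine hp.ne_top (hv.trans ?_)
    ext a
    simp [Submodule.mem_colon_singleton]
  · exact hx p hp hpm hxp

theorem eventually_regular (h : gam (A := A) X = ⊥) :
    ∀ᶠ x in genF A, ∀ u : X, x • u = 0 → u = 0 := by
  filter_upwards [eventually_notMem (associatedPrimes.finite A X) fun p hp => hp.isPrime] with x hx
  exact eq_zero_of_smul_eq_zero h hx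

theorem eventually_comap (V : Submodule A X) : ∃ S : Submodule A X, ∀ᶠ y in genF A,
    V.comap (LinearMap.lsmul A X y) = S ∧ S.comap (LinearMap.lsmul A X y) = S := by
  refine ⟨(gam (A := A) (X ⧸ V)).comap V.mkQ, ?_⟩
  obtain ⟨k, hk⟩ := exists_pow_smul_gam (A := A) (X := X ⧸ V)
  filter_upwards [eventually_mem_pow k, eventually_regular (gam_quotient_gam (A := A) (X := X ⧸ V))]
    with y hy hy'
  have h1 : ∀ u : X ⧸ V, y • u ∈ gam (A := A) (X ⧸ V) → u ∈ gam (A := A) (X ⧸ V) := fun u hu => by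
    rw [← Submodule.Quotient.mk_eq_zero] at hu ⊢
    exact hy' _ hu
  constructor
  · ext u
    simp only [Submodule.mem_comap, LinearMap.lsmul_apply]
    rw [← Submodule.Quotient.mk_eq_zero, Submodule.Quotient.mk_smul]
    constructor
    · intro hu
      exact h1 _ (by rw [Submodule.mkQ_apply, hu]; exact Submodule.zero_mem _)
    · intro hu
      exact hk y hy _ hu
  · ext u
    simp only [Submodule.mem_comap, LinearMap.lsmul_apply, map_smul]
    exact ⟨h1 _, Submodule.smul_mem _ _⟩

/-- A property of lists holds for generic choices of their `r` elements, one after the other. -/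
def EvG (A : Type) [CommRing A] [IsLocalRing A] : ℕ → (List A → Prop) → Prop
  | 0, P => P []
  | r + 1, P => ∀ᶠ x in genF A, EvG A r fun l => P (x :: l)

theorem EvG.mono {r : ℕ} {P P' : List A → Prop} (h : EvG A r P) (hP : ∀ l, P l → P' l) :
    EvG A r P' := by
  induction r generalizing P P' with
  | zero => exact hP _ h
  | succ r ih => exact Eventually.mono h fun x hx => ih hx fun l => hP _

theorem EvG.and {r : ℕ} {P P' : List A → Prop} (h : EvG A r P) (h' : EvG A r P') :
    EvG A r fun l => P l ∧ P' l := by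
  induction r generalizing P P' with
  | zero => exact ⟨h, h'⟩
  | succ r ih =>
    refine Eventually.mono (Eventually.and h h') fun x hx => ih hx.1 hx.2

theorem EvG.length (r : ℕ) : EvG A r fun l => l.length = r := by
  induction r with
  | zero => exact rfl
  | succ r ih => exact Eventually.of_forall fun x => ih.mono fun l hl => by simp [hl]

theorem EvG.forall_mem {r : ℕ} {P : A → Prop} (h : ∀ᶠ x in genF A, P x) :
    EvG A r fun l => ∀ y ∈ l, P y := by
  induction r with
  | zero => exact fun y hy => by simp at hy
  | succ r ih => exact h.mono fun x hx => ih.mono fun l hl => by simpa using ⟨hx, hl⟩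

theorem EvG.DS (r : ℕ) (V : Submodule A X) : EvG A r (DS X V) := by
  induction r generalizing V with
  | zero => exact trivial
  | succ r ih =>
    obtain ⟨S, hS⟩ := eventually_comap V
    refine hS.mono fun x hx => ?_
    refine ((EvG.forall_mem hS).and (ih (V ⊔ Ideal.span {x} • ⊤))).mono fun l hl => ?_
    exact ⟨⟨S, by simpa using ⟨hx, hl.1⟩⟩, hl.2⟩

theorem EvG.PL {r : ℕ} (h : DL A (r + 1) X) : EvG A r fun l => PL l X := by
  induction r generalizing X with
  | zero =>
    refine ⟨by simp, ?_⟩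
    rw [hf_one, Ideal.ofList_nil, Submodule.bot_smul,
      (Submodule.quotEquivOfEqBot (⊥ : Submodule A X) rfl).length_eq]
    exact h.length_ne_top
  | succ r ih =>
    filter_upwards [eventually_mem, eventually_DL h (by omega)] with x hx hx'
    exact (ih hx').mono fun l hl => PL.cons hx hl

end Generic

end LocalCoh

namespace LocalCoh

open Filter

section CosetAvoidance

/-- Prime avoidance for cosets of ideals. -/
theorem exists_add_notMem {A : Type} [CommRing A] {S : Set (Ideal A)} (hS : S.Finite)
    (hp : ∀ p ∈ S, p.IsPrime) {Q : Ideal A} {x : A} (hQ : ∀ p ∈ S, ¬ Ideal.span {x} ⊔ Q ≤ p) :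
    ∃ a ∈ Q, ∀ p ∈ S, x + a ∉ p := by
  obtain ⟨F, hF⟩ : ∃ F : Finset (Ideal A), ∀ p, p ∈ F ↔
      p ∈ S ∧ x ∉ p ∧ ∀ q ∈ S, x ∈ q → ¬ p ≤ q :=
    ⟨(hS.subset (Set.sep_subset S fun p => x ∉ p ∧ ∀ q ∈ S, x ∈ q → ¬ p ≤ q)).toFinset,
      fun p => by rw [Set.Finite.mem_toFinset]; rfl⟩
  obtain ⟨a, ha, ha'⟩ := exists_mem_forall_notMem (S := {p ∈ S | x ∈ p}) (Q := Q * F.prod id)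
    (hS.subset (Set.sep_subset _ _)) (fun p h => hp p h.1) fun q hq hle => by
      have := hp q hq.1
      rcases (Ideal.IsPrime.mul_le this).1 hle with h | h
      · exact hQ q hq.1 (sup_le ((Ideal.span_singleton_le_iff_mem _).2 hq.2) h)
      · obtain ⟨p, hpT, hpq⟩ := (Ideal.IsPrime.prod_le this).1 h
        exact ((hF p).1 hpT).2.2 q hq.1 hq.2 hpq
  have key : ∀ q ∈ S, x ∈ q → x + a ∉ q := fun q hq hxq h => ha' q ⟨hq, hxq⟩ (by
    simpa using q.sub_mem h hxq)
  refine ⟨a, Ideal.mul_le_left ha, fun p hpS hmem => ?_⟩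
  by_cases hx : x ∈ p
  · exact key p hpS hx hmem
  · by_cases hq : ∃ q ∈ S, x ∈ q ∧ p ≤ q
    · obtain ⟨q, hq, hxq, hpq⟩ := hq
      exact key q hq hxq (hpq hmem)
    · have h1 : p ∈ F := (hF p).2 ⟨hpS, hx, fun q hq' hxq hpq => hq ⟨q, hq', hxq, hpq⟩⟩
      have h2 : F.prod id ≤ p := Ideal.prod_le_inf.trans (Finset.inf_le (f := id) h1)
      have h3 : a ∈ p := h2 (Ideal.mul_le_right ha)
      exact hx (by simpa using p.sub_mem hmem h3)

end CosetAvoidance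

section LowerBound

variable {A : Type} [CommRing A] [IsLocalRing A] [IsNoetherianRing A]
variable {X : Type} [AddCommGroup X] [Module A X] [Module.Finite A X]

theorem length_ker_ne_top {x : A}
    (hx : ∀ p ∈ associatedPrimes A (X ⧸ gam (A := A) X), p ≠ maximalIdeal A → x ∉ p) :
    Module.length A (LinearMap.ker (LinearMap.lsmul A X x)) ≠ ⊤ := by
  have h1 : LinearMap.ker (LinearMap.lsmul A X x) ≤ gam (A := A) X := fun u hu => by
    rw [LinearMap.mem_ker, LinearMap.lsmul_apply] at hu
    rw [← Submodule.Quotient.mk_eq_zero]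
    refine eq_zero_of_smul_eq_zero gam_quotient_gam hx _ ?_
    rw [← Submodule.Quotient.mk_smul, hu, Submodule.Quotient.mk_zero]
  exact ne_top_of_le_ne_top length_gam_ne_top
    (Module.length_le_of_injective _ (Submodule.inclusion_injective h1))

theorem gam_submodule_eq_top {V : Submodule A X} (h : Module.length A V ≠ ⊤) :
    gam (A := A) V = ⊤ := by
  obtain ⟨k, hk⟩ := exists_pow_smul_eq_bot_of_length h
  exact gam_eq_top_of_pow_smul hk

theorem exists_length_ker_ne_top {x : A} {l : List A} (h : PL (x :: l) X) :
    ∃ a ∈ Ideal.ofList l,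
      Module.length A (LinearMap.ker (LinearMap.lsmul A X (x + a))) ≠ ⊤ := by
  obtain ⟨a, ha, ha'⟩ := exists_add_notMem (x := x) (Q := Ideal.ofList l)
    (S := {p ∈ associatedPrimes A (X ⧸ gam (A := A) X) | p ≠ maximalIdeal A})
    ((associatedPrimes.finite A _).subset (Set.sep_subset _ _)) (fun p hp => hp.1.isPrime)
    fun p hp hle => by
      have h1 := hp.1.isPrime
      obtain ⟨k, hk⟩ := exists_pow_le_sup_annihilator
        (h.quotient (gam (A := A) X)).2
      refine not_pow_le_of_ne hp.2 k (hk.trans (sup_le ?_ (by simpa [Submodule.annihilator_top] using hp.1.annihilator_le)))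
      rwa [Ideal.ofList_cons]
  exact ⟨a, ha, length_ker_ne_top fun p hp hpm => ha' p ⟨hp, hpm⟩⟩

theorem PL.e1_eq_of_ofList_eq {l l' : List A} (h : PL l X) (hl : 1 ≤ l.length)
    (hll : l'.length = l.length) (hI : Ideal.ofList l' = Ideal.ofList l) : e1 l' X = e1 l X := by
  obtain ⟨s, hs, -⟩ := h.exists_HC
  rw [hs.e1_eq hl]
  rw [← hll, ← hI] at hs
  exact hs.e1_eq (hll ▸ hl)

theorem hl_quotient_ker_le {x : A} (hx : Module.length A (LinearMap.ker (LinearMap.lsmul A X x)) ≠ ⊤)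
    (i : ℕ) : hl A (i + 1) (X ⧸ LinearMap.ker (LinearMap.lsmul A X x)) ≤ hl A (i + 1) X := by
  have := hl_right_le (LinearMap.ker (LinearMap.lsmul A X x)).subtype_injective
    (Submodule.mkQ_surjective _) (LinearMap.exact_subtype_mkQ _) (i + 1)
  rwa [hl_of_torsion (gam_submodule_eq_top hx), add_zero] at this

/-- The sequence `0 → X / (0 : x) → X → X / x X → 0`. -/
theorem exists_exact_quo (x : A) : ∃ f : (X ⧸ LinearMap.ker (LinearMap.lsmul A X x)) →ₗ[A] X,
    Function.Injective f ∧ Function.Exact f (LinearMap.range (LinearMap.lsmul A X x)).mkQ := by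
  refine ⟨(LinearMap.ker (LinearMap.lsmul A X x)).liftQ (LinearMap.lsmul A X x) le_rfl, ?_, ?_⟩
  · rw [← LinearMap.ker_eq_bot]
    exact Submodule.ker_liftQ_eq_bot _ _ _ le_rfl
  · rw [LinearMap.exact_iff, Submodule.ker_mkQ, Submodule.range_liftQ]

theorem hl_quo_le {x : A} (hx : Module.length A (LinearMap.ker (LinearMap.lsmul A X x)) ≠ ⊤)
    (i : ℕ) : hl A i (Quo x X) ≤ hl A i X + hl A (i + 1) X := by
  obtain ⟨f, hf, hfe⟩ := exists_exact_quo (X := X) x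
  exact (hl_right_le hf (Submodule.mkQ_surjective _) hfe i).trans
    (add_le_add le_rfl (hl_quotient_ker_le hx i))

theorem length_gam_quo_le {x : A}
    (hx : Module.length A (LinearMap.ker (LinearMap.lsmul A X x)) ≠ ⊤) :
    Module.length A (gam (A := A) (Quo x X)) ≤
      Module.length A (LinearMap.ker (LinearMap.lsmul A X x)) + hl A 1 X := by
  obtain ⟨f, hf, hfe⟩ := exists_exact_quo (X := X) x
  have h1 := hl_zero_right_le hf (Submodule.mkQ_surjective _) hfe
  have h2 := hl_mid_le (LinearMap.ker (LinearMap.lsmul A X x)).subtype_injective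
    (Submodule.mkQ_surjective _) (LinearMap.exact_subtype_mkQ _) 0
  have h3 := hl_quotient_ker_le hx 0
  have h4 : hl A 0 (LinearMap.ker (LinearMap.lsmul A X x)) =
      Module.length A (LinearMap.ker (LinearMap.lsmul A X x)) := by
    rw [hl_zero_eq, gam_submodule_eq_top hx, Module.length_top]
  have h5 : hl A 0 (X ⧸ LinearMap.ker (LinearMap.lsmul A X x)) ≠ ⊤ := by
    rw [hl_zero_eq]
    exact length_gam_ne_top
  rw [← hl_zero_eq, ← h4]
  have h6 := h1.trans (add_le_add h2 h3)
  rw [add_comm (hl A 0 (LinearMap.ker (LinearMap.lsmul A X x))), add_assoc] at h6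
  exact (ENat.add_le_add_iff_left h5).1 h6

theorem sum_choose_pascal (s : ℕ) (h : ℕ → ℤ) :
    ∑ i ∈ Finset.range (s + 1), (s.choose i : ℤ) * (h i + h (i + 1)) =
      ∑ i ∈ Finset.range (s + 2), ((s + 1).choose i : ℤ) * h i := by
  rw [Finset.sum_range_succ' _ (s + 1)]
  simp only [Nat.choose_succ_succ, Nat.choose_zero_right, mul_add, Nat.cast_add, add_mul,
    Finset.sum_add_distrib, Nat.cast_one]
  rw [Finset.sum_range_succ' (fun i => (s.choose i : ℤ) * h i) s,
    Finset.sum_range_succ (fun i => (s.choose (i + 1) : ℤ) * h (i + 1)) s]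
  simp only [Nat.choose_succ_self, Nat.choose_zero_right]
  push_cast
  ring

/-- The lower bound for the first Hilbert coefficient in terms of local cohomology. -/
theorem PL.le_e1 {l : List A} (h : PL l X) {s : ℕ} (hl2 : l.length = s + 2) {b : ℕ → ℕ}
    (hb : ∀ i ≤ s, hl A (i + 1) X ≤ b i) :
    -∑ i ∈ Finset.range (s + 1), (s.choose i : ℤ) * b i ≤ e1 l X := by
  induction s generalizing X l b with
  | zero =>
    obtain ⟨x, y, rfl⟩ := List.length_eq_two.1 hl2
    obtain ⟨a, ha, hx⟩ := exists_length_ker_ne_top h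
    have hI : Ideal.ofList [x + a, y] = Ideal.ofList [x, y] := by
      rw [Ideal.ofList_cons, span_add_sup ha, ← Ideal.ofList_cons]
    have h' : PL [x + a, y] X := ⟨hI ▸ h.1, hI ▸ h.2⟩
    rw [← h.e1_eq_of_ofList_eq (by simp) (by simp) hI]
    obtain ⟨c, hc⟩ := ENat.ne_top_iff_exists.1 hx
    have h1 := h'.e1_pair_ge hc.symm
    rw [h'.tail.e1_singleton] at h1
    have h2 := length_gam_quo_le hx
    have h3 := h2.trans (add_le_add le_rfl (hb 0 le_rfl))
    rw [← hc, ← Nat.cast_add] at h3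
    have h4 := ENat.toNat_le_of_le_natCast h3
    simp
    omega
  | succ s ih =>
    rcases l with _ | ⟨x, l⟩
    · simp at hl2
    obtain ⟨a, ha, hx⟩ := exists_length_ker_ne_top h
    have hI : Ideal.ofList ((x + a) :: l) = Ideal.ofList (x :: l) := by
      rw [Ideal.ofList_cons, span_add_sup ha, ← Ideal.ofList_cons]
    have h' : PL ((x + a) :: l) X := ⟨hI ▸ h.1, hI ▸ h.2⟩
    rw [← h.e1_eq_of_ofList_eq (by simp) (by simp) hI]
    have hls : l.length = s + 2 := by simpa using hl2
    refine le_trans ?_ (h'.e1_quo_le (by omega) hx)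
    have h2 := ih h'.tail hls (b := fun i => b i + b (i + 1)) fun i hi => by
      refine (hl_quo_le hx (i + 1)).trans ?_
      push_cast
      exact add_le_add (hb i (by omega)) (hb (i + 1) (by omega))
    rw [← sum_choose_pascal]
    simpa using h2

end LowerBound

end LocalCoh

namespace LocalCoh

open Filter Topology

section Growth

variable {A : Type} [CommRing A] [IsLocalRing A] [IsNoetherianRing A]
variable {X : Type} [AddCommGroup X] [Module A X] [Module.Finite A X]

theorem PL.zero_pos_singleton {x : A} (h : PL [x] X) (hX : ¬ LocalCoh.DL A 1 X) {s : ℕ → ℤ}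
    (hs : HC (Ideal.ofList [x]) X 1 s) : 0 < s 0 := by
  have h1 := h.quotient (gam (A := A) X)
  have hreg : ∀ u : X ⧸ gam (A := A) X, x • u = 0 → u = 0 := fun u hu => by
    have := mem_gam_of_smul_eq_zero h1.2 (u := u) fun y hy => by
      rw [Ideal.ofList_singleton] at hy
      obtain ⟨b, rfl⟩ := Ideal.mem_span_singleton'.1 hy
      rw [mul_smul, hu, smul_zero]
    rwa [gam_quotient_gam, Submodule.mem_bot] at this
  have hne : Nontrivial (X ⧸ gam (A := A) X) := by
    by_contra hsub
    rw [not_nontrivial_iff_subsingleton] at hsub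
    have htop : gam (A := A) X = ⊤ := Submodule.Quotient.subsingleton_iff.1 hsub
    refine hX (DL_one_iff_length.2 ?_)
    rw [← Module.length_top, ← htop]
    exact length_gam_ne_top
  have h2 : 1 ≤ hf (Ideal.span {x}) (X ⧸ gam (A := A) X) 1 := by
    rw [Order.one_le_iff_ne_zero, hf_one, Ne, Module.length_eq_zero_iff,
      Submodule.Quotient.subsingleton_iff]
    intro htop
    have := Submodule.eq_bot_of_le_smul_of_le_jacobson_bot (Ideal.span {x})
      (⊤ : Submodule A (X ⧸ gam (A := A) X)) Module.Finite.fg_top htop.ge (by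
        rw [IsLocalRing.jacobson_eq_maximalIdeal ⊥ bot_ne_top, Ideal.span_singleton_le_iff_mem]
        exact h.head_mem)
    exact bot_ne_top this.symm
  by_contra! hle
  obtain ⟨n, hn, hn'⟩ := (hs.and (eventually_ge_atTop (-s 1).toNat)).exists
  obtain ⟨l, hl, hl'⟩ := hn
  have h3 := hf_quotient_le (gam (A := A) X) (Ideal.span {x}) (n + 1)
  rw [← Ideal.ofList_singleton, hl, Ideal.ofList_singleton, hf_singleton_of_injective hreg] at h3
  have h4 : ((n + 1 : ℕ) : ℕ∞) ≤ l := by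
    refine le_trans ?_ h3
    calc ((n + 1 : ℕ) : ℕ∞) = (n + 1 : ℕ) * 1 := (mul_one _).symm
      _ ≤ _ := by gcongr
  have h5 : n + 1 ≤ l := by exact_mod_cast h4
  rw [bsum_succ', bsum_zero] at hl'
  have h6 : s 0 * ((n + (0 + 1)).choose (0 + 1) : ℤ) ≤ 0 :=
    mul_nonpos_of_nonpos_of_nonneg hle (Nat.cast_nonneg _)
  simp only [zero_add] at *
  omega

/-- The multiplicity of a module of full dimension is positive. -/
theorem PL.zero_pos {l : List A} (h : PL l X) (hl : 1 ≤ l.length) (hX : ¬ LocalCoh.DL A l.length X)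
    {s : ℕ → ℤ} (hs : HC (Ideal.ofList l) X l.length s) : 0 < s 0 := by
  induction l generalizing X s with
  | nil => simp at hl
  | cons x l ih =>
    rcases l with _ | ⟨y, l⟩
    · exact h.zero_pos_singleton hX hs
    · obtain ⟨a, ha, hx⟩ := exists_length_ker_ne_top h
      have hI : Ideal.ofList ((x + a) :: y :: l) = Ideal.ofList (x :: y :: l) := by
        rw [Ideal.ofList_cons, span_add_sup ha, ← Ideal.ofList_cons]
      have h' : PL ((x + a) :: y :: l) X := ⟨hI ▸ h.1, hI ▸ h.2⟩
      rw [← hI] at hs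
      obtain ⟨t, ht, -⟩ := h'.tail.exists_HC
      rw [zero_eq_of_HC h' (by simp) hx ht hs]
      exact ih h'.tail (by simp) (fun hd => hX (hd.of_quo h'.head_mem)) ht

theorem exists_hf_le_ix (V : Submodule A X) : ∃ c, ∀ (J Q : Ideal A) (a k n : ℕ),
    1 ≤ a → maximalIdeal A ^ a ≤ J ⊔ Module.annihilator A V → Q ≤ maximalIdeal A ^ (a * k) →
    hf J V (k * n - c) ≤ ix (Q ^ n • (⊤ : Submodule A X)) V := by
  obtain ⟨c, hc⟩ := Ideal.exists_pow_inf_eq_pow_smul (maximalIdeal A) V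
  refine ⟨c, fun J Q a k n ha hJ hQ => ?_⟩
  have h1 : Q ^ n • (⊤ : Submodule A X) ⊓ V ≤ maximalIdeal A ^ (a * (k * n - c)) • V := by
    rcases le_total (k * n) c with hkn | hkn
    · simp [Nat.sub_eq_zero_of_le hkn]
    · have h3 : Q ^ n ≤ maximalIdeal A ^ (a * (k * n)) := by
        rw [← mul_assoc, pow_mul]
        exact Ideal.pow_right_mono hQ n
      have h4 : k * n ≤ a * (k * n) := Nat.le_mul_of_pos_left _ ha
      refine (inf_le_inf_right V (Submodule.smul_mono h3 le_rfl)).trans ?_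
      rw [hc _ (hkn.trans h4)]
      refine Submodule.smul_mono (Ideal.pow_le_pow_right ?_) inf_le_right
      rw [Nat.mul_sub]
      exact Nat.sub_le_sub_left (Nat.le_mul_of_pos_left _ ha) _
  have h2 : ∀ j, maximalIdeal A ^ (a * j) • V ≤ J ^ j • V := fun j => by
    induction j with
    | zero => simp
    | succ j ih =>
      rw [Nat.mul_succ, pow_add, mul_comm, mul_smul, pow_succ, mul_smul]
      refine (Submodule.smul_mono le_rfl ih).trans ?_
      rw [← mul_smul, mul_comm, mul_smul]
      refine Submodule.smul_mono le_rfl ?_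
      refine (Submodule.smul_mono hJ le_rfl).trans ?_
      rw [Submodule.sup_smul]
      refine sup_le le_rfl (Submodule.smul_le.2 fun b hb u hu => ?_)
      have := Module.mem_annihilator.1 hb ⟨u, hu⟩
      have h3 : b • u = 0 := congrArg Subtype.val this
      rw [h3]
      exact Submodule.zero_mem _
  rw [hf, ix, LinearEquiv.length_eq (LinearMap.quotKerEquivRange _).symm,
    ker_mkQ_comp_subtype]
  refine Module.length_le_of_surjective (Submodule.factor ?_) (Submodule.factor_surjective _)
  have h3 : (J ^ (k * n - c) • (⊤ : Submodule A V)).map V.subtype = J ^ (k * n - c) • V := by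
    rw [Submodule.map_smul'', Submodule.map_top, Submodule.range_subtype]
  rw [← Submodule.comap_map_eq_of_injective V.subtype_injective (J ^ (k * n - c) • ⊤), h3]
  exact fun u hu => h2 _ (h1 ⟨hu, u.2⟩)

theorem hf_ne_top_of_pow_le {k : ℕ} {Q : Ideal A}
    (h : maximalIdeal A ^ k ≤ Q ⊔ Module.annihilator A X) : hf Q X 1 ≠ ⊤ := by
  rw [hf_one]
  refine length_ne_top_of_pow_smul (k := k) ?_
  rw [eq_bot_iff, Submodule.smul_le]
  rintro a ha u -
  obtain ⟨u, rfl⟩ := Submodule.mkQ_surjective _ u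
  rw [Submodule.mem_bot, ← map_smul, Submodule.mkQ_apply, Submodule.Quotient.mk_eq_zero]
  obtain ⟨b, hb, c, hc, rfl⟩ := Submodule.mem_sup.1 (h ha)
  rw [add_smul, Module.mem_annihilator.1 hc, add_zero]
  exact Submodule.smul_mem_smul hb trivial

theorem PL.submodule {l : List A} (h : PL l X) (V : Submodule A X) : PL l V := by
  obtain ⟨k, hk⟩ := exists_pow_le_sup_annihilator h.2
  refine ⟨h.1, hf_ne_top_of_pow_le (hk.trans (sup_le_sup_left ?_ _))⟩
  exact LinearMap.annihilator_le_of_injective V.subtype V.subtype_injective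

/-- A submodule of codimension one makes the first coefficients unbounded. -/
theorem exists_e1_lt_of_submodule {d : ℕ} (hd : 1 ≤ d) (h : LocalCoh.DL A (d + 2) X)
    (V : Submodule A X) (hV : LocalCoh.DL A (d + 1) V) (hV' : ¬ LocalCoh.DL A d V) (B : ℕ) :
    ∃ l : List A, l.length = d + 1 ∧ PL l X ∧ e1 l X < -B := by
  obtain ⟨l₀, hl₀, hV₀⟩ := exists_PL_of_DL hV
  obtain ⟨v, hv, -⟩ := hV₀.exists_HC
  have hvpos := hV₀.zero_pos (by omega) (hl₀ ▸ hV') hv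
  obtain ⟨a, ha⟩ := exists_pow_le_sup_annihilator hV₀.2
  obtain ⟨c, hc⟩ := exists_hf_le_ix V
  obtain ⟨l, hl, hlQ, hlf⟩ := exists_list_of_DL h
    (Q := maximalIdeal A ^ ((a + 1) * (B + 1))) (hf_ne_top_of_pow_le le_sup_left)
  have hPL : PL l X := ⟨hlQ.trans (Ideal.pow_le_self (by positivity)), hlf⟩
  refine ⟨l, hl, hPL, ?_⟩
  obtain ⟨l', hl', hlQ', hlf'⟩ := exists_list_of_DL hV (Q := Ideal.ofList l) (hPL.submodule V).2
  obtain ⟨s, hs, -⟩ := hPL.exists_HC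
  obtain ⟨t, ht, ht1⟩ := (hPL.quotient V).exists_HC
  have h0 := hs.zero_eq_quotient V hlQ' hlf' (by omega) ht
  rw [hs.e1_eq (by omega)]
  rw [hl] at hs ht ht1
  rw [hl₀] at hv
  have hu' : Tendsto (fun n => (B + 1) * (n + 1) - c - 1) atTop atTop := by
    refine tendsto_atTop_mono (f := fun n => n + 1 - c - 1) (fun n => ?_) ?_
    · have : n + 1 ≤ (B + 1) * (n + 1) := Nat.le_mul_of_pos_left _ (by omega)
      omega
    · refine tendsto_atTop_atTop.2 fun b => ⟨b + c, fun n hn => by omega⟩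
  have hu : Tendsto (fun n => (((B + 1) * (n + 1) - c - 1 : ℕ) : ℝ) / n) atTop (𝓝 (B + 1 : ℝ)) := by
    have h1 : Tendsto (fun n : ℕ => (B + 1 : ℝ) + ((B : ℝ) - c) / n) atTop (𝓝 (B + 1 : ℝ)) := by
      simpa using (tendsto_const_div_atTop_nhds_zero_nat ((B : ℝ) - c)).const_add (B + 1 : ℝ)
    refine h1.congr' ?_
    filter_upwards [eventually_ge_atTop (c + 1)] with n hn
    have h2 : n + 1 ≤ (B + 1) * (n + 1) := Nat.le_mul_of_pos_left _ (by omega)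
    have hn0 : (n : ℝ) ≠ 0 := by
      have : n ≠ 0 := by omega
      exact_mod_cast this
    rw [Nat.sub_sub, Nat.cast_sub (by omega), eq_div_iff hn0]
    push_cast
    field_simp
    ring
  have key : ∀ᶠ n in atTop, bsum d v ((B + 1) * (n + 1) - c - 1) ≤
      bsum d (fun i => t (i + 1) - s (i + 1)) n := by
    filter_upwards [hs, ht, hu'.eventually hv, hu'.eventually (eventually_ge_atTop 1)] with n
      ⟨p, hp, hp'⟩ ⟨q, hq, hq'⟩ ⟨w, hw, hw'⟩ hn
    have h1 := hc (Ideal.ofList l₀) (Ideal.ofList l) (a + 1) (B + 1) (n + 1) (by omega)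
      ((Ideal.pow_le_pow_right (by omega)).trans ha) hlQ
    have h2 : (B + 1) * (n + 1) - c - 1 + 1 = (B + 1) * (n + 1) - c := by omega
    rw [h2] at hw
    rw [hw] at h1
    have h3 := hf_eq_add V (Ideal.ofList l) (n + 1)
    rw [hp, hq] at h3
    have h4 : (w : ℕ∞) + q ≤ p := by rw [h3]; gcongr
    have h5 : w + q ≤ p := by exact_mod_cast h4
    have h6 : bsum (d + 1) s n - bsum (d + 1) t n = bsum d (fun i => t (i + 1) - s (i + 1)) n := by
      rw [bsum_succ', bsum_succ', h0]
      have := bsum_add d (fun i => t (i + 1) - s (i + 1)) (fun i => s (i + 1)) n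
      simp only [sub_add_cancel] at this
      linarith
    rw [← h6, ← hw', ← hp', ← hq']
    omega
  have h1 := le_of_tendsto_of_tendsto (tendsto_bsum_div d v hu hu')
    (tendsto_bsum_div_self d fun i => t (i + 1) - s (i + 1)) (by
      filter_upwards [key] with n hn
      have : ((bsum d v ((B + 1) * (n + 1) - c - 1) : ℤ) : ℝ) ≤
        (bsum d (fun i => t (i + 1) - s (i + 1)) n : ℤ) := by exact_mod_cast hn
      gcongr)
  rw [mul_div_assoc', div_le_div_iff_of_pos_right (by positivity)] at h1
  have h2 : v 0 * (B + 1 : ℤ) ^ d ≤ t (0 + 1) - s (0 + 1) := by exact_mod_cast h1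
  have h3 : (B + 1 : ℤ) ≤ (B + 1 : ℤ) ^ d := le_self_pow₀ (by omega) (by omega)
  have h4 : (B + 1 : ℤ) ^ d ≤ v 0 * (B + 1 : ℤ) ^ d := le_mul_of_one_le_left (by positivity) hvpos
  have h5 := ht1 (by omega)
  simp only [zero_add] at h2
  omega

end Growth

end LocalCoh

namespace LocalCoh

open Filter

section Chevalley

variable {A : Type} [CommRing A] [IsLocalRing A] [IsNoetherianRing A]
variable {T : Type} [AddCommGroup T] [Module A T] [Module.Finite A T]

theorem isPrecomplete_of_finite [IsAdicComplete (maximalIdeal A) A] :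
    IsPrecomplete (maximalIdeal A) T := by
  rw [← AdicCompletion.of_surjective_iff]
  intro t
  obtain ⟨z, rfl⟩ := AdicCompletion.ofTensorProduct_surjective_of_finite (maximalIdeal A) T t
  induction z with
  | zero => exact ⟨0, by simp⟩
  | add x y hx hy =>
    obtain ⟨a, ha⟩ := hx
    obtain ⟨b, hb⟩ := hy
    exact ⟨a + b, by rw [map_add, map_add, ha, hb]⟩
  | tmul a x =>
    obtain ⟨b, rfl⟩ := AdicCompletion.of_surjective (maximalIdeal A) A a
    refine ⟨b • x, ?_⟩
    rw [AdicCompletion.ofTensorProduct_tmul]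
    ext n
    simp
    rfl

theorem mem_of_forall_mem_sup_pow {F : Submodule A T} {u : T}
    (h : ∀ n : ℕ, u ∈ F ⊔ maximalIdeal A ^ n • (⊤ : Submodule A T)) : u ∈ F := by
  rw [← Submodule.Quotient.mk_eq_zero]
  refine IsHausdorff.haus (inferInstance : IsHausdorff (maximalIdeal A) (T ⧸ F)) _ fun n => ?_
  rw [SModEq.zero]
  obtain ⟨a, ha, b, hb, rfl⟩ := Submodule.mem_sup.1 (h n)
  have h1 : (Submodule.Quotient.mk (a + b) : T ⧸ F) = F.mkQ b := by
    rw [Submodule.Quotient.mk_add, (Submodule.Quotient.mk_eq_zero F).2 ha, zero_add]; rfl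
  rw [h1]
  have h2 := Submodule.mem_map_of_mem (f := F.mkQ) hb
  rw [Submodule.map_smul''] at h2
  exact Submodule.smul_mono le_rfl le_top h2

theorem length_quotient_pow_smul_ne_top (j : ℕ) :
    Module.length A (T ⧸ (maximalIdeal A ^ j • (⊤ : Submodule A T))) ≠ ⊤ := by
  refine length_ne_top_of_pow_smul (k := j) ?_
  rw [← Submodule.range_mkQ (maximalIdeal A ^ j • (⊤ : Submodule A T)), LinearMap.range_eq_map,
    ← Submodule.map_smul'', ← le_bot_iff, Submodule.map_le_iff_le_comap]
  intro u hu
  simpa using hu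

theorem exists_le_pow_smul [IsAdicComplete (maximalIdeal A) A] {F : ℕ → Submodule A T}
    (hF : Antitone F) (h0 : ⨅ k, F k = ⊥) (j : ℕ) :
    ∃ k, F k ≤ maximalIdeal A ^ j • (⊤ : Submodule A T) := by
  obtain ⟨P, hPd⟩ : ∃ P : ℕ → Submodule A T, P = fun j => maximalIdeal A ^ j • ⊤ := ⟨_, rfl⟩
  have hP : Antitone P := fun a b hab => by
    rw [hPd]
    exact Submodule.smul_mono_left (Ideal.pow_le_pow_right hab)
  have hst : ∀ j, ∃ K, ∀ k, F K ⊔ P j ≤ F k ⊔ P j := by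
    intro j
    have := Module.length_ne_top_iff.1 (hPd ▸ length_quotient_pow_smul_ne_top (A := A) (T := T) j :
      Module.length A (T ⧸ P j) ≠ ⊤)
    have : IsArtinian A (T ⧸ P j) := (isFiniteLength_iff_isNoetherian_isArtinian.1 this).2
    obtain ⟨K, hK⟩ := IsArtinian.monotone_stabilizes (R := A) (M := T ⧸ P j)
      ⟨fun k => OrderDual.toDual ((F k).map (P j).mkQ), fun a b hab => Submodule.map_mono (hF hab)⟩
    refine ⟨K, fun k => ?_⟩
    rcases le_total k K with h | h
    · exact sup_le_sup_right (hF h) _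
    · have h1 : (F K).map (P j).mkQ = (F k).map (P j).mkQ := hK k h
      have h2 := congrArg (Submodule.comap (P j).mkQ) h1
      rw [Submodule.comap_map_mkQ, Submodule.comap_map_mkQ, sup_comm, sup_comm _ (F k)] at h2
      exact h2.le
  choose K hK using hst
  have hstep : ∀ i, ∀ u ∈ F (K i) ⊔ P i, ∃ w ∈ F (K (i + 1)) ⊔ P (i + 1), w - u ∈ P i := by
    intro i u hu
    obtain ⟨a, ha, b, hb, rfl⟩ := Submodule.mem_sup.1 (hK i (K (i + 1)) hu)
    exact ⟨a, Submodule.mem_sup_left ha, by simpa using hb⟩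
  by_contra! hne
  obtain ⟨u₀, hu₀, hu₀'⟩ := SetLike.not_le_iff_exists.1 (hne (K j))
  choose! w hw hw' using hstep
  obtain ⟨u, hu0, hus⟩ : ∃ u : ℕ → T, u 0 = u₀ ∧ ∀ n, u (n + 1) = w (j + n) (u n) :=
    ⟨fun n => n.rec u₀ fun n v => w (j + n) v, rfl, fun _ => rfl⟩
  have hu : ∀ n, u n ∈ F (K (j + n)) ⊔ P (j + n) := by
    intro n
    induction n with
    | zero => exact hu0 ▸ Submodule.mem_sup_left hu₀
    | succ n ih => exact hus n ▸ hw (j + n) _ ih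
  have hu' : ∀ n, u (n + 1) - u n ∈ P (j + n) := fun n => hus n ▸ hw' (j + n) _ (hu n)
  have hcau : ∀ {a b : ℕ}, a ≤ b → u b - u a ∈ P (j + a) := by
    intro a b hab
    induction b, hab using Nat.le_induction with
    | base => simp
    | succ b hab ih =>
      have := add_mem (hP (by omega) (hu' b)) ih
      simpa using this
  obtain ⟨L, hL⟩ := (isPrecomplete_of_finite (A := A) (T := T)).prec (f := u) fun {a b} hab => by
    rw [SModEq.comm, SModEq.sub_mem]
    change _ ∈ (fun j => maximalIdeal A ^ j • (⊤ : Submodule A T)) a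
    rw [← hPd]
    exact hP (by omega) (hcau hab)
  have hL' : ∀ n, u n - L ∈ P n := fun n => hPd ▸ SModEq.sub_mem.1 (hL n)
  have hL0 : L ∈ ⨅ k, F k := by
    rw [Submodule.mem_iInf]
    refine fun k => mem_of_forall_mem_sup_pow fun n => ?_
    change _ ∈ F k ⊔ (fun j => maximalIdeal A ^ j • (⊤ : Submodule A T)) n
    rw [← hPd]
    have h1 : u n ∈ F k ⊔ P n := (hK (j + n) k).trans (sup_le_sup_left (hP (by omega)) _) (hu n)
    have := sub_mem h1 (Submodule.mem_sup_right (S := F k) (hL' n))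
    simpa using this
  rw [h0, Submodule.mem_bot] at hL0
  have h1 := hL' j
  rw [hL0, sub_zero] at h1
  have h2 := sub_mem h1 (hcau (Nat.zero_le j))
  rw [sub_sub_cancel, hu0] at h2
  rw [hPd] at h2
  exact hu₀' h2

/-- A bound on the lengths of the quotients by `K ⊔ F k`, with `F` an exhausting decreasing
sequence, bounds the length of the quotient by `K`. -/
theorem length_quotient_le_of_antitone [IsAdicComplete (maximalIdeal A) A] {F : ℕ → Submodule A T}
    (hF : Antitone F) (h0 : ⨅ k, F k = ⊥) (K : Submodule A T) {B : ℕ∞} {k₀ : ℕ}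
    (h : ∀ k ≥ k₀, Module.length A (T ⧸ (K ⊔ F k)) ≤ B) : Module.length A (T ⧸ K) ≤ B := by
  rcases eq_or_ne B ⊤ with rfl | hB
  · exact le_top
  have h1 : ∀ j, hf (maximalIdeal A) (T ⧸ K) j ≤ B := by
    intro j
    obtain ⟨k, hk⟩ := exists_le_pow_smul hF h0 j
    rw [hf_quotient]
    refine le_trans ?_ (h (max k k₀) (le_max_right _ _))
    have h2 : K ⊔ F (max k k₀) ≤ maximalIdeal A ^ j • (⊤ : Submodule A T) ⊔ K :=
      sup_le le_sup_right (le_sup_of_le_left ((hF (le_max_left _ _)).trans hk))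
    exact Module.length_le_of_surjective (Submodule.factor h2) (Submodule.factor_surjective _)
  obtain ⟨j, hj⟩ : ∃ j, ix (maximalIdeal A ^ (j + 1) • (⊤ : Submodule A (T ⧸ K)))
      (maximalIdeal A ^ j • (⊤ : Submodule A (T ⧸ K))) = 0 := by
    by_contra! hne
    have h3 : ∀ j : ℕ, (j : ℕ∞) ≤ hf (maximalIdeal A) (T ⧸ K) j := by
      intro j
      induction j with
      | zero => simp
      | succ j ih =>
        rw [hf_succ, Nat.cast_succ, add_comm]
        exact add_le_add (Order.one_le_iff_ne_zero.2 (hne j)) ih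
    refine hB (top_le_iff.1 (ENat.forall_natCast_le_iff_le.1 fun a _ => (h3 a).trans (h1 a)))
  have h2 : maximalIdeal A ^ j • (⊤ : Submodule A (T ⧸ K)) = ⊥ := by
    refine Submodule.eq_bot_of_le_smul_of_le_jacobson_bot (maximalIdeal A) _
      (IsNoetherian.noetherian _) ?_ (IsLocalRing.jacobson_eq_maximalIdeal ⊥ bot_ne_top).ge
    rw [← Submodule.mul_smul, ← pow_succ']
    rw [ix, Module.length_eq_zero_iff, range_mkQ_comp_subtype, Submodule.subsingleton_iff_eq_bot,
      ← le_bot_iff, Submodule.map_le_iff_le_comap, Submodule.comap_bot, Submodule.ker_mkQ] at hj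
    exact hj
  have h3 := h1 j
  rw [hf, h2, (Submodule.quotEquivOfEqBot _ rfl).length_eq] at h3
  exact h3

end Chevalley

end LocalCoh

namespace LocalCoh

open Filter

section Over

variable {A : Type} [CommRing A]
variable {X Y Z : Type} [AddCommGroup X] [Module A X] [AddCommGroup Y] [Module A Y]
  [AddCommGroup Z] [Module A Z]

theorem DL.of_ker_le {d : ℕ} {f : X →ₗ[A] Y} {g : X →ₗ[A] Z}
    (h : DL A d (LinearMap.range f)) (hg : Function.Surjective g)
    (hfg : LinearMap.ker f ≤ LinearMap.ker g) : DL A d Z := by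
  have h1 : DL A d (X ⧸ LinearMap.ker f) := h.of_injective f.quotKerEquivRange.injective
  exact h1.of_surjective (f := (LinearMap.ker f).liftQ g hfg)
    (fun z => by obtain ⟨u, rfl⟩ := hg z; exact ⟨Submodule.Quotient.mk u, rfl⟩)

theorem DL.of_mul_le_annihilator [Module.Finite A X] [Module.Finite A Y] {d : ℕ}
    (hX : DL A d X) (hY : DL A d Y)
    (h : Module.annihilator A X * Module.annihilator A Y ≤ Module.annihilator A Z) : DL A d Z := by
  intro p hp
  rcases p.2.mul_le.1 (h.trans (Module.annihilator_le_of_mem_support hp)) with h1 | h1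
  · exact hX p (Module.mem_support_iff_of_finite.2 h1)
  · exact hY p (Module.mem_support_iff_of_finite.2 h1)

theorem le_low_of_map [IsNoetherianRing A] [Module.Finite A X] [Module.Finite A Y] {d : ℕ}
    (f : X →ₗ[A] Y) : (low A d X).map f ≤ low A d Y := by
  rw [le_low_iff]
  exact (DL_low d).of_surjective (f := f.submoduleMap (low A d X))
    (LinearMap.submoduleMap_surjective _ _)

/-- The preimage in `T` of the largest submodule of `T / y T` of dimension less than `d`. -/
def lowPre (d : ℕ) (y : A) (X : Type) [AddCommGroup X] [Module A X] : Submodule A X :=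
  (low A d (Quo y X)).comap (Submodule.mkQ _)

theorem range_le_lowPre {d : ℕ} {y : A} : LinearMap.range (LinearMap.lsmul A X y) ≤ lowPre d y X := by
  intro u hu
  rw [lowPre, Submodule.mem_comap, Submodule.mkQ_apply, (Submodule.Quotient.mk_eq_zero _).2 hu]
  exact zero_mem _

theorem lowPre_pow_antitone [IsNoetherianRing A] [Module.Finite A X] (d : ℕ) (x : A) :
    Antitone fun k => lowPre d (x ^ k) X := by
  intro a b hab u hu
  have h : LinearMap.range (LinearMap.lsmul A X (x ^ b)) ≤
      LinearMap.range (LinearMap.lsmul A X (x ^ a)) := by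
    rintro _ ⟨v, rfl⟩
    refine ⟨x ^ (b - a) • v, ?_⟩
    simp only [LinearMap.lsmul_apply]
    rw [smul_smul, ← pow_add, Nat.add_sub_cancel' hab]
  exact le_low_of_map (Submodule.factor h) ⟨_, hu, rfl⟩

theorem low_quotient_lowPre [IsNoetherianRing A] [Module.Finite A X] (d : ℕ) (y : A) :
    low A d (X ⧸ lowPre d y X) = ⊥ := by
  have hle : lowPre d y X ≤ (low A d (Quo y X)).comap (Submodule.mkQ _) := le_rfl
  refine low_eq_bot_of_injective (low_quotient_low (A := A) (X := Quo y X) d)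
    (f := Submodule.mapQ (lowPre d y X) (low A d (Quo y X)) (Submodule.mkQ _) hle) ?_
  rw [← LinearMap.ker_eq_bot, eq_bot_iff]
  intro u hu
  obtain ⟨u, rfl⟩ := Submodule.mkQ_surjective _ u
  rw [LinearMap.mem_ker, Submodule.mkQ_apply, Submodule.mapQ_apply,
    Submodule.Quotient.mk_eq_zero] at hu
  exact (Submodule.mem_bot A).2 ((Submodule.Quotient.mk_eq_zero _).2 hu)

theorem iInf_lowPre_pow [IsLocalRing A] [IsNoetherianRing A] [Module.Finite A X] {d : ℕ} {x : A}
    (hx : x ∈ maximalIdeal A) (h : low A (d + 1) X = ⊥) : ⨅ k, lowPre d (x ^ k) X = ⊥ := by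
  rw [← le_bot_iff, ← h, le_low_iff]
  refine DL.of_quo hx ?_
  obtain ⟨c, hc⟩ := Ideal.exists_pow_inf_eq_pow_smul (Ideal.span {x}) (⨅ k, lowPre d (x ^ k) X)
  have h1 := hc (c + 1) c.le_succ
  rw [Nat.add_sub_cancel_left, pow_one] at h1
  refine DL.of_ker_le (f := (Submodule.mkQ (LinearMap.range (LinearMap.lsmul A X (x ^ (c + 1))))) ∘ₗ
    (⨅ k, lowPre d (x ^ k) X).subtype) ?_ (Submodule.mkQ_surjective _) ?_
  · rw [← le_low_iff]
    rintro _ ⟨u, rfl⟩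
    exact (Submodule.mem_iInf _).1 u.2 (c + 1)
  · rintro ⟨u, hu⟩ hu'
    rw [LinearMap.mem_ker, LinearMap.comp_apply, Submodule.mkQ_apply, Submodule.Quotient.mk_eq_zero]
      at hu'
    obtain ⟨v, hv⟩ := hu'
    have h2 : u ∈ Ideal.span {x} ^ (c + 1) • (⊤ : Submodule A X) ⊓ ⨅ k, lowPre d (x ^ k) X := by
      refine ⟨?_, hu⟩
      rw [← show x ^ (c + 1) • v = u from hv]
      exact Submodule.smul_mem_smul (Ideal.pow_mem_pow (Ideal.mem_span_singleton_self x) _) trivial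
    rw [h1] at h2
    have h3 := Submodule.smul_mono (le_refl (Ideal.span {x})) (inf_le_right :
      (Ideal.span {x} ^ c • (⊤ : Submodule A X)) ⊓ (⨅ k, lowPre d (x ^ k) X) ≤ _) h2
    rw [span_singleton_smul_eq_map] at h3
    obtain ⟨w, hw, hw'⟩ := h3
    rw [Submodule.ker_mkQ]
    exact ⟨⟨w, hw⟩, Subtype.ext hw'⟩

end Over

section Ascent

variable {A : Type} [CommRing A] [IsLocalRing A] [IsNoetherianRing A]
variable {N T : Type} [AddCommGroup N] [Module A N] [Module.Finite A N]
  [AddCommGroup T] [Module A T] [Module.Finite A T]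

theorem length_quotient_range_le_gam {f : N →ₗ[A] T} (hf : Function.Injective f) {x : A} {a : ℕ}
    (ha : maximalIdeal A ^ a • (⊤ : Submodule A (T ⧸ LinearMap.range f)) = ⊥)
    (hxa : x ∈ maximalIdeal A ^ a) (hx : ∀ u : T, x • u = 0 → u = 0) :
    Module.length A (T ⧸ LinearMap.range f) ≤ Module.length A (gam (A := A) (Quo x N)) := by
  have hmem : ∀ b ∈ maximalIdeal A ^ a, ∀ t : T, b • t ∈ LinearMap.range f := fun b hb t => by
    have h1 : b • (Submodule.Quotient.mk t : T ⧸ LinearMap.range f) ∈ (⊥ : Submodule A _) :=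
      ha ▸ Submodule.smul_mem_smul hb trivial
    rwa [Submodule.mem_bot, ← Submodule.Quotient.mk_smul, Submodule.Quotient.mk_eq_zero] at h1
  let g₀ : T →ₗ[A] N := (LinearEquiv.ofInjective f hf).symm.toLinearMap ∘ₗ
    (LinearMap.lsmul A T x).codRestrict (LinearMap.range f) fun t => hmem x hxa t
  have hg₀ : ∀ t, f (g₀ t) = x • t := fun t => by
    have := (LinearEquiv.ofInjective f hf).apply_symm_apply
      ((LinearMap.lsmul A T x).codRestrict (LinearMap.range f) (fun t => hmem x hxa t) t)
    exact congrArg Subtype.val this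
  let g : T →ₗ[A] Quo x N := Submodule.mkQ _ ∘ₗ g₀
  have hker : LinearMap.ker g ≤ LinearMap.ker (LinearMap.range f).mkQ := by
    intro t ht
    rw [LinearMap.mem_ker, LinearMap.comp_apply, Submodule.mkQ_apply,
      Submodule.Quotient.mk_eq_zero] at ht
    obtain ⟨v, hv⟩ := ht
    have h1 : x • (t - f v) = 0 := by
      rw [smul_sub, ← hg₀, ← hv, LinearMap.lsmul_apply, map_smul, sub_self]
    rw [Submodule.ker_mkQ]
    exact ⟨v, (sub_eq_zero.1 (hx _ h1)).symm⟩
  have h1 := length_range_le_of_ker_le hker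
  rw [Submodule.range_mkQ, Module.length_top] at h1
  refine h1.trans ?_
  have h2 : LinearMap.range g ≤ gam (A := A) (Quo x N) := by
    rintro _ ⟨t, rfl⟩
    refine ⟨a, fun b hb => ?_⟩
    rw [← map_smul, LinearMap.comp_apply, Submodule.mkQ_apply, Submodule.Quotient.mk_eq_zero]
    obtain ⟨v, hv⟩ := hmem b hb t
    refine ⟨v, hf ?_⟩
    rw [LinearMap.lsmul_apply, map_smul, hv, hg₀]
  exact Module.length_le_of_injective _ (Submodule.inclusion_injective h2)

/-- Passing from a submodule of `N` containing `y N` to the quotient. -/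
theorem PL.e1_quo_le_quotient {l : List A} {y : A} {d : ℕ} (h : PL l (Quo y N)) {F : Submodule A N}
    (hy : LinearMap.range (LinearMap.lsmul A N y) ≤ F)
    (hF : LocalCoh.DL A (d + 1) (F.map (LinearMap.range (LinearMap.lsmul A N y)).mkQ))
    (hd : d + 1 ≤ l.length) : e1 l (Quo y N) ≤ e1 l (N ⧸ F) := by
  obtain ⟨l', hl', hll, hlf⟩ := exists_list_of_DL hF (h.submodule _).2
  exact (h.e1_le_quotient _ hll hlf (by omega)).trans_eq
    (e1_congr (Submodule.quotientQuotientEquivQuotient _ F hy) l)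

theorem length_quotient_range_le_of_two {f : N →ₗ[A] T} (hf : Function.Injective f) {B : ℕ}
    (hT : DL A 3 T) (hlow : low A 2 T = ⊥) (hC : DL A 1 (T ⧸ LinearMap.range f))
    (hE : EvG A 2 (fun l => -(B : ℤ) ≤ e1 l N)) : Module.length A (T ⧸ LinearMap.range f) ≤ B := by
  have hgT : gam (A := A) T = ⊥ := by
    rw [← low_one, ← le_bot_iff, ← hlow]
    exact low_mono (by omega)
  obtain ⟨a, ha⟩ := hC.exists_pow
  have h1 : ∀ᶠ x in genF A, EvG A 1 fun l =>
      (-(B : ℤ) ≤ e1 (x :: l) N ∧ DS N ⊥ (x :: l)) ∧ PL (x :: l) N :=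
    (hE.and (EvG.DS 2 (⊥ : Submodule A N))).and (EvG.PL (hT.of_injective hf))
  obtain ⟨x, hxE, hxa, hx⟩ := (h1.and ((eventually_mem_pow (A := A) a).and
    (eventually_regular hgT))).exists
  have hxE' : ∀ᶠ y in genF A, (-(B : ℤ) ≤ e1 [x, y] N ∧ DS N ⊥ [x, y]) ∧ PL [x, y] N := hxE
  obtain ⟨y, ⟨hy1, hy2⟩, hy3⟩ := hxE'.exists
  refine (length_quotient_range_le_gam hf ha hxa hx).trans ?_
  have hxN : ∀ u : N, x • u = 0 → u = 0 := fun u hu => hf (by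
    rw [map_zero]; exact hx _ (by rw [← map_smul, hu, map_zero]))
  rw [hy3.e1_cons_eq_of_DS (le_refl 1) hy2 hxN, hy3.tail.e1_singleton] at hy1
  have h2 := ENat.natCast_toNat (length_gam_ne_top (A := A) (X := Quo x N))
  rw [← h2]
  have h3 : (Module.length A (gam (A := A) (Quo x N))).toNat ≤ B := by omega
  exact_mod_cast h3

theorem length_quotient_range_le_step [IsAdicComplete (maximalIdeal A) A] {s B : ℕ}
    (ih : ∀ {N T : Type} [AddCommGroup N] [Module A N] [Module.Finite A N]
      [AddCommGroup T] [Module A T] [Module.Finite A T] {f : N →ₗ[A] T}, Function.Injective f →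
      DL A (s + 3) T → low A (s + 2) T = ⊥ → DL A (s + 1) (T ⧸ LinearMap.range f) →
      EvG A (s + 2) (fun l => -(B : ℤ) ≤ e1 l N) →
      Module.length A (T ⧸ LinearMap.range f) ≤ B)
    {f : N →ₗ[A] T} (hf : Function.Injective f) (hT : DL A (s + 4) T) (hlow : low A (s + 3) T = ⊥)
    (hC : DL A (s + 2) (T ⧸ LinearMap.range f))
    (hE : EvG A (s + 3) (fun l => -(B : ℤ) ≤ e1 l N)) :
    Module.length A (T ⧸ LinearMap.range f) ≤ B := by
  have hgT : gam (A := A) T = ⊥ := by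
    rw [← low_one, ← le_bot_iff, ← hlow]
    exact low_mono (by omega)
  have hev : ∀ᶠ y in genF A, (∀ u : T, y • u = 0 → u = 0) ∧ DL A (s + 3) (Quo y T) ∧
      DL A (s + 1) (Quo y (T ⧸ LinearMap.range f)) ∧ EvG A (s + 2) (fun l =>
        (((-(B : ℤ) ≤ e1 (y :: l) N ∧ DS N ⊥ (y :: l)) ∧ PL (y :: l) N) ∧ l.length = s + 2)) := by
    have h1 := (hE.and (EvG.DS (s + 3) (⊥ : Submodule A N))).and (EvG.PL (hT.of_injective hf))
    filter_upwards [h1, eventually_regular hgT, eventually_DL hT (by omega),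
      eventually_DL hC (by omega)] with y hy1 hy2 hy3 hy4
    exact ⟨hy2, hy3, hy4, EvG.and hy1 (EvG.length _)⟩
  obtain ⟨x, hxm, hx⟩ := (eventually_mem.and (eventually_pow hev)).exists
  obtain ⟨k₀, hk₀⟩ := eventually_atTop.1 hx
  refine length_quotient_le_of_antitone (lowPre_pow_antitone (s + 2) x)
    (iInf_lowPre_pow hxm hlow) _ (k₀ := k₀) fun k hk => ?_
  obtain ⟨hreg, hkT, hkC, hkE⟩ := hk₀ k hk
  generalize x ^ k = y at hreg hkT hkC hkE
  have hle : (lowPre (s + 2) y T).comap f ≤ (lowPre (s + 2) y T).comap f := le_rfl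
  let g := Submodule.mapQ ((lowPre (s + 2) y T).comap f) (lowPre (s + 2) y T) f hle
  have hg : Function.Injective g := by
    rw [← LinearMap.ker_eq_bot, eq_bot_iff]
    intro u hu
    obtain ⟨u, rfl⟩ := Submodule.mkQ_surjective _ u
    rw [LinearMap.mem_ker, Submodule.mkQ_apply, Submodule.mapQ_apply,
      Submodule.Quotient.mk_eq_zero] at hu
    exact (Submodule.mem_bot A).2 ((Submodule.Quotient.mk_eq_zero _).2 hu)
  have hyF : LinearMap.range (LinearMap.lsmul A N y) ≤ (lowPre (s + 2) y T).comap f := by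
    rintro _ ⟨v, rfl⟩
    refine range_le_lowPre ⟨f v, ?_⟩
    simp
  let π : T →ₗ[A] (T ⧸ lowPre (s + 2) y T) ⧸ LinearMap.range g :=
    Submodule.mkQ _ ∘ₗ Submodule.mkQ _
  have hπ : Function.Surjective π :=
    (Submodule.mkQ_surjective _).comp (Submodule.mkQ_surjective _)
  have hfk : LinearMap.range f ⊔ lowPre (s + 2) y T = LinearMap.ker π := by
    refine le_antisymm (sup_le ?_ ?_) ?_
    · rintro _ ⟨n, rfl⟩
      exact (Submodule.Quotient.mk_eq_zero _).2 ⟨Submodule.Quotient.mk n, rfl⟩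
    · intro t ht
      have h1 : (Submodule.mkQ (lowPre (s + 2) y T)) t = 0 := (Submodule.Quotient.mk_eq_zero _).2 ht
      rw [LinearMap.mem_ker, LinearMap.comp_apply, h1, map_zero]
    · intro t ht
      obtain ⟨n, hn⟩ := (Submodule.Quotient.mk_eq_zero _).1 ht
      obtain ⟨n, rfl⟩ := Submodule.mkQ_surjective _ n
      have h1 : f n - t ∈ lowPre (s + 2) y T := (Submodule.Quotient.eq _).1 hn
      have := sub_mem (Submodule.mem_sup_left (S := LinearMap.range f) ⟨n, rfl⟩)
        (Submodule.mem_sup_right h1)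
      rwa [sub_sub_cancel] at this
  have hmain : Module.length A ((T ⧸ lowPre (s + 2) y T) ⧸ LinearMap.range g) ≤ B := by
    refine ih hg ?_ (low_quotient_lowPre _ y) ?_ ?_
    · exact hkT.of_surjective (f := Submodule.factor range_le_lowPre)
        (Submodule.factor_surjective _)
    · refine DL.of_ker_le (f := (Submodule.mkQ (LinearMap.range
        (LinearMap.lsmul A (T ⧸ LinearMap.range f) y))) ∘ₗ (LinearMap.range f).mkQ)
        (hkC.submodule _) hπ fun t ht => ?_
      rw [← hfk]
      obtain ⟨c, hc⟩ := (Submodule.Quotient.mk_eq_zero _).1 ht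
      obtain ⟨c, rfl⟩ := Submodule.mkQ_surjective _ c
      have h1 : y • c - t ∈ LinearMap.range f := (Submodule.Quotient.eq _).1 hc
      have := sub_mem (Submodule.mem_sup_right (T := lowPre (s + 2) y T)
        (range_le_lowPre ⟨c, rfl⟩)) (Submodule.mem_sup_left h1)
      rwa [LinearMap.lsmul_apply, sub_sub_cancel] at this
    · have hxN : ∀ u : N, y • u = 0 → u = 0 := fun u hu => hf (by
        rw [map_zero]; exact hreg _ (by rw [← map_smul, hu, map_zero]))
      refine hkE.mono fun l hl => ?_
      obtain ⟨⟨⟨hl1, hl2⟩, hl3⟩, hl4⟩ := hl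
      rw [hl3.e1_cons_eq_of_DS (by omega) hl2 hxN] at hl1
      refine hl1.trans (hl3.tail.e1_quo_le_quotient (d := s + 1) hyF ?_ (by omega))
      refine DL.of_mul_le_annihilator hC (DL_low (A := A) (X := Quo y T) (s + 2)) ?_
      refine Ideal.mul_le.2 fun a ha b hb => Module.mem_annihilator.2 ?_
      rintro ⟨_, u, hu, rfl⟩
      have h1 := congrArg Subtype.val (Module.mem_annihilator.1 hb ⟨_, hu⟩)
      obtain ⟨t, ht⟩ := (Submodule.Quotient.mk_eq_zero _).1 h1
      have h2 := Module.mem_annihilator.1 ha (Submodule.Quotient.mk t)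
      obtain ⟨w, hw⟩ := (Submodule.Quotient.mk_eq_zero _).1 h2
      refine Subtype.ext ((Submodule.Quotient.mk_eq_zero _).2 ⟨w, hf ?_⟩)
      have ht' : y • t = b • f u := ht
      have hw' : f w = a • t := hw
      change f (y • w) = f ((a * b) • u)
      rw [map_smul, hw', smul_comm, ht', map_smul, mul_smul]
  rw [hfk, (π.quotKerEquivOfSurjective hπ).length_eq]
  exact hmain

/-- Bounded first coefficients of `N` bound the length of `T / N` for the extensions `N ⊆ T` of
small codimension in an unmixed module `T`. -/
theorem length_quotient_range_le [IsAdicComplete (maximalIdeal A) A] (s B : ℕ) :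
    ∀ {N T : Type} [AddCommGroup N] [Module A N] [Module.Finite A N]
      [AddCommGroup T] [Module A T] [Module.Finite A T] {f : N →ₗ[A] T}, Function.Injective f →
      DL A (s + 3) T → low A (s + 2) T = ⊥ → DL A (s + 1) (T ⧸ LinearMap.range f) →
      EvG A (s + 2) (fun l => -(B : ℤ) ≤ e1 l N) →
      Module.length A (T ⧸ LinearMap.range f) ≤ B := by
  induction s with
  | zero => exact fun hf hT hlow hC hE => length_quotient_range_le_of_two hf hT hlow hC hE
  | succ s ih => exact fun hf hT hlow hC hE => length_quotient_range_le_step ih hf hT hlow hC hE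

end Ascent

end LocalCoh

namespace LocalCoh

open Filter

section Cohomology

theorem length_le_of_monotone {A : Type} [CommRing A] {Y : Type} [AddCommGroup Y] [Module A Y]
    {K : ℕ → Submodule A Y} (hK : Monotone K) (htop : ∀ y, ∃ k, y ∈ K k) {B k₀ : ℕ}
    (h : ∀ k ≥ k₀, Module.length A (K k) ≤ B) : Module.length A Y ≤ B := by
  have hne : {n : ℕ | ∃ k ≥ k₀, Module.length A (K k) = n}.Nonempty := by
    obtain ⟨n, hn⟩ := ENat.ne_top_iff_exists.1
      (ne_top_of_le_ne_top (ENat.natCast_ne_top B) (h k₀ le_rfl))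
    exact ⟨n, k₀, le_rfl, hn.symm⟩
  have hbdd : BddAbove {n : ℕ | ∃ k ≥ k₀, Module.length A (K k) = n} := by
    refine ⟨B, ?_⟩
    rintro n ⟨k, hk, hn⟩
    exact_mod_cast hn ▸ h k hk
  obtain ⟨k, hk, hkn⟩ := Nat.sSup_mem hne hbdd
  have heq : ∀ k' ≥ k, K k' ≤ K k := by
    intro k' hk'
    have hfin := ne_top_of_le_ne_top (ENat.natCast_ne_top B) (h k' (hk.trans hk'))
    obtain ⟨n, hn⟩ := ENat.ne_top_iff_exists.1 hfin
    have h1 : n ≤ sSup {n : ℕ | ∃ k ≥ k₀, Module.length A (K k) = n} :=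
      le_csSup hbdd ⟨k', hk.trans hk', hn.symm⟩
    have hfl := isFiniteLength_iff_isNoetherian_isArtinian.1 (Module.length_ne_top_iff.1 hfin)
    have := hfl.1
    have := hfl.2
    by_contra hne'
    have h2 := Submodule.length_lt (R := A) (N := (K k).comap (K k').subtype)
      fun h => hne' (Submodule.comap_subtype_eq_top.1 h)
    rw [(Submodule.comapSubtypeEquivOfLe (hK hk')).length_eq, hkn, ← hn] at h2
    exact absurd h1 (not_le.2 (by exact_mod_cast h2))
  have htop' : K k = ⊤ := by
    rw [eq_top_iff]
    intro y _
    obtain ⟨j, hj⟩ := htop y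
    exact heq (max j k) (le_max_right _ _) (hK (le_max_left _ _) hj)
  have h3 := h k hk
  rwa [htop', Module.length_top] at h3

end Cohomology

section Cohomology

variable {A : Type} [CommRing A] [IsLocalRing A] [IsNoetherianRing A]
variable {N S : Type} [AddCommGroup N] [Module A N] [Module.Finite A N]
  [AddCommGroup S] [Module A S] [Module.Finite A S]

theorem hl_zero_of_low {d : ℕ} (h : low A (d + 1) N = ⊥) : hl A 0 N = 0 := by
  have h1 : gam (A := A) N = ⊥ := by
    rw [← low_one, ← le_bot_iff, ← h]
    exact low_mono (by omega)
  rw [hl_zero_eq, Module.length_eq_zero_iff, h1]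
  infer_instance

/-- Cohomology of `S` from that of `S / x ^ k S` for large `k`. -/
theorem hl_succ_le_of_pow {x : A} (hxm : x ∈ maximalIdeal A) {i B k₀ : ℕ}
    (hreg : ∀ k ≥ k₀, ∀ u : S, x ^ k • u = 0 → u = 0)
    (h : ∀ k ≥ k₀, hl A i (Quo (x ^ k) S) ≤ B) : hl A (i + 1) S ≤ B := by
  refine length_le_of_monotone (K := fun k => LinearMap.ker (LinearMap.lsmul A (LC A (i + 1) S) (x ^ k)))
    ?_ ?_ (k₀ := k₀) fun k hk => ?_
  · intro a b hab u hu
    rw [LinearMap.mem_ker, LinearMap.lsmul_apply] at hu ⊢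
    rw [← Nat.sub_add_cancel hab, pow_add, mul_smul, hu, smul_zero]
  · intro y
    obtain ⟨n, hn⟩ := LC_torsion (A := A) (i := i + 1) y
    exact ⟨n, hn _ (Ideal.pow_mem_pow hxm n)⟩
  · refine (length_ker_smul_le (x ^ k) ?_ i).trans (h k hk)
    exact (injective_iff_map_eq_zero _).2 (hreg k hk)

/-- The extensions of `N` of small codimension. -/
structure Ext (A N S : Type) [CommRing A] [AddCommGroup N] [Module A N]
    [AddCommGroup S] [Module A S] (s : ℕ) (f : N →ₗ[A] S) : Prop where
  injective : Function.Injective f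
  dim : DL A (s + 3) S
  low_eq_bot : low A (s + 2) S = ⊥
  dim_quotient : DL A (s + 1) (S ⧸ LinearMap.range f)

theorem Ext.exists_of_regular {s : ℕ} {f : N →ₗ[A] S} (h : Ext A N S s f) {x : A}
    (hx : ∀ u : S, x • u = 0 → u = 0) :
    ∃ f' : N →ₗ[A] lowPre (s + 1) x S, Ext A N _ s f' ∧
      Module.length A (lowPre (s + 1) x S ⧸ LinearMap.range f') =
        Module.length A (S ⧸ LinearMap.range f) + Module.length A (low A (s + 1) (Quo x S)) := by
  let β : S →ₗ[A] lowPre (s + 1) x S :=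
    (LinearMap.lsmul A S x).codRestrict _ fun u => range_le_lowPre ⟨u, rfl⟩
  have hβ : Function.Injective β := (injective_iff_map_eq_zero _).2 fun u hu =>
    hx u (congrArg Subtype.val hu)
  have hle : LinearMap.range f ≤ (LinearMap.range (β ∘ₗ f)).comap β := by
    rintro _ ⟨n, rfl⟩
    exact ⟨n, rfl⟩
  let α := Submodule.mapQ _ _ β hle
  let δ : lowPre (s + 1) x S →ₗ[A] low A (s + 1) (Quo x S) :=
    (Submodule.mkQ _).restrict fun u hu => hu
  have hδ : LinearMap.range (β ∘ₗ f) ≤ LinearMap.ker δ := by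
    rintro _ ⟨n, rfl⟩
    exact Subtype.ext ((Submodule.Quotient.mk_eq_zero _).2 ⟨f n, rfl⟩)
  let γ := Submodule.liftQ _ δ hδ
  have hα : Function.Injective α := by
    refine (injective_iff_map_eq_zero _).2 fun u hu => ?_
    obtain ⟨u, rfl⟩ := Submodule.mkQ_surjective _ u
    obtain ⟨n, hn⟩ := (Submodule.Quotient.mk_eq_zero _).1 hu
    exact (Submodule.Quotient.mk_eq_zero _).2 ⟨n, hβ hn⟩
  have hγ : Function.Surjective γ := by
    rintro ⟨u, hu⟩
    obtain ⟨u, rfl⟩ := Submodule.mkQ_surjective _ u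
    exact ⟨Submodule.Quotient.mk ⟨u, hu⟩, rfl⟩
  have hex : Function.Exact α γ := by
    intro u
    constructor
    · intro hu
      obtain ⟨⟨u, hu'⟩, rfl⟩ := Submodule.mkQ_surjective _ u
      obtain ⟨v, hv⟩ := (Submodule.Quotient.mk_eq_zero _).1 (congrArg Subtype.val hu)
      exact ⟨Submodule.Quotient.mk v, congrArg _ (Subtype.ext hv)⟩
    · rintro ⟨v, rfl⟩
      obtain ⟨v, rfl⟩ := Submodule.mkQ_surjective _ v
      exact Subtype.ext ((Submodule.Quotient.mk_eq_zero _).2 ⟨v, rfl⟩)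
  exact ⟨β ∘ₗ f, ⟨hβ.comp h.injective, h.dim.submodule _,
    low_eq_bot_of_injective h.low_eq_bot (Submodule.subtype_injective _),
    DL.of_exact hex hα hγ h.dim_quotient (DL_low _)⟩,
    Module.length_eq_add_of_exact α γ hα hγ hex⟩

theorem Ext.eventually_le_e1 {s B : ℕ} {f : N →ₗ[A] S} (h : Ext A N S s f)
    (hlen : Module.length A (S ⧸ LinearMap.range f) ≠ ⊤)
    (hE : EvG A (s + 2) (fun l => -(B : ℤ) ≤ e1 l N)) :
    EvG A (s + 2) (fun l => -(B : ℤ) ≤ e1 l S) := by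
  refine ((hE.and (EvG.length _)).and (EvG.PL h.dim)).mono fun l hl => ?_
  obtain ⟨⟨h1, h2⟩, h3⟩ := hl
  rw [e1_congr (LinearEquiv.ofInjective f h.injective)] at h1
  exact h1.trans (h3.e1_le_of_finite_colength _ (h3.submodule _) hlen (by omega))

theorem hl_le_step [IsAdicComplete (maximalIdeal A) A] {s B : ℕ}
    (ih : ∀ {N : Type} [AddCommGroup N] [Module A N] [Module.Finite A N],
      DL A (s + 2) N → low A (s + 1) N = ⊥ → EvG A (s + 1) (fun l => -(B : ℤ) ≤ e1 l N) →
      ∀ i ≤ s, hl A i N ≤ B)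
    (hN : DL A (s + 3) N) (hlow : low A (s + 2) N = ⊥)
    (hE : EvG A (s + 2) (fun l => -(B : ℤ) ≤ e1 l N)) {i : ℕ} (hi : i ≤ s + 1) :
    hl A i N ≤ B := by
  let P : Set ℕ := {n | ∃ (S : Type) (_ : AddCommGroup S) (_ : Module A S) (_ : Module.Finite A S)
    (f : N →ₗ[A] S), Ext A N S s f ∧ Module.length A (S ⧸ LinearMap.range f) = n}
  have hne : P.Nonempty := by
    have : Subsingleton (N ⧸ LinearMap.range (LinearMap.id : N →ₗ[A] N)) := by
      rw [Submodule.Quotient.subsingleton_iff, LinearMap.range_id]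
    refine ⟨0, N, inferInstance, inferInstance, inferInstance, LinearMap.id,
      ⟨Function.injective_id, hN, hlow, (DL_zero_iff.2 this).mono (by omega)⟩, ?_⟩
    exact_mod_cast Module.length_eq_zero
  have hle : ∀ {S : Type} [AddCommGroup S] [Module A S] [Module.Finite A S] {f : N →ₗ[A] S},
      Ext A N S s f → Module.length A (S ⧸ LinearMap.range f) ≤ B := fun h =>
    length_quotient_range_le s B h.injective h.dim h.low_eq_bot h.dim_quotient hE
  have hbdd : BddAbove P := by
    refine ⟨B, ?_⟩
    rintro n ⟨S, _, _, _, f, h, hn⟩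
    exact_mod_cast hn ▸ hle h
  obtain ⟨S, _, _, _, f, h, hn⟩ := Nat.sSup_mem hne hbdd
  have hlen : Module.length A (S ⧸ LinearMap.range f) ≠ ⊤ :=
    ne_top_of_le_ne_top (ENat.natCast_ne_top B) (hle h)
  have hlowS : ∀ x : A, (∀ u : S, x • u = 0 → u = 0) → low A (s + 1) (Quo x S) = ⊥ := by
    intro x hx
    obtain ⟨f', h', hf'⟩ := h.exists_of_regular hx
    obtain ⟨n', hn'⟩ := ENat.ne_top_iff_exists.1
      (ne_top_of_le_ne_top (ENat.natCast_ne_top B) (hle h'))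
    have h1 : n' ≤ sSup P := le_csSup hbdd ⟨_, _, _, inferInstance, f', h', hn'.symm⟩
    rw [← hn', hn] at hf'
    have h2 : ((sSup P : ℕ) : ℕ∞) + Module.length A (low A (s + 1) (Quo x S)) ≤ (sSup P : ℕ) + 0 := by
      rw [← hf', add_zero]
      exact_mod_cast h1
    rw [ENat.add_le_add_iff_left (ENat.natCast_ne_top _), nonpos_iff_eq_zero,
      Module.length_eq_zero_iff] at h2
    exact (Submodule.subsingleton_iff_eq_bot).1 h2
  have hgS : gam (A := A) S = ⊥ := by
    rw [← low_one, ← le_bot_iff, ← h.low_eq_bot]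
    exact low_mono (by omega)
  have hev : ∀ᶠ y in genF A, (∀ u : S, y • u = 0 → u = 0) ∧ DL A (s + 2) (Quo y S) ∧
      EvG A (s + 1) (fun l => -(B : ℤ) ≤ e1 l (Quo y S)) := by
    have h1 : ∀ᶠ y in genF A, EvG A (s + 1) fun l => (((-(B : ℤ) ≤ e1 (y :: l) S ∧
        DS S ⊥ (y :: l)) ∧ PL (y :: l) S)) :=
      ((h.eventually_le_e1 hlen hE).and (EvG.DS (s + 2) (⊥ : Submodule A S))).and (EvG.PL h.dim)
    filter_upwards [h1, eventually_regular hgS, eventually_DL h.dim (by omega)] with y hy1 hy2 hy3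
    refine ⟨hy2, hy3, (hy1.and (EvG.length _)).mono fun l hl => ?_⟩
    obtain ⟨⟨⟨hl1, hl2⟩, hl3⟩, hl4⟩ := hl
    rwa [hl3.e1_cons_eq_of_DS (by omega) hl2 hy2] at hl1
  obtain ⟨x, hxm, hx⟩ := (eventually_mem.and (eventually_pow hev)).exists
  obtain ⟨k₀, hk₀⟩ := eventually_atTop.1 hx
  have h1 : hl A 1 S = 0 := by
    have := hl_succ_le_of_pow (B := 0) (i := 0) hxm (fun k hk => (hk₀ k hk).1) fun k hk =>
      (hl_zero_of_low (hlowS _ (hk₀ k hk).1)).le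
    simpa using this
  have h2 : ∀ j ≤ s, hl A (j + 1) S ≤ B := fun j hj =>
    hl_succ_le_of_pow hxm (fun k hk => (hk₀ k hk).1) fun k hk =>
      ih (hk₀ k hk).2.1 (hlowS _ (hk₀ k hk).1) (hk₀ k hk).2.2 j hj
  have hfg := LinearMap.exact_map_mkQ_range f
  match i, hi with
  | 0, _ => rw [hl_zero_of_low hlow]; exact zero_le
  | 1, _ =>
    refine (hl_left_le h.injective (Submodule.mkQ_surjective _) hfg 0).trans ?_
    rw [h1, add_zero, hl_zero_eq]
    exact (Module.length_le_of_injective _ (Submodule.subtype_injective _)).trans (hle h)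
  | j + 2, hj =>
    refine (hl_left_le h.injective (Submodule.mkQ_surjective _) hfg (j + 1)).trans ?_
    obtain ⟨k, hk⟩ := exists_pow_smul_eq_bot_of_length hlen
    rw [hl_of_torsion (gam_eq_top_of_pow_smul hk), zero_add]
    exact h2 _ (by omega)

/-- Bounded first coefficients of an unmixed module bound its local cohomology. -/
theorem hl_le [IsAdicComplete (maximalIdeal A) A] (s B : ℕ) :
    ∀ {N : Type} [AddCommGroup N] [Module A N] [Module.Finite A N],
      DL A (s + 2) N → low A (s + 1) N = ⊥ → EvG A (s + 1) (fun l => -(B : ℤ) ≤ e1 l N) →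
      ∀ i ≤ s, hl A i N ≤ B := by
  induction s with
  | zero =>
    intro N _ _ _ _ hlow _ i hi
    rw [Nat.le_zero.1 hi, hl_zero_of_low hlow]
    exact zero_le
  | succ s ih => exact fun hN hlow hE i hi => hl_le_step ih hN hlow hE hi

end Cohomology

end LocalCoh

namespace LocalCoh

open Filter

section Complete

variable {A : Type} [CommRing A] [IsLocalRing A] [IsNoetherianRing A]
variable {N : Type} [AddCommGroup N] [Module A N] [Module.Finite A N]

theorem PL.e1_eq_quotient_of_DL {s : ℕ} {l : List A} (h : PL l N) {V : Submodule A N}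
    (hV : LocalCoh.DL A (s + 1) V) (hl : l.length = s + 2) : e1 l N = e1 l (N ⧸ V) := by
  obtain ⟨l', hl', hll, hlf⟩ := exists_list_of_DL hV (h.submodule V).2
  exact h.e1_eq_quotient V hll hlf (by omega)

/-- The lower bound for the first coefficient in terms of the unmixed quotient. -/
theorem PL.le_e1_of_low {s : ℕ} {l : List A} (h : PL l N) (hlen : l.length = s + 2)
    (hU : LocalCoh.DL A (s + 1) (low A (s + 2) N)) {b : ℕ → ℕ}
    (hb : ∀ i ≤ s, hl A (i + 1) (N ⧸ low A (s + 2) N) ≤ b i) :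
    -∑ i ∈ Finset.range (s + 1), (s.choose i : ℤ) * b i ≤ e1 l N := by
  rw [h.e1_eq_quotient_of_DL hU hlen]
  exact (h.quotient _).le_e1 hlen hb

theorem of_forall_le_e1 [IsAdicComplete (maximalIdeal A) A] {s B : ℕ} (hN : DL A (s + 3) N)
    (h : ∀ l : List A, l.length = s + 2 → PL l N → -(B : ℤ) ≤ e1 l N) :
    DL A (s + 1) (low A (s + 2) N) ∧ ∀ i ≤ s + 1, hl A i (N ⧸ low A (s + 2) N) ≠ ⊤ := by
  have hU : DL A (s + 1) (low A (s + 2) N) := by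
    by_contra hU
    obtain ⟨l, hl, hPL, hlt⟩ := exists_e1_lt_of_submodule (d := s + 1) (by omega) hN
      (low A (s + 2) N) (DL_low _) hU B
    exact absurd (h l hl hPL) (not_le.2 hlt)
  refine ⟨hU, fun i hi => ne_top_of_le_ne_top (ENat.natCast_ne_top B) ?_⟩
  refine hl_le (s + 1) B (hN.quotient _) (low_quotient_low _) ?_ i hi
  refine ((EvG.PL hN).and (EvG.length _)).mono fun l hl => ?_
  rw [← hl.1.e1_eq_quotient_of_DL hU hl.2]
  exact h l hl.2 hl.1

end Complete

end LocalCoh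

namespace LocalCoh

open Filter

theorem factorPow_evalₐ {P : Type*} [CommRing P] (J : Ideal P) {m n : ℕ} (hle : m ≤ n)
    (x : AdicCompletion J P) :
    Ideal.Quotient.factor (Ideal.pow_le_pow_right hle) (AdicCompletion.evalₐ J n x) =
      AdicCompletion.evalₐ J m x := by
  obtain ⟨x, rfl⟩ := AdicCompletion.mk_surjective J P x
  rw [AdicCompletion.evalₐ_mk, AdicCompletion.evalₐ_mk, Ideal.Quotient.factor_mk]
  exact AdicCompletion.Ideal.mk_eq_mk _ hle x

theorem isNoetherianRing_adicCompletion {R : Type*} [CommRing R] [IsNoetherianRing R]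
    (I : Ideal R) : IsNoetherianRing (AdicCompletion I R) := by
  obtain ⟨n, a, ha⟩ := Submodule.fg_iff_exists_fin_generating_family.1
    (IsNoetherian.noetherian I)
  let A := AdicCompletion I R
  let I' : Ideal A := I.map (algebraMap R A)
  have : IsAdicComplete I' A := AdicCompletion.isAdicComplete_self I (IsNoetherian.noetherian I)
  let P := MvPolynomial (Fin n) R
  let J : Ideal P := MvPolynomial.idealOfVars (Fin n) R
  let B := AdicCompletion J P
  have : IsNoetherianRing B := isNoetherianRing_of_ringEquiv _
    (MvPowerSeries.toAdicCompletionAlgEquiv (Fin n) R).toRingEquiv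
  let K : Ideal B := J.map (algebraMap P B)
  have : IsAdicComplete K B :=
    AdicCompletion.isAdicComplete_self J (MvPolynomial.idealOfVars_fg (Fin n) R)
  let φ : P →ₐ[R] A := MvPolynomial.aeval fun i => algebraMap R A (a i)
  have hφJ : J.map φ.toRingHom = I' := by
    have h₂ : I.map (algebraMap R A) = (Ideal.span (Set.range a)).map (algebraMap R A) :=
      congrArg (Ideal.map (algebraMap R A)) ha.symm
    refine Eq.trans ?_ h₂.symm
    change (Ideal.span (Set.range MvPolynomial.X)).map φ.toRingHom = _
    rw [Ideal.map_span, Ideal.map_span, ← Set.range_comp, ← Set.range_comp]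
    congr 2
    funext i
    exact MvPolynomial.aeval_X _ i
  have hk (k : ℕ) : J ^ k ≤ (I' ^ k).comap φ.toRingHom := by
    rw [← Ideal.map_le_iff_le_comap, Ideal.map_pow, hφJ]
  let f (k : ℕ) : B →+* A ⧸ I' ^ k :=
    (Ideal.quotientMap (I' ^ k) φ.toRingHom (hk k)).comp (AdicCompletion.evalₐ J k).toRingHom
  have hf {m n : ℕ} (hle : m ≤ n) : (Ideal.Quotient.factorPow I' hle).comp (f n) = f m := by
    ext x
    change Ideal.Quotient.factorPow I' hle
      (Ideal.quotientMap (I' ^ n) φ.toRingHom (hk n) (AdicCompletion.evalₐ J n x)) =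
      Ideal.quotientMap (I' ^ m) φ.toRingHom (hk m) (AdicCompletion.evalₐ J m x)
    rw [← factorPow_evalₐ J hle]
    obtain ⟨y, hy⟩ := Ideal.Quotient.mk_surjective (AdicCompletion.evalₐ J n x)
    rw [← hy, Ideal.Quotient.factor_mk, Ideal.quotientMap_mk, Ideal.quotientMap_mk]
    rfl
  let g : B →+* A := IsAdicComplete.liftRingHom I' f hf
  have hg (p : P) : g (algebraMap P B p) = φ p := by
    rw [← sub_eq_zero]
    refine IsHausdorff.haus (I := I') inferInstance _ fun k => ?_
    rw [SModEq.zero, smul_eq_mul, Ideal.mul_top, ← Ideal.Quotient.eq]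
    refine (IsAdicComplete.mk_liftRingHom I' f hf k _).trans ?_
    change Ideal.quotientMap (I' ^ k) φ.toRingHom (hk k)
      (AdicCompletion.evalₐ J k (AdicCompletion.of J P p)) = _
    rw [AdicCompletion.evalₐ_of, Ideal.quotientMap_mk]
    rfl
  have hgK : K.map g = I' := by
    rw [← hφJ, Ideal.map_map]
    congr 1
    ext p <;> simp [hg]
  have : IsHausdorff (K.map g) A := by rw [hgK]; infer_instance
  refine isNoetherianRing_of_surjective B A g
    (surjective_of_mk_map_comp_surjective (I := K) g fun y => ?_)
  obtain ⟨y, rfl⟩ := Ideal.Quotient.mk_surjective y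
  obtain ⟨r, hr⟩ := Ideal.Quotient.mk_surjective (AdicCompletion.evalOneₐ I y)
  refine ⟨algebraMap P B (MvPolynomial.C r), ?_⟩
  rw [RingHom.comp_apply, hg, Ideal.Quotient.eq, hgK]
  change _ ∈ I.map (algebraMap R (AdicCompletion I R))
  rw [← AdicCompletion.ker_evalOneₐ_eq_map I (IsNoetherian.noetherian I), RingHom.mem_ker]
  change AdicCompletion.evalOneₐ I (φ (MvPolynomial.C r) - y) = 0
  rw [map_sub, ← hr]
  have : φ (MvPolynomial.C r) = algebraMap R A r := MvPolynomial.aeval_C _ _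
  rw [this, sub_eq_zero]
  rfl

end LocalCoh

namespace LocalCoh

open Filter

section

variable {R A M N : Type} [CommRing R] [CommRing A] [Algebra R A]
variable [AddCommGroup M] [Module R M] [AddCommGroup N] [Module R N] [Module A N]
  [IsScalarTower R A N]

theorem length_restrictScalars_eq (h : ∀ a : A, ∃ r : R, ∀ z : N, a • z = r • z) :
    Module.length R N = Module.length A N := by
  rw [Module.length, Module.length, WithBot.unbot_inj]
  refine (Order.krullDim_eq_of_orderIso
    { toFun := fun V : Submodule A N => V.restrictScalars R
      invFun := fun W =>
        { toAddSubmonoid := W.toAddSubmonoid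
          smul_mem' := fun a z hz => by
            obtain ⟨r, hr⟩ := h a
            rw [hr]
            exact W.smul_mem r hz }
      left_inv := fun _ => rfl
      right_inv := fun _ => rfl
      map_rel_iff' := Iff.rfl }).symm

variable [IsLocalRing R] [IsLocalRing A]

/-- `j : M → N` behaves like the map from a finite module to its completion. -/
structure IsCompletionMap (A : Type) [CommRing A] [Algebra R A] [IsLocalRing A] [Module A N]
    (j : M →ₗ[R] N) : Prop where
  maximalIdeal_eq : maximalIdeal A = (maximalIdeal R).map (algebraMap R A)
  span_range : Submodule.span A (Set.range j) = ⊤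
  mem_of_map_mem : ∀ (k : ℕ) (x : M), j x ∈ maximalIdeal A ^ k • (⊤ : Submodule A N) →
    x ∈ maximalIdeal R ^ k • (⊤ : Submodule R M)
  exists_sub_mem : ∀ (k : ℕ) (a : A), ∃ r : R, a - algebraMap R A r ∈ maximalIdeal A ^ k

namespace IsCompletionMap

variable {j : M →ₗ[R] N} (hj : IsCompletionMap A j)

theorem exists_sub_map_mem (hj : IsCompletionMap A j) (k : ℕ) {F : Submodule R M} {y : N}
    (hy : y ∈ Submodule.span A (j '' F)) :
    ∃ x ∈ F, y - j x ∈ maximalIdeal A ^ k • (⊤ : Submodule A N) := by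
  induction hy using Submodule.span_induction with
  | mem y hy =>
    obtain ⟨x, hx, rfl⟩ := hy
    exact ⟨x, hx, by simp⟩
  | zero => exact ⟨0, F.zero_mem, by simp⟩
  | add y z _ _ hy hz =>
    obtain ⟨x, hx, hxy⟩ := hy
    obtain ⟨w, hw, hwz⟩ := hz
    refine ⟨x + w, F.add_mem hx hw, ?_⟩
    rw [map_add, add_sub_add_comm]
    exact add_mem hxy hwz
  | smul a y _ hy =>
    obtain ⟨x, hx, hxy⟩ := hy
    obtain ⟨r, hr⟩ := hj.exists_sub_mem k a
    refine ⟨r • x, F.smul_mem r hx, ?_⟩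
    have : a • y - j (r • x) = a • (y - j x) + (a - algebraMap R A r) • j x := by
      rw [map_smul, smul_sub, sub_smul, algebraMap_smul]
      abel
    rw [this]
    exact add_mem (Submodule.smul_mem _ _ hxy) (Submodule.smul_mem_smul hr trivial)

theorem map_smul_top (hj : IsCompletionMap A j) (I : Ideal R) :
    I.map (algebraMap R A) • (⊤ : Submodule A N) =
      Submodule.span A (j '' (I • (⊤ : Submodule R M) : Submodule R M)) := by
  refine le_antisymm ?_ (Submodule.span_le.2 ?_)
  · rw [← hj.span_range, Ideal.map, Submodule.span_smul_span, Submodule.span_le]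
    rintro _ ⟨_, ⟨a, ha, rfl⟩, _, ⟨x, rfl⟩, rfl⟩
    refine Submodule.subset_span ⟨a • x, Submodule.smul_mem_smul ha trivial, ?_⟩
    simp [algebraMap_smul]
  · rintro _ ⟨x, hx, rfl⟩
    induction hx using Submodule.smul_induction_on' with
    | smul a ha x _ =>
      rw [map_smul, ← algebraMap_smul A a (j x)]
      exact Submodule.smul_mem_smul (Ideal.mem_map_of_mem _ ha) trivial
    | add x _ y _ hx hy =>
      rw [map_add]
      exact add_mem hx hy

theorem pow_smul_top (hj : IsCompletionMap A j) (k : ℕ) :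
    maximalIdeal A ^ k • (⊤ : Submodule A N) =
      Submodule.span A (j '' (maximalIdeal R ^ k • (⊤ : Submodule R M) : Submodule R M)) := by
  rw [hj.maximalIdeal_eq, ← Ideal.map_pow, hj.map_smul_top]

theorem length_quotient_eq (hj : IsCompletionMap A j) {k : ℕ} {F : Submodule R M}
    (hF : maximalIdeal R ^ k • (⊤ : Submodule R M) ≤ F) :
    Module.length R (M ⧸ F) = Module.length A (N ⧸ Submodule.span A (j '' F)) := by
  set F' := Submodule.span A (j '' F) with hF'
  have hk : maximalIdeal A ^ k • (⊤ : Submodule A N) ≤ F' := by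
    rw [hj.pow_smul_top]
    exact Submodule.span_mono (Set.image_mono hF)
  have hle : F ≤ (F'.restrictScalars R).comap j := fun x hx =>
    Submodule.subset_span ⟨x, hx, rfl⟩
  let f : (M ⧸ F) →ₗ[R] (N ⧸ F'.restrictScalars R) := Submodule.mapQ _ _ j hle
  have hf : Function.Bijective f := by
    constructor
    · rw [← LinearMap.ker_eq_bot, eq_bot_iff]
      intro x hx
      obtain ⟨x, rfl⟩ := Submodule.Quotient.mk_surjective _ x
      rw [LinearMap.mem_ker, Submodule.mapQ_apply, Submodule.Quotient.mk_eq_zero] at hx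
      obtain ⟨w, hw, hxw⟩ := hj.exists_sub_map_mem k (F := F) hx
      rw [← map_sub] at hxw
      rw [Submodule.mem_bot, Submodule.Quotient.mk_eq_zero]
      simpa using F.add_mem (hF (hj.mem_of_map_mem k _ hxw)) hw
    · intro y
      obtain ⟨y, rfl⟩ := Submodule.Quotient.mk_surjective _ y
      obtain ⟨x, -, hx⟩ := hj.exists_sub_map_mem k (F := ⊤) (y := y) (by
        rw [Submodule.top_coe, Set.image_univ, hj.span_range]
        trivial)
      refine ⟨Submodule.Quotient.mk x, ?_⟩
      rw [Submodule.mapQ_apply, eq_comm, Submodule.Quotient.eq]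
      exact hk hx
  rw [(LinearEquiv.ofBijective f hf).length_eq]
  refine (((Submodule.Quotient.restrictScalarsEquiv R F')).length_eq).trans
    (length_restrictScalars_eq fun a => ?_)
  obtain ⟨r, hr⟩ := hj.exists_sub_mem k a
  refine ⟨r, fun z => ?_⟩
  obtain ⟨z, rfl⟩ := Submodule.Quotient.mk_surjective _ z
  rw [← Submodule.Quotient.mk_smul, ← Submodule.Quotient.mk_smul, Submodule.Quotient.eq,
    ← algebraMap_smul A r, ← sub_smul]
  exact hk (Submodule.smul_mem_smul hr trivial)

theorem exists_pow_smul_le {Q : Ideal R} {n : ℕ} (h : hf Q M n ≠ ⊤) :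
    ∃ k, maximalIdeal R ^ k • (⊤ : Submodule R M) ≤ Q ^ n • ⊤ := by
  obtain ⟨k, hk⟩ := exists_pow_smul_eq_bot_of_length h
  refine ⟨k, ?_⟩
  rw [← Submodule.ker_mkQ (Q ^ n • (⊤ : Submodule R M)), LinearMap.le_ker_iff_map,
    Submodule.map_smul'', eq_bot_iff, ← hk]
  exact Submodule.smul_mono le_rfl le_top

theorem hf_map (hj : IsCompletionMap A j) {Q : Ideal R} {n : ℕ} (h : hf Q M n ≠ ⊤) :
    hf Q M n = hf (Q.map (algebraMap R A)) N n := by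
  obtain ⟨k, hk⟩ := exists_pow_smul_le h
  rw [hf, hf, ← Ideal.map_pow, hj.map_smul_top, hj.length_quotient_eq hk]

theorem PL_map (hj : IsCompletionMap A j) {l : List R} (h : PL l M) :
    PL (l.map (algebraMap R A)) N := by
  rw [PL, ← Ideal.map_ofList]
  exact ⟨hj.maximalIdeal_eq ▸ Ideal.map_mono h.1, hj.hf_map h.2 ▸ h.2⟩

theorem HC_map (hj : IsCompletionMap A j) {l : List R} (h : PL l M) {d : ℕ} {s : ℕ → ℤ}
    (hs : HC (Ideal.ofList l) M d s) : HC (Ideal.ofList (l.map (algebraMap R A))) N d s := by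
  rw [← Ideal.map_ofList]
  exact hs.congr (.of_forall fun n => hj.hf_map (hf_ne_top l h.2 n))

variable [IsNoetherianRing R] [IsNoetherianRing A] [Module.Finite R M] [Module.Finite A N]

theorem PL_of_map (hj : IsCompletionMap A j) {l : List R} (h : PL (l.map (algebraMap R A)) N) :
    PL l M := by
  rw [PL, ← Ideal.map_ofList] at h
  constructor
  · intro x hx
    by_contra hx'
    rw [mem_maximalIdeal, mem_nonunits_iff, not_not] at hx'
    exact (mem_nonunits_iff.1 ((mem_maximalIdeal _).1 (h.1 (Ideal.mem_map_of_mem _ hx))))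
      (hx'.map _)
  · obtain ⟨k, hk⟩ := exists_pow_smul_le h.2
    rw [pow_one, hj.map_smul_top] at hk
    rw [hf_one]
    refine length_ne_top_of_pow_smul (k := k) ?_
    rw [← Submodule.range_mkQ, LinearMap.range_eq_map, ← Submodule.map_smul'',
      ← LinearMap.le_ker_iff_map, Submodule.ker_mkQ]
    refine fun x hx => mem_of_forall_mem_sup_pow fun n => ?_
    have h1 : j x ∈ maximalIdeal A ^ k • (⊤ : Submodule A N) := by
      rw [hj.pow_smul_top]
      exact Submodule.subset_span ⟨x, hx, rfl⟩
    obtain ⟨w, hw, hxw⟩ := hj.exists_sub_map_mem n (hk h1)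
    rw [← map_sub] at hxw
    rw [← sub_add_cancel x w, add_comm]
    exact Submodule.add_mem_sup hw (hj.mem_of_map_mem n _ hxw)

end IsCompletionMap

end

end LocalCoh

namespace LocalCoh

open Filter

section Approximation

variable {A N : Type} [CommRing A] [AddCommGroup N] [Module A N]

theorem pow_smul_top_congr {Q Q' : Ideal A} (h : Q • (⊤ : Submodule A N) = Q' • ⊤) (n : ℕ) :
    Q ^ n • (⊤ : Submodule A N) = Q' ^ n • ⊤ := by
  induction n with
  | zero => simp
  | succ n ih =>
    rw [pow_succ, mul_smul, h, ← mul_smul, mul_comm, mul_smul, ih, ← mul_smul, ← pow_succ']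

theorem hf_congr_of_smul_top {Q Q' : Ideal A} (h : Q • (⊤ : Submodule A N) = Q' • ⊤) (n : ℕ) :
    hf Q N n = hf Q' N n := by
  rw [hf, hf, pow_smul_top_congr h]

theorem ofList_map_le {l : List A} {J : Ideal A} {g : A → A} (hg : ∀ a, a - g a ∈ J) :
    Ideal.ofList (l.map g) ≤ Ideal.ofList l ⊔ J := by
  refine Ideal.span_le.2 fun x hx => ?_
  obtain ⟨a, ha, rfl⟩ := List.mem_map.1 hx
  rw [← sub_sub_cancel a (g a)]
  exact sub_mem (Ideal.mem_sup_left (Ideal.subset_span ha)) (Ideal.mem_sup_right (hg a))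

theorem ofList_le_map {l : List A} {J : Ideal A} {g : A → A} (hg : ∀ a, a - g a ∈ J) :
    Ideal.ofList l ≤ Ideal.ofList (l.map g) ⊔ J := by
  refine Ideal.span_le.2 fun a ha => ?_
  rw [← add_sub_cancel (g a) a]
  exact add_mem (Ideal.mem_sup_left (Ideal.subset_span (List.mem_map_of_mem ha)))
    (Ideal.mem_sup_right (hg a))

variable [IsLocalRing A] [IsNoetherianRing A] [Module.Finite A N]

theorem PL.exists_approx {l : List A} (h : PL l N) : ∃ k : ℕ, ∀ g : A → A,
    (∀ a, a - g a ∈ maximalIdeal A ^ k) → PL (l.map g) N ∧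
      (1 ≤ l.length → e1 (l.map g) N = e1 l N) := by
  obtain ⟨k, hk⟩ := IsCompletionMap.exists_pow_smul_le h.2
  rw [pow_one] at hk
  refine ⟨k + 1, fun g hg => ?_⟩
  have hk1 : maximalIdeal A ^ (k + 1) • (⊤ : Submodule A N) ≤
      maximalIdeal A • Ideal.ofList l • (⊤ : Submodule A N) := by
    rw [pow_succ', mul_smul]
    exact Submodule.smul_mono le_rfl hk
  have hQ : Ideal.ofList (l.map g) • (⊤ : Submodule A N) = Ideal.ofList l • ⊤ := by
    refine le_antisymm ?_ ?_
    · refine (Submodule.smul_mono_left (ofList_map_le hg)).trans ?_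
      rw [Submodule.sup_smul]
      exact sup_le le_rfl (hk1.trans Submodule.smul_le_right)
    · refine Submodule.le_of_le_smul_of_le_jacobson_bot (I := maximalIdeal A)
        (IsNoetherian.noetherian _) (IsLocalRing.jacobson_eq_maximalIdeal ⊥ bot_ne_top).ge ?_
      refine (Submodule.smul_mono_left (ofList_le_map hg)).trans ?_
      rw [Submodule.sup_smul]
      exact sup_le_sup le_rfl hk1
  have hPL : PL (l.map g) N := by
    refine ⟨(ofList_map_le hg).trans (sup_le h.1 (Ideal.pow_le_self k.succ_ne_zero)), ?_⟩
    rw [hf_congr_of_smul_top hQ]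
    exact h.2
  refine ⟨hPL, fun hl => ?_⟩
  obtain ⟨s, hs, -⟩ := h.exists_HC
  rw [hs.e1_eq hl]
  refine HC.e1_eq ?_ (by simpa using hl)
  rw [List.length_map]
  exact hs.congr (.of_forall fun n => (hf_congr_of_smul_top hQ n).symm)

end Approximation

section Completion

variable {R A M N : Type} [CommRing R] [CommRing A] [Algebra R A]
  [AddCommGroup M] [Module R M] [AddCommGroup N] [Module R N] [Module A N]
  [IsScalarTower R A N] [IsLocalRing R] [IsLocalRing A]
  [IsNoetherianRing R] [IsNoetherianRing A] [Module.Finite R M] [Module.Finite A N]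

namespace IsCompletionMap

variable {j : M →ₗ[R] N}

theorem exists_PL_e1_eq (hj : IsCompletionMap A j) {l : List A} (h : PL l N) :
    ∃ l' : List R, l'.length = l.length ∧ PL l' M ∧
      (1 ≤ l.length → e1 (l'.map (algebraMap R A)) N = e1 l N) := by
  obtain ⟨k, hk⟩ := h.exists_approx
  choose g hg using hj.exists_sub_mem k
  have := hk (fun a => algebraMap R A (g a)) hg
  have hmap : l.map (fun a => algebraMap R A (g a)) = (l.map g).map (algebraMap R A) := by
    rw [List.map_map]
    rfl
  rw [hmap] at this
  exact ⟨l.map g, by simp, hj.PL_of_map this.1, this.2⟩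

theorem DL_iff (hj : IsCompletionMap A j) {d : ℕ} (hd : 1 ≤ d) : DL A d N ↔ DL R d M := by
  obtain ⟨d, rfl⟩ := Nat.exists_eq_add_of_le' hd
  constructor
  · intro h
    obtain ⟨l, rfl, hl⟩ := exists_PL_of_DL h
    obtain ⟨l', hl', hPL, -⟩ := hj.exists_PL_e1_eq hl
    exact hl' ▸ hPL.DL
  · intro h
    obtain ⟨l, rfl, hl⟩ := exists_PL_of_DL h
    simpa using (hj.PL_map hl).DL

end IsCompletionMap

end Completion

section AdicCompletion

variable (R : Type) [CommRing R] [IsLocalRing R] [IsNoetherianRing R]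
  (M : Type) [AddCommGroup M] [Module R M] [Module.Finite R M]

theorem module_finite_adicCompletion (I : Ideal R) :
    Module.Finite (AdicCompletion I R) (AdicCompletion I M) :=
  Module.Finite.equiv (AdicCompletion.ofTensorProductEquivOfFiniteNoetherian I M)

theorem isCompletionMap_of : IsCompletionMap (AdicCompletion (maximalIdeal R) R)
    (AdicCompletion.of (maximalIdeal R) M) where
  maximalIdeal_eq := AdicCompletion.maximalIdeal_eq_map
  span_range := by
    rw [eq_top_iff]
    rintro y -
    obtain ⟨t, rfl⟩ := AdicCompletion.ofTensorProduct_surjective_of_finite (maximalIdeal R) M y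
    induction t using TensorProduct.induction_on with
    | zero => simp
    | tmul a x =>
      rw [AdicCompletion.ofTensorProduct_tmul]
      exact Submodule.smul_mem _ _ (Submodule.subset_span ⟨x, rfl⟩)
    | add a b ha hb =>
      rw [map_add]
      exact add_mem ha hb
  mem_of_map_mem k x hx := by
    have key : ∀ y ∈ maximalIdeal (AdicCompletion (maximalIdeal R) R) ^ k •
        (⊤ : Submodule (AdicCompletion (maximalIdeal R) R) (AdicCompletion (maximalIdeal R) M)),
        AdicCompletion.eval (maximalIdeal R) M k y = 0 := by
      intro y hy
      have : y ∈ (maximalIdeal R ^ k • ⊤ : Submodule R (AdicCompletion (maximalIdeal R) M)) := by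
        rw [AdicCompletion.maximalIdeal_eq_map, ← Ideal.map_pow] at hy
        rwa [← Submodule.restrictScalars_mem R, Ideal.smul_restrictScalars,
          Submodule.restrictScalars_top] at hy
      rw [AdicCompletion.pow_smul_top_eq_ker_eval (IsNoetherian.noetherian _)] at this
      exact this
    have := key _ hx
    rwa [AdicCompletion.eval_of, Submodule.mkQ_apply, Submodule.Quotient.mk_eq_zero] at this
  exists_sub_mem k a := by
    obtain ⟨r, hr⟩ := Submodule.Quotient.mk_surjective _
      (AdicCompletion.eval (maximalIdeal R) R k a)
    refine ⟨r, ?_⟩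
    rw [AdicCompletion.maximalIdeal_eq_map, ← Ideal.map_pow, ← Submodule.restrictScalars_mem R,
      ← Ideal.smul_top_eq_map, AdicCompletion.pow_smul_top_eq_ker_eval (IsNoetherian.noetherian _),
      LinearMap.mem_ker, map_sub, sub_eq_zero, ← hr]
    rfl

end AdicCompletion

end LocalCoh

namespace LocalCoh

open Filter

section

variable {R M : Type} [CommRing R] [AddCommGroup M] [Module R M]

theorem hasHilbCoeffs_iff {Q : Ideal R} {t : ℕ} {s : ℕ → ℤ} :
    HasHilbCoeffs R Q M t s ↔ HC Q M t s := by
  rw [HC, eventually_atTop]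
  have (n l : ℕ) : mLength R (M ⧸ (Q ^ (n + 1) • (⊤ : Submodule R M))) = ((l : ℕ∞) : WithBot ℕ∞) ↔
      hf Q M (n + 1) = l := by
    rw [mLength, ← Module.coe_length, WithBot.coe_inj, hf]
  exact exists_congr fun N => forall₂_congr fun n _ => exists_congr fun l =>
    and_congr_left fun _ => this n l

theorem lt_add_one_iff_of_natCast {a : WithBot ℕ∞} {d : ℕ} :
    a < ((d + 1 : ℕ) : ℕ∞) ↔ a ≤ (d : ℕ∞) := by
  induction a with
  | bot => simp
  | coe a =>
    rw [WithBot.coe_lt_coe, WithBot.coe_le_coe, Nat.cast_add_one, ENat.lt_add_one_iff (by simp)]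

variable [IsLocalRing R]

theorem PL.isParamIdeal {l : List R} (h : PL l M) : IsParamIdeal R (Ideal.ofList l) M l.length := by
  refine ⟨h.1, ⟨l.get, ?_⟩, ?_⟩
  · rw [Ideal.ofList, Set.range_list_get]
  · rw [← Module.length_ne_top_iff, ← hf_one]
    exact h.2

theorem _root_.IsParamIdeal.exists_PL {Q : Ideal R} {r : ℕ} (h : IsParamIdeal R Q M r) :
    ∃ l : List R, l.length = r ∧ PL l M ∧ Ideal.ofList l = Q := by
  obtain ⟨hQ, ⟨x, rfl⟩, hlen⟩ := h
  have : Ideal.ofList (List.ofFn x) = Ideal.span (Set.range x) := by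
    simp [Ideal.ofList, Set.range, List.mem_ofFn]
  refine ⟨List.ofFn x, by simp, ?_, this⟩
  rw [PL, this, hf_one, Module.length_ne_top_iff]
  exact ⟨hQ, hlen⟩

theorem DL_succ_iff_mDim [IsNoetherianRing R] [Module.Finite R M] {d : ℕ} :
    DL R (d + 1) M ↔ mDim R M ≤ (d : ℕ∞) := by
  rw [DL_iff_mDim, lt_add_one_iff_of_natCast]

theorem unmixedComp_eq_low [IsNoetherianRing R] [Module.Finite R M] {d : ℕ}
    (h : mDim R M = (d : ℕ∞)) : unmixedComp R M = low R d M := by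
  rw [unmixedComp, low, h]
  congr 1
  ext V
  exact DL_iff_mDim.symm

end

section

variable {R A M N : Type} [CommRing R] [CommRing A] [Algebra R A]
  [AddCommGroup M] [Module R M] [AddCommGroup N] [Module R N] [Module A N]
  [IsScalarTower R A N] [IsLocalRing R] [IsLocalRing A]
  [IsNoetherianRing R] [IsNoetherianRing A] [Module.Finite R M] [Module.Finite A N]

namespace IsCompletionMap

variable {j : M →ₗ[R] N}

theorem mDim_eq (hj : IsCompletionMap A j) {d : ℕ} (hd : 1 ≤ d) (h : mDim R M = (d : ℕ∞)) :
    mDim A N = (d : ℕ∞) := by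
  refine le_antisymm ?_ (not_lt.1 ?_)
  · rw [← DL_succ_iff_mDim, hj.DL_iff (by omega), DL_succ_iff_mDim, h]
  · rw [← DL_iff_mDim, hj.DL_iff hd, DL_iff_mDim, h]
    exact lt_irrefl _

theorem exists_PL_of_hasHilbCoeffs (hj : IsCompletionMap A j) {Q : Ideal R} {r : ℕ} (hr : 1 ≤ r)
    {e : ℕ → ℤ} (hQ : IsParamIdeal R Q M r) (he : HasHilbCoeffs R Q M r e) :
    ∃ l : List A, l.length = r ∧ PL l N ∧ e1 l N = e 1 := by
  obtain ⟨l, rfl, hl, rfl⟩ := hQ.exists_PL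
  refine ⟨l.map (algebraMap R A), by simp, hj.PL_map hl, HC.e1_eq ?_ (by simpa using hr)⟩
  rw [List.length_map]
  exact hj.HC_map hl (hasHilbCoeffs_iff.1 he)

theorem e1_mem_Lambda (hj : IsCompletionMap A j) {l : List A} (hl : 1 ≤ l.length) (h : PL l N) :
    e1 l N ∈ Lambda R M l.length := by
  obtain ⟨l', hl', hPL, he⟩ := hj.exists_PL_e1_eq h
  obtain ⟨s, hs, -⟩ := hPL.exists_HC
  refine ⟨Ideal.ofList l', s, hl' ▸ hPL.isParamIdeal, hasHilbCoeffs_iff.2 (hl' ▸ hs), ?_⟩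
  rw [← he hl]
  refine (HC.e1_eq ?_ (by simpa [hl'] using hl)).symm
  rw [List.length_map]
  exact hj.HC_map hPL hs

theorem finite_Lambda_iff (hj : IsCompletionMap A j) [IsAdicComplete (maximalIdeal A) A] {s : ℕ}
    (h : mDim R M = ((s + 2 : ℕ) : ℕ∞)) :
    (Lambda R M (s + 2)).Finite ↔ mDim A (unmixedComp A N) ≤ (s : ℕ∞) ∧
      IsGenCM A (N ⧸ unmixedComp A N) (s + 2) := by
  have hN := hj.mDim_eq (by omega) h
  have hgen : IsGenCM A (N ⧸ low A (s + 2) N) (s + 2) ↔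
      ∀ i ≤ s + 1, hl A i (N ⧸ low A (s + 2) N) ≠ ⊤ :=
    ⟨fun h i hi => Module.length_ne_top_iff.2 (h i (by omega)),
      fun h i hi => Module.length_ne_top_iff.1 (h i (by omega))⟩
  rw [unmixedComp_eq_low hN, ← DL_succ_iff_mDim, hgen]
  constructor
  · intro hfin
    obtain ⟨B, hB⟩ := hfin.bddBelow
    refine of_forall_le_e1 (B := B.natAbs) (DL_succ_iff_mDim.2 hN.le) fun l hl hPL => ?_
    have := hB (hl ▸ hj.e1_mem_Lambda (by omega) hPL)
    omega
  · rintro ⟨hU, hfin⟩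
    refine (Set.finite_Icc (-∑ i ∈ Finset.range (s + 1), (s.choose i : ℤ) *
      (hl A (i + 1) (N ⧸ low A (s + 2) N)).toNat) 0).subset ?_
    rintro _ ⟨Q, e, hQ, he, rfl⟩
    obtain ⟨l, hlen, hPL, hle⟩ := hj.exists_PL_of_hasHilbCoeffs (by omega) hQ he
    rw [← hle]
    exact ⟨hPL.le_e1_of_low hlen hU fun i hi => (ENat.natCast_toNat (hfin _ (by omega))).ge,
      hPL.e1_nonpos (by omega)⟩

theorem e_one_bounds (hj : IsCompletionMap A j) {s : ℕ}
    (h : mDim R M = ((s + 2 : ℕ) : ℕ∞)) (hU : mDim A (unmixedComp A N) ≤ (s : ℕ∞))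
    {Q : Ideal R} {e : ℕ → ℤ} (hQ : IsParamIdeal R Q M (s + 2))
    (he : HasHilbCoeffs R Q M (s + 2) e) {b : ℕ → ℕ}
    (hb : ∀ i ≤ s, mLength A (LC A (i + 1) (N ⧸ unmixedComp A N)) = ((b i : ℕ) : ℕ∞)) :
    e 1 ≤ 0 ∧ -∑ i ∈ Finset.range (s + 1), (s.choose i : ℤ) * b i ≤ e 1 := by
  rw [unmixedComp_eq_low (hj.mDim_eq (by omega) h)] at hU hb
  obtain ⟨l, hlen, hPL, hle⟩ := hj.exists_PL_of_hasHilbCoeffs (by omega) hQ he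
  rw [← hle]
  refine ⟨hPL.e1_nonpos (by omega), hPL.le_e1_of_low hlen (DL_succ_iff_mDim.2 hU) fun i hi => ?_⟩
  have := hb i hi
  rw [mLength, ← Module.coe_length, WithBot.coe_inj] at this
  exact this.le

end IsCompletionMap

end

end LocalCoh

theorem statement13 (R : Type) [CommRing R] [IsLocalRing R] [IsNoetherianRing R]
    (M : Type) [AddCommGroup M] [Module R M] [Module.Finite R M]
    (r : ℕ) (hr : mDim R M = (r : ℕ∞)) (hr2 : 2 ≤ r)
    [IsLocalRing (AdicCompletion (maximalIdeal R) R)] :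
    ((Lambda R M r).Finite ↔
      (mDim (AdicCompletion (maximalIdeal R) R)
          ↥(unmixedComp (AdicCompletion (maximalIdeal R) R)
            (AdicCompletion (maximalIdeal R) M)) ≤ ((r - 2 : ℕ) : ℕ∞) ∧
        IsGenCM (AdicCompletion (maximalIdeal R) R)
          (AdicCompletion (maximalIdeal R) M ⧸
            unmixedComp (AdicCompletion (maximalIdeal R) R)
              (AdicCompletion (maximalIdeal R) M)) r)) ∧
    ((Lambda R M r).Finite →
      ∀ (Q : Ideal R) (e : ℕ → ℤ), IsParamIdeal R Q M r →
        HasHilbCoeffs R Q M r e →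
      ∀ h : ℕ → ℕ,
        (∀ i, 1 ≤ i → i ≤ r - 1 →
          mLength (AdicCompletion (maximalIdeal R) R)
            ↥(LC (AdicCompletion (maximalIdeal R) R) i
              (AdicCompletion (maximalIdeal R) M ⧸
                unmixedComp (AdicCompletion (maximalIdeal R) R)
                  (AdicCompletion (maximalIdeal R) M))) = ((h i : ℕ) : ℕ∞)) →
        e 1 ≤ 0 ∧
          -(∑ i ∈ Finset.Icc 1 (r - 1),
              (((r - 2).choose (i - 1) : ℤ) * (h i : ℤ))) ≤ e 1) := by
  have := LocalCoh.isNoetherianRing_adicCompletion (maximalIdeal R)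
  have := LocalCoh.module_finite_adicCompletion R M (maximalIdeal R)
  have hj := LocalCoh.isCompletionMap_of R M
  obtain ⟨s, rfl⟩ := Nat.exists_eq_add_of_le' hr2
  have hiff := hj.finite_Lambda_iff hr
  refine ⟨hiff, fun hfin Q e hQ he h hh => ?_⟩
  have := hj.e_one_bounds hr (hiff.1 hfin).1 hQ he (b := fun i => h (i + 1))
    fun i hi => hh (i + 1) (by omega) (by omega)
  rw [Finset.range_eq_Ico] at this
  exact (Finset.sum_Ico_add' (fun i => (s.choose (i - 1) : ℤ) * (h i : ℤ)) 0 (s + 1) 1) ▸ this
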